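/- If (C,D,h) ∈ W_n and T is a homotopy taming set for C, then h(T) is a homotopy taming set for D. (Theorem 3.5) -/

import Mathlib

noncomputable section

open Metric Set unitInterval

/-- The ambient Euclidean space `ℝ^{n+1}` in which the sphere `S^n` lives. -/
abbrev Amb (n : ℕ) := EuclideanSpace ℝ (Fin (n + 1))

/-- The unit sphere `S^n` inside `ℝ^{n+1}`. -/
def Sph (n : ℕ) : Set (Amb n) := Metric.sphere 0 1

/-- A crumpled `n`-cube: the union of the image `bd` of a topological embedding of the
sphere `S^{n-1}` into `S^n` together with one of the connected components `int` of
`S^n \ bd`. -/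
structure CrumpledCube (n : ℕ) where
  bd : Set (Amb n)
  int : Set (Amb n)
  bd_subset_sphere : bd ⊆ Sph n
  exists_embedding : ∃ e : ↥(Sph (n - 1)) → Amb n,
      Continuous e ∧ Function.Injective e ∧ Set.range e = bd
  int_component : ∃ x, x ∈ Sph n \ bd ∧ int = connectedComponentIn (Sph n \ bd) x

namespace CrumpledCube

/-- The underlying set of a crumpled cube. -/
def carrier {n : ℕ} (C : CrumpledCube n) : Set (Amb n) := C.bd ∪ C.int

lemma bd_subset_carrier {n : ℕ} (C : CrumpledCube n) : C.bd ⊆ C.carrier :=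
  Set.subset_union_left

end CrumpledCube

/-- `f : C → D` is a map associated with the triple `(C, D, h)`: it is continuous,
restricts to `h` on `Bd C`, and satisfies `f⁻¹(Bd D) = Bd C`. -/
def IsAssociatedMap {n : ℕ} (C D : CrumpledCube n) (h : ↥C.bd ≃ₜ ↥D.bd)
    (f : ↥C.carrier → ↥D.carrier) : Prop :=
  Continuous f ∧
    (∀ (x : ↥C.carrier) (hx : (x : Amb n) ∈ C.bd),
      ((f x : ↥D.carrier) : Amb n) = ((h ⟨(x : Amb n), hx⟩ : ↥D.bd) : Amb n)) ∧
    (∀ x : ↥C.carrier, ((f x : ↥D.carrier) : Amb n) ∈ D.bd ↔ (x : Amb n) ∈ C.bd)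

/-- The triple `(C, D, h)` belongs to the collection `𝒲_n`. -/
def MemW {n : ℕ} (C D : CrumpledCube n) (h : ↥C.bd ≃ₜ ↥D.bd) : Prop :=
  ∃ f : ↥C.carrier → ↥D.carrier, IsAssociatedMap C D h f

/-- The image `h(T)` of a subset `T` of `Bd C` under a boundary homeomorphism
`h : Bd C → Bd D`, as a subset of the ambient space. -/
def bdImage {n : ℕ} {C D : CrumpledCube n} (h : ↥C.bd ≃ₜ ↥D.bd) (T : Set (Amb n)) :
    Set (Amb n) :=
  (fun x : ↥C.bd => ((h x : ↥D.bd) : Amb n)) '' {x : ↥C.bd | (x : Amb n) ∈ T}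

/-- `T` is a homotopy taming set for the crumpled cube `C`. -/
def IsHomotopyTamingSet {n : ℕ} (C : CrumpledCube n) (T : Set (Amb n)) : Prop :=
  T ⊆ C.bd ∧
    ∀ (m : C(I × I, ↥C.carrier)) (ε : ℝ), 0 < ε →
      ∃ m' : C(I × I, ↥C.carrier),
        (∀ x, dist (m x) (m' x) < ε) ∧ ∀ x, ((m' x : ↥C.carrier) : Amb n) ∈ T ∪ C.int

/-- `Bd C` is locally collared in `C` at the point `p`. -/
def LocallyCollaredAt {n : ℕ} (C : CrumpledCube n) (p : ↥C.carrier) : Prop :=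
  ∃ N : Set ↥C.carrier, IsOpen N ∧ p ∈ N ∧
    ∃ φ : ↥N ≃ₜ ↥(N ∩ {x : ↥C.carrier | (x : Amb n) ∈ C.bd}) × ↥(Set.Ico (0 : ℝ) 1),
      ∀ (x : ↥N) (hx : ((x : ↥C.carrier) : Amb n) ∈ C.bd),
        φ x = (⟨(x : ↥C.carrier), ⟨x.2, hx⟩⟩, ⟨0, ⟨le_rfl, zero_lt_one⟩⟩)

/-- The wild set of a crumpled cube: the points of `Bd C` at which `Bd C` fails to be
locally collared in `C`. -/
def wildSet {n : ℕ} (C : CrumpledCube n) : Set (Amb n) :=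
  {p | ∃ hp : p ∈ C.bd, ¬ LocallyCollaredAt C ⟨p, C.bd_subset_carrier hp⟩}

/-- `C` is strictly wilder than `D`. -/
def StrictlyWilder {n : ℕ} (C D : CrumpledCube n) : Prop :=
  (∃ h : ↥C.bd ≃ₜ ↥D.bd, MemW C D h) ∧ ∀ H : ↥D.bd ≃ₜ ↥C.bd, ¬ MemW D C H

/-- A crumpled `n`-cube is a closed `n`-cell-complement if the complement of its
interior in `S^n` is an `n`-cell. -/
def IsClosedCellComplement {n : ℕ} (C : CrumpledCube n) : Prop :=
  Nonempty (↥(Sph n \ C.int) ≃ₜ ↥(Metric.closedBall (0 : EuclideanSpace ℝ (Fin n)) 1))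

open MeasureTheory Filter Topology

lemma exists_det_interpolation (k : ℕ) {η : ℝ} (hη : 0 < η) :
    ∃ (v w : Fin (k + 2) → ℝ), (∀ i, |v i| < η) ∧ (∑ i, w i = 0) ∧
      ∀ A : Amb k →L[ℝ] Amb k,
        A.det = ∑ i, w i * (ContinuousLinearMap.id ℝ (Amb k) + v i • A).det := by
  let v : Fin (k + 2) → ℝ := fun i => η * ((i : ℕ) : ℝ) / (k + 2)
  have hk : (0 : ℝ) < k + 2 := by positivity
  have hv : ∀ i, |v i| < η := by
    intro i
    have hi : ((i : ℕ) : ℝ) < k + 2 := by exact_mod_cast i.2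
    have h0 : 0 ≤ v i := by positivity
    rw [abs_of_nonneg h0, div_lt_iff₀ hk]
    exact mul_lt_mul_of_pos_left hi hη
  have hinj : Set.InjOn v (Finset.univ : Finset (Fin (k + 2))) := by
    intro i _ j _ hij
    have h1 : η * ((i : ℕ) : ℝ) = η * ((j : ℕ) : ℝ) := by
      simpa [v, div_left_inj' hk.ne'] using hij
    have h2 := mul_left_cancel₀ hη.ne' h1
    exact Fin.ext (by exact_mod_cast h2)
  let w : Fin (k + 2) → ℝ := fun i => 1 / ∏ j ∈ Finset.univ.erase i, (v i - v j)
  have key : ∀ A : Amb k →L[ℝ] Amb k,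
        A.det = ∑ i, w i * (ContinuousLinearMap.id ℝ (Amb k) + v i • A).det := by
    intro A
    let b := (EuclideanSpace.basisFun (Fin (k + 1)) ℝ).toBasis
    let M := LinearMap.toMatrix b b (A : Amb k →ₗ[ℝ] Amb k)
    have hM : A.det = M.det := by
      rw [ContinuousLinearMap.det, LinearMap.det_toMatrix]
    have hN : ∀ t : ℝ, (ContinuousLinearMap.id ℝ (Amb k) + t • A).det = (1 + t • M).det := by
      intro t
      rw [ContinuousLinearMap.det, ← LinearMap.det_toMatrix b]
      congr 1
      simp [M]
    let P : Polynomial ℝ := (((Polynomial.X : Polynomial ℝ) • M.map Polynomial.C +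
      (1 : Matrix (Fin (k+1)) (Fin (k+1)) ℝ).map Polynomial.C)).det
    have hdeg : P.degree < (Finset.univ : Finset (Fin (k + 2))).card := by
      have := Polynomial.natDegree_det_X_add_C_le M 1
      refine lt_of_le_of_lt Polynomial.degree_le_natDegree ?_
      rw [Finset.card_univ, Fintype.card_fin]
      rw [Fintype.card_fin] at this
      exact_mod_cast Nat.lt_succ_of_le this
    have hc := Lagrange.coeff_eq_sum hinj hdeg
    have hev : ∀ t : ℝ, P.eval t = (1 + t • M).det := by
      intro t
      have := RingHom.map_det (Polynomial.evalRingHom t) (((Polynomial.X : Polynomial ℝ) • M.map Polynomial.C +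
        (1 : Matrix (Fin (k+1)) (Fin (k+1)) ℝ).map Polynomial.C))
      simp only [Polynomial.coe_evalRingHom] at this
      rw [this]
      congr 1
      ext i j
      simp [Matrix.one_apply]
      split_ifs <;> simp <;> ring
    have hlead : P.coeff (k + 1) = M.det := by
      have := Polynomial.coeff_det_X_add_C_card M 1
      rwa [Fintype.card_fin] at this
    rw [Finset.card_univ, Fintype.card_fin] at hc
    rw [hM, ← hlead]
    rw [show k + 2 - 1 = k + 1 from rfl] at hc
    rw [hc]
    refine Finset.sum_congr rfl fun i _ => ?_
    rw [hev, hN]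
    simp only [w]
    ring
  refine ⟨v, w, hv, ?_, key⟩
  have h0 := key 0
  have h1 : (ContinuousLinearMap.id ℝ (Amb k)).det = 1 := by
    simp [ContinuousLinearMap.det]
  have h2 : (0 : Amb k →L[ℝ] Amb k).det = 0 := by
    simp [ContinuousLinearMap.det]
  rw [h2] at h0
  have h3 : ∀ i, (ContinuousLinearMap.id ℝ (Amb k) + v i • (0 : Amb k →L[ℝ] Amb k)).det = 1 := by
    intro i
    have h4 : v i • (0 : Amb k →L[ℝ] Amb k) = 0 := by ext; simp
    rw [h4, add_zero, h1]
  simp only [h3, mul_one] at h0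
  exact h0.symm

lemma exists_pos_forall_det_pos (k : ℕ) :
    ∃ η > 0, ∀ B : Amb k →L[ℝ] Amb k, ‖B‖ < η →
      0 < (ContinuousLinearMap.id ℝ (Amb k) + B).det := by
  have hc : Continuous fun B : Amb k →L[ℝ] Amb k =>
      (ContinuousLinearMap.id ℝ (Amb k) + B).det :=
    ContinuousLinearMap.continuous_det.comp (continuous_const.add continuous_id)
  have h1 : (0 : ℝ) < (ContinuousLinearMap.id ℝ (Amb k) + (0 : Amb k →L[ℝ] Amb k)).det := by
    simp [ContinuousLinearMap.det]
  obtain ⟨η, hη, h⟩ := Metric.eventually_nhds_iff.1 (hc.continuousAt.eventually (lt_mem_nhds h1))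
  exact ⟨η, hη, fun B hB => h (by simpa using hB)⟩

lemma integral_det_id_add_eq (k : ℕ) {g : Amb k → Amb k} (hg : ContDiff ℝ 1 g)
    (hc : HasCompactSupport g) : ∃ R : ℝ, tsupport g ⊆ closedBall 0 R ∧ ∃ η > 0, ∀ t : ℝ, |t| < η →
      ∫ x in closedBall (0 : Amb k) R,
        (ContinuousLinearMap.id ℝ (Amb k) + t • fderiv ℝ g x).det =
      (volume (closedBall (0 : Amb k) R)).toReal := by
  obtain ⟨R, hR⟩ := hc.isCompact.isBounded.subset_closedBall (0 : Amb k)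
  obtain ⟨L, hL⟩ := ContDiff.lipschitzWith_of_hasCompactSupport hc hg one_ne_zero
  obtain ⟨η, hη, hpos⟩ := exists_pos_forall_det_pos k
  refine ⟨R, hR, min (η / (L + 1)) (1 / (L + 1)), by positivity, fun t ht => ?_⟩
  have hL1 : (0 : ℝ) < L + 1 := by positivity
  have ht1 : |t| * (L + 1) < η := by
    rw [← lt_div_iff₀ hL1]; exact ht.trans_le (min_le_left _ _)
  have ht2 : |t| * (L + 1) < 1 := by
    rw [← lt_div_iff₀ hL1]; exact ht.trans_le (min_le_right _ _)
  have hfd : ∀ x, ‖fderiv ℝ g x‖ ≤ L := fun x => norm_fderiv_le_of_lipschitz ℝ hL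
  let f : Amb k → Amb k := fun x => x + t • g x
  have hf' : ∀ x, HasFDerivAt f (ContinuousLinearMap.id ℝ (Amb k) + t • fderiv ℝ g x) x := by
    intro x
    exact (hasFDerivAt_id x).add
      (((hg.differentiable one_ne_zero) x).hasFDerivAt.const_smul t)
  have hdet : ∀ x, 0 < (ContinuousLinearMap.id ℝ (Amb k) + t • fderiv ℝ g x).det := by
    intro x
    apply hpos
    rw [norm_smul, Real.norm_eq_abs]
    calc |t| * ‖fderiv ℝ g x‖ ≤ |t| * (L + 1) := by
          gcongr; linarith [hfd x]
      _ < η := ht1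
  let c : NNReal := ⟨|t| * L, by positivity⟩
  have happ : ApproximatesLinearOn f ((ContinuousLinearEquiv.refl ℝ (Amb k)) : Amb k →L[ℝ] Amb k)
      univ c := by
    intro x _ y _
    have : f x - f y - ((ContinuousLinearEquiv.refl ℝ (Amb k)) : Amb k →L[ℝ] Amb k) (x - y)
        = t • (g x - g y) := by
      simp [f, smul_sub]; abel
    rw [this, norm_smul, Real.norm_eq_abs]
    have := hL.dist_le_mul x y
    rw [dist_eq_norm, dist_eq_norm] at this
    calc |t| * ‖g x - g y‖ ≤ |t| * (L * ‖x - y‖) := by gcongr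
      _ = c * ‖x - y‖ := by rw [← mul_assoc]; rfl
  have hcN : Subsingleton (Amb k) ∨
      c < ‖(((ContinuousLinearEquiv.refl ℝ (Amb k)).symm : Amb k ≃L[ℝ] Amb k) :
        Amb k →L[ℝ] Amb k)‖₊⁻¹ := by
    right
    have h1 : ‖(((ContinuousLinearEquiv.refl ℝ (Amb k)).symm : Amb k ≃L[ℝ] Amb k) :
        Amb k →L[ℝ] Amb k)‖₊ = 1 := by
      have : (((ContinuousLinearEquiv.refl ℝ (Amb k)).symm : Amb k ≃L[ℝ] Amb k) :
        Amb k →L[ℝ] Amb k) = ContinuousLinearMap.id ℝ (Amb k) := rfl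
      rw [this]
      ext
      simp
    rw [h1, inv_one, ← NNReal.coe_lt_coe]
    show |t| * L < 1
    nlinarith [abs_nonneg t]
  have hinj : Function.Injective f := Set.injOn_univ.1 (happ.injOn hcN)
  have hsurj := happ.surjective hcN
  have hout : ∀ x, x ∉ closedBall (0 : Amb k) R → f x = x := by
    intro x hx
    have : g x = 0 := image_eq_zero_of_notMem_tsupport fun h => hx (hR h)
    simp [f, this]
  have himg : f '' closedBall (0 : Amb k) R = closedBall (0 : Amb k) R := by
    apply Subset.antisymm
    · rintro _ ⟨x, hx, rfl⟩
      by_contra h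
      have := hinj (hout _ h)
      rw [this] at h
      exact h hx
    · intro y hy
      obtain ⟨x, rfl⟩ := hsurj y
      by_cases hx : x ∈ closedBall (0 : Amb k) R
      · exact ⟨x, hx, rfl⟩
      · rw [hout x hx] at hy; exact absurd hy hx
  have hcv := integral_image_eq_integral_abs_det_fderiv_smul volume
    (measurableSet_closedBall (x := (0 : Amb k)) (ε := R))
    (fun x _ => (hf' x).hasFDerivWithinAt) hinj.injOn (fun _ => (1 : ℝ))
  rw [himg] at hcv
  simp only [integral_const, smul_eq_mul, mul_one, abs_of_pos (hdet _)] at hcv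
  rw [← hcv]
  simp [Measure.real]

/-- The Jacobian determinant of a compactly supported `C¹` self-map integrates to zero. -/
lemma integral_det_fderiv_eq_zero (k : ℕ) {g : Amb k → Amb k} (hg : ContDiff ℝ 1 g)
    (hc : HasCompactSupport g) : ∫ x, (fderiv ℝ g x).det = 0 := by
  obtain ⟨R, hR, η, hη, h⟩ := integral_det_id_add_eq k hg hc
  obtain ⟨v, w, hv, hw, hdet⟩ := exists_det_interpolation k hη
  have hcf : Continuous (fderiv ℝ g) := hg.continuous_fderiv one_ne_zero
  have h0 : ∀ x, x ∉ closedBall (0 : Amb k) R → (fderiv ℝ g x).det = 0 := by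
    intro x hx
    have : fderiv ℝ g x = 0 := by
      by_contra h
      exact hx (hR (support_fderiv_subset ℝ h))
    rw [this]
    simp [ContinuousLinearMap.det]
  rw [← setIntegral_eq_integral_of_forall_compl_eq_zero h0]
  rw [setIntegral_congr_fun (g := fun x => ∑ i, w i *
    (ContinuousLinearMap.id ℝ (Amb k) + v i • fderiv ℝ g x).det) measurableSet_closedBall
    fun x _ => hdet _]
  rw [integral_finsetSum]
  · rw [Finset.sum_congr rfl fun i _ => (integral_const_mul _ _).trans
      (congrArg (w i * ·) (h _ (hv i))), ← Finset.sum_mul, hw, zero_mul]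
  · intro i _
    have hci : Continuous fun x => (ContinuousLinearMap.id ℝ (Amb k) + v i • fderiv ℝ g x).det :=
      ContinuousLinearMap.continuous_det.comp (continuous_const.add (hcf.const_smul (v i)))
    exact (hci.continuousOn.integrableOn_compact (isCompact_closedBall _ _)).const_mul (w i)

lemma exists_jacobian_bump (k : ℕ) : ∃ (b : Amb k → ℝ) (Φ : Amb k → Amb k) (c : ℝ), 0 < c ∧
    Continuous b ∧ ContDiff ℝ 1 Φ ∧ (∀ y, (fderiv ℝ Φ y).det = c * b y) ∧
    ∫ y, b y = 1 ∧ (∀ y, 1 ≤ ‖y‖ → b y = 0) ∧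
    ∀ y z : Amb k, (∀ i, |y i| = |z i|) → b y = b z := by
  have hk : (0 : ℝ) < k + 1 := by positivity
  let β : ContDiffBump (0 : ℝ) :=
    ⟨1 / (2 * (k + 1)), 1 / (k + 1), by positivity, by
      apply one_div_lt_one_div_of_lt hk; linarith⟩
  have hβc : Continuous β := β.continuous
  let B : ℝ → ℝ := fun t => ∫ s in (0 : ℝ)..t, β s
  have hB : ∀ t, HasDerivAt B (β t) t := fun t =>
    intervalIntegral.integral_hasDerivAt_right (hβc.intervalIntegrable _ _)
      (hβc.stronglyMeasurableAtFilter _ _) hβc.continuousAt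
  have hBd : deriv B = β := funext fun t => (hB t).deriv
  have hBc : ContDiff ℝ 1 B := by
    rw [contDiff_one_iff_deriv]
    exact ⟨fun t => (hB t).differentiableAt, hBd ▸ hβc⟩
  let Φ : Amb k → Amb k := fun y => WithLp.toLp 2 fun i => B (y i)
  have hΦ : ContDiff ℝ 1 Φ := by
    rw [contDiff_euclidean]
    intro i
    exact hBc.comp (by fun_prop)
  let b₀ : Amb k → ℝ := fun y => ∏ i, β (y i)
  have hb₀c : Continuous b₀ := by
    apply continuous_finsetProd
    intro i _
    exact hβc.comp (by fun_prop)
  have hdet : ∀ y, (fderiv ℝ Φ y).det = b₀ y := by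
    intro y
    let bs := (EuclideanSpace.basisFun (Fin (k + 1)) ℝ).toBasis
    rw [ContinuousLinearMap.det, ← LinearMap.det_toMatrix bs]
    have hM : LinearMap.toMatrix bs bs (fderiv ℝ Φ y : Amb k →ₗ[ℝ] Amb k) =
        Matrix.diagonal fun i => β (y i) := by
      ext i j
      rw [LinearMap.toMatrix_apply]
      have h1 : HasFDerivAt (fun x : Amb k => Φ x i)
          ((EuclideanSpace.proj i : Amb k →L[ℝ] ℝ).comp (fderiv ℝ Φ y)) y :=
        (EuclideanSpace.proj i : Amb k →L[ℝ] ℝ).hasFDerivAt.comp y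
          (hΦ.differentiable one_ne_zero y).hasFDerivAt
      have h2 : HasFDerivAt (fun x : Amb k => Φ x i)
          ((β (y i)) • (EuclideanSpace.proj i : Amb k →L[ℝ] ℝ)) y :=
        HasDerivAt.comp_hasFDerivAt (f := fun x : Amb k => x i) y (hB (y i))
          (EuclideanSpace.proj i : Amb k →L[ℝ] ℝ).hasFDerivAt
      have h3 := congrArg (fun L : Amb k →L[ℝ] ℝ => L (bs j)) (h1.unique h2)
      simp only [ContinuousLinearMap.comp_apply, smul_apply] at h3
      have h4 : bs.repr ((fderiv ℝ Φ y : Amb k →ₗ[ℝ] Amb k) (bs j)) i =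
        (EuclideanSpace.proj i : Amb k →L[ℝ] ℝ) ((fderiv ℝ Φ y) (bs j)) := by
        simp [bs]
      rw [h4, h3]
      simp [bs, Matrix.diagonal_apply]
    rw [hM, Matrix.det_diagonal]
  have hzero : ∀ y, 1 ≤ ‖y‖ → b₀ y = 0 := by
    intro y hy
    by_contra h
    have h1 : ∀ i, |y i| < 1 / (k + 1) := by
      intro i
      by_contra h2
      push Not at h2
      apply h
      apply Finset.prod_eq_zero (Finset.mem_univ i)
      apply β.zero_of_le_dist
      rw [Real.dist_eq, sub_zero]
      exact h2
    have h2 : ‖y‖ ^ 2 < 1 := by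
      rw [EuclideanSpace.norm_sq_eq]
      calc ∑ i, ‖y i‖ ^ 2 < ∑ _i : Fin (k + 1), (1 / ((k : ℝ) + 1)) ^ 2 := by
            apply Finset.sum_lt_sum_of_nonempty Finset.univ_nonempty
            intro i _
            exact pow_lt_pow_left₀ (h1 i) (abs_nonneg _) two_ne_zero
        _ = 1 / (k + 1) := by
            rw [Finset.sum_const, Finset.card_univ, Fintype.card_fin]
            push_cast [nsmul_eq_mul]
            field_simp
        _ ≤ 1 := by
            rw [div_le_one hk]; linarith [(Nat.cast_nonneg k : (0 : ℝ) ≤ k)]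
    nlinarith
  have hnn : ∀ y, 0 ≤ b₀ y := fun y => Finset.prod_nonneg fun i _ => β.nonneg
  have hcs : HasCompactSupport b₀ :=
    HasCompactSupport.intro (isCompact_closedBall (0 : Amb k) 1) fun y hy => hzero y (by
      simp only [mem_closedBall, dist_zero_right, not_le] at hy; exact hy.le)
  have hb0 : b₀ 0 ≠ 0 := by
    simp only [b₀]
    refine (Finset.prod_pos fun i _ => ?_).ne'
    exact β.pos_of_mem_ball (by simp [β.rOut_pos])
  have hpos : 0 < ∫ y, b₀ y :=
    hb₀c.integral_pos_of_hasCompactSupport_nonneg_nonzero hcs hnn hb0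
  refine ⟨fun y => (∫ y, b₀ y)⁻¹ * b₀ y, Φ, ∫ y, b₀ y, hpos, hb₀c.const_mul _, hΦ, ?_, ?_, ?_, ?_⟩
  · intro y
    rw [hdet, mul_inv_cancel_left₀ hpos.ne']
  · rw [integral_const_mul, inv_mul_cancel₀ hpos.ne']
  · intro y hy
    simp only [hzero y hy, mul_zero]
  · intro y z hyz
    have hyz' : b₀ y = b₀ z := Finset.prod_congr rfl fun i _ => ?_
    · simp only [hyz']
    rcases abs_eq_abs.1 (hyz i) with h | h
    · rw [h]
    · rw [h, β.neg]

/-- A normalised bump function whose multiples by a constant are Jacobians. -/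
def jacBump (k : ℕ) : Amb k → ℝ := (exists_jacobian_bump k).choose

lemma jacBump_spec (k : ℕ) : ∃ (Φ : Amb k → Amb k) (c : ℝ), 0 < c ∧
    Continuous (jacBump k) ∧ ContDiff ℝ 1 Φ ∧ (∀ y, (fderiv ℝ Φ y).det = c * jacBump k y) ∧
    ∫ y, jacBump k y = 1 ∧ (∀ y, 1 ≤ ‖y‖ → jacBump k y = 0) ∧
    ∀ y z : Amb k, (∀ i, |y i| = |z i|) → jacBump k y = jacBump k z :=
  (exists_jacobian_bump k).choose_spec

lemma continuous_jacBump (k : ℕ) : Continuous (jacBump k) := by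
  obtain ⟨Φ, c, h⟩ := jacBump_spec k
  exact h.2.1

lemma jacBump_eq_zero {k : ℕ} {y : Amb k} (hy : 1 ≤ ‖y‖) : jacBump k y = 0 := by
  obtain ⟨Φ, c, h⟩ := jacBump_spec k
  exact h.2.2.2.2.2.1 y hy

lemma integral_jacBump (k : ℕ) : ∫ y, jacBump k y = 1 := by
  obtain ⟨Φ, c, h⟩ := jacBump_spec k
  exact h.2.2.2.2.1

lemma jacBump_congr_abs {k : ℕ} {y z : Amb k} (h : ∀ i, |y i| = |z i|) :
    jacBump k y = jacBump k z := by
  obtain ⟨Φ, c, h'⟩ := jacBump_spec k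
  exact h'.2.2.2.2.2.2 y z h

/-- The integrand of the degree integral. -/
def jacDensity {k : ℕ} (g : Amb k → Amb k) (x : Amb k) : ℝ :=
  jacBump k (g x) * (fderiv ℝ g x).det

lemma continuous_jacDensity {k : ℕ} {g : Amb k → Amb k} (hg : ContDiff ℝ 1 g) :
    Continuous (jacDensity g) :=
  ((continuous_jacBump k).comp hg.continuous).mul
    (ContinuousLinearMap.continuous_det.comp (hg.continuous_fderiv one_ne_zero))

lemma integrableOn_jacDensity {k : ℕ} {g : Amb k → Amb k} (hg : ContDiff ℝ 1 g)
    {O : Set (Amb k)} (hO : Bornology.IsBounded O) : IntegrableOn (jacDensity g) O := by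
  refine IntegrableOn.mono_set ?_ (subset_closure (s := O))
  exact (continuous_jacDensity hg).continuousOn.integrableOn_compact hO.isCompact_closure

lemma jacDensity_congr {k : ℕ} {g₀ g₁ : Amb k → Amb k} {x : Amb k} (h : g₀ =ᶠ[𝓝 x] g₁) :
    jacDensity g₀ x = jacDensity g₁ x := by
  rw [jacDensity, jacDensity, h.fderiv_eq, h.eq_of_nhds]

lemma exists_smooth_cutoff {k : ℕ} {K O : Set (Amb k)} (hK : IsCompact K) (hO : IsOpen O)
    (hKO : K ⊆ O) : ∃ χ : Amb k → ℝ, ContDiff ℝ 1 χ ∧ HasCompactSupport χ ∧ tsupport χ ⊆ O ∧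
      (∀ x, χ x ∈ Icc (0 : ℝ) 1) ∧ ∀ x ∈ K, χ =ᶠ[𝓝 x] 1 := by
  obtain ⟨K', hK', hKK', hK'O⟩ := exists_compact_between hK hO hKO
  obtain ⟨K'', hK'', hKK, hK''O⟩ := exists_compact_between hK' hO hK'O
  obtain ⟨f, hf, h0, h1⟩ := exists_contMDiff_zero_iff_one_iff_of_isClosed
    (modelWithCornersSelf ℝ (Amb k)) (n := 1) (s := (interior K'')ᶜ) (t := K')
    isOpen_interior.isClosed_compl hK'.isClosed (by
      rw [disjoint_left]; intro x hx hx'; exact hx (hKK hx'))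
  have hsupp : Function.support f ⊆ K'' := by
    intro x hx
    by_contra h
    exact hx ((h1.1 x).1 (fun h' => h (interior_subset h')))
  have hts : tsupport f ⊆ K'' := closure_minimal hsupp hK''.isClosed
  refine ⟨f, hf.contDiff, HasCompactSupport.of_support_subset_isCompact hK'' hsupp,
    hts.trans hK''O, fun x => h0 ⟨x, rfl⟩, fun x hx => ?_⟩
  filter_upwards [isOpen_interior.mem_nhds (hKK' hx)] with y hy
  exact (h1.2 y).1 (interior_subset hy)

lemma integral_jacDensity_eq_of_eq_off_compact {k : ℕ} {g₀ g₁ : Amb k → Amb k}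
    (h₀ : ContDiff ℝ 1 g₀) (h₁ : ContDiff ℝ 1 g₁) {O K : Set (Amb k)}
    (hO : IsOpen O) (hOb : Bornology.IsBounded O) (hK : IsCompact K) (hKO : K ⊆ O)
    (h : ∀ x ∉ K, g₀ x = g₁ x) :
    ∫ x in O, jacDensity g₀ x = ∫ x in O, jacDensity g₁ x := by
  obtain ⟨Φ, c, hc, -, hΦ, hdet, -⟩ := jacBump_spec k
  obtain ⟨χ, hχ, hχc, -, -, hχ1⟩ := exists_smooth_cutoff hK hO hKO
  have hoff : ∀ x ∉ K, g₀ =ᶠ[𝓝 x] g₁ := fun x hx => by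
    filter_upwards [hK.isClosed.isOpen_compl.mem_nhds hx] with y hy using h y hy
  have aux : ∀ g : Amb k → Amb k, ContDiff ℝ 1 g →
      (∫ x, (fderiv ℝ (fun x => χ x • Φ (g x)) x).det = 0) ∧
      Integrable (fun x => (fderiv ℝ (fun x => χ x • Φ (g x)) x).det) ∧
      ∀ x ∈ K, (fderiv ℝ (fun x => χ x • Φ (g x)) x).det = c * jacDensity g x := by
    intro g hg
    have hC : ContDiff ℝ 1 (fun x => χ x • Φ (g x)) := hχ.smul (hΦ.comp hg)
    have hS : HasCompactSupport (fun x => χ x • Φ (g x)) := hχc.smul_right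
    refine ⟨integral_det_fderiv_eq_zero k hC hS, ?_, ?_⟩
    · apply Continuous.integrable_of_hasCompactSupport
      · exact ContinuousLinearMap.continuous_det.comp (hC.continuous_fderiv one_ne_zero)
      · apply HasCompactSupport.intro (hS.fderiv ℝ)
        intro x hx
        rw [image_eq_zero_of_notMem_tsupport hx]
        simp [ContinuousLinearMap.det]
    · intro x hx
      have he : (fun x => χ x • Φ (g x)) =ᶠ[𝓝 x] fun x => Φ (g x) := by
        filter_upwards [hχ1 x hx] with y hy
        rw [hy]; simp
      have hcomp : fderiv ℝ (fun x => Φ (g x)) x =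
          (fderiv ℝ Φ (g x)).comp (fderiv ℝ g x) :=
        fderiv_comp x (hΦ.differentiable one_ne_zero _) (hg.differentiable one_ne_zero _)
      rw [he.fderiv_eq, hcomp, jacDensity, ← mul_assoc, ← hdet]
      exact LinearMap.det_comp _ _
  obtain ⟨a0, b0, c0⟩ := aux g₀ h₀
  obtain ⟨a1, b1, c1⟩ := aux g₁ h₁
  have hKm := hK.isClosed.measurableSet
  rw [← integral_add_compl hKm b0] at a0
  rw [← integral_add_compl hKm b1] at a1
  have e1 : ∫ x in Kᶜ, (fderiv ℝ (fun x => χ x • Φ (g₀ x)) x).det =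
      ∫ x in Kᶜ, (fderiv ℝ (fun x => χ x • Φ (g₁ x)) x).det := by
    refine setIntegral_congr_fun hKm.compl fun x hx => ?_
    have : (fun x => χ x • Φ (g₀ x)) =ᶠ[𝓝 x] fun x => χ x • Φ (g₁ x) := by
      filter_upwards [hoff x hx] with y hy
      rw [hy]
    simp only [this.fderiv_eq]
  rw [setIntegral_congr_fun hKm c0, integral_const_mul] at a0
  rw [setIntegral_congr_fun hKm c1, integral_const_mul] at a1
  have e2 : ∫ x in K, jacDensity g₀ x = ∫ x in K, jacDensity g₁ x := by
    apply mul_left_cancel₀ hc.ne'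
    linarith
  have split : ∀ g : Amb k → Amb k, ContDiff ℝ 1 g → ∫ x in O, jacDensity g x =
      (∫ x in K, jacDensity g x) + ∫ x in O \ K, jacDensity g x := by
    intro g hg
    rw [← setIntegral_union disjoint_sdiff_right (hO.measurableSet.diff hKm)
      ((integrableOn_jacDensity hg hOb).mono_set hKO)
      ((integrableOn_jacDensity hg hOb).mono_set sdiff_subset), union_sdiff_cancel hKO]
  rw [split _ h₀, split _ h₁, e2]
  congr 1
  exact setIntegral_congr_fun (hO.measurableSet.diff hKm) fun x hx =>
    jacDensity_congr (hoff x hx.2)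

lemma integral_jacDensity_eq_of_segment {k : ℕ} {g₀ g₁ : Amb k → Amb k}
    (h₀ : ContDiff ℝ 1 g₀) (h₁ : ContDiff ℝ 1 g₁) {O : Set (Amb k)}
    (hO : IsOpen O) (hOb : Bornology.IsBounded O)
    (h : ∀ x ∈ frontier O, ∀ t ∈ Icc (0 : ℝ) 1, 1 < ‖g₀ x + t • (g₁ x - g₀ x)‖) :
    ∫ x in O, jacDensity g₀ x = ∫ x in O, jacDensity g₁ x := by
  let H : Amb k × ℝ → Amb k := fun p => g₀ p.1 + p.2 • (g₁ p.1 - g₀ p.1)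
  have hH : Continuous H := by
    have := h₀.continuous; have := h₁.continuous
    fun_prop
  let Z : Set (Amb k) := Prod.fst '' ((closure O ×ˢ Icc (0 : ℝ) 1) ∩ {p | ‖H p‖ ≤ 1})
  have hZ : IsCompact Z :=
    ((hOb.isCompact_closure.prod isCompact_Icc).inter_right
      (isClosed_le hH.norm continuous_const)).image continuous_fst
  have hZO : Z ⊆ O := by
    rintro _ ⟨⟨x, t⟩, ⟨⟨hx, ht⟩, hle⟩, rfl⟩
    by_contra hx'
    have := h x ⟨hx, by rwa [hO.interior_eq]⟩ t ht
    exact absurd hle (not_le.2 this)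
  have memZ : ∀ x ∈ O, ∀ t ∈ Icc (0 : ℝ) 1, ‖g₀ x + t • (g₁ x - g₀ x)‖ ≤ 1 → x ∈ Z :=
    fun x hx t ht hle => ⟨(x, t), ⟨⟨subset_closure hx, ht⟩, hle⟩, rfl⟩
  obtain ⟨χ, hχ, hχc, hχO, hχI, hχ1⟩ := exists_smooth_cutoff hZ hO hZO
  let g : Amb k → Amb k := fun x => g₀ x + χ x • (g₁ x - g₀ x)
  have hg : ContDiff ℝ 1 g := h₀.add (hχ.smul (h₁.sub h₀))
  have e1 : ∫ x in O, jacDensity g₀ x = ∫ x in O, jacDensity g x := by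
    apply integral_jacDensity_eq_of_eq_off_compact h₀ hg hO hOb hχc hχO
    intro x hx
    simp [g, image_eq_zero_of_notMem_tsupport hx]
  rw [e1]
  refine setIntegral_congr_fun hO.measurableSet fun x hx => ?_
  by_cases hxZ : x ∈ Z
  · apply jacDensity_congr
    filter_upwards [hχ1 x hxZ] with y hy
    simp [g, hy]
  · have z1 : 1 ≤ ‖g x‖ := by
      by_contra hlt
      exact hxZ (memZ x hx (χ x) (hχI x) (not_le.1 hlt).le)
    have z2 : 1 ≤ ‖g₁ x‖ := by
      by_contra hlt
      refine hxZ (memZ x hx 1 ⟨zero_le_one, le_rfl⟩ ?_)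
      simpa using (not_le.1 hlt).le
    simp only [jacDensity, jacBump_eq_zero z1, jacBump_eq_zero z2, zero_mul]

/-- `F` is continuous and has no zero on the frontier of the bounded open set `O`. -/
structure DegAdm {k : ℕ} (F : Amb k → Amb k) (O : Set (Amb k)) : Prop where
  cont : Continuous F
  isOpen : IsOpen O
  bdd : Bornology.IsBounded O
  ne_zero : ∀ x ∈ frontier O, F x ≠ 0

/-- `g` is a `C¹` map close on the frontier of `O` to a large multiple of `F`. -/
def DegApprox {k : ℕ} (F : Amb k → Amb k) (O : Set (Amb k)) (g : Amb k → Amb k) : Prop :=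
  ContDiff ℝ 1 g ∧ ∃ l : ℝ, ∀ x ∈ frontier O, 3 ≤ ‖l • F x‖ ∧ 0 < l ∧ ‖g x - l • F x‖ ≤ 1

/-- The Brouwer degree at `0` of `F` on `O`. -/
def deg {k : ℕ} (F : Amb k → Amb k) (O : Set (Amb k)) : ℝ :=
  Classical.epsilon fun d => ∀ g, DegApprox F O g → ∫ x in O, jacDensity g x = d

lemma exists_contDiff_close {k : ℕ} {F : Amb k → Amb k} (hF : Continuous F) {ε : ℝ} (hε : 0 < ε) :
    ∃ g : Amb k → Amb k, ContDiff ℝ 1 g ∧ ∀ x, ‖g x - F x‖ < ε := by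
  obtain ⟨g, hg, h, -⟩ := hF.exists_contDiff_approx 1 (ε := fun _ => ε) continuous_const
    (fun _ => hε)
  exact ⟨g, hg, fun x => by simpa [dist_eq_norm] using h x⟩

lemma exists_norm_lower_bound {X : Type*} [TopologicalSpace X] {E : Type*} [NormedAddCommGroup E]
    {K : Set X} (hK : IsCompact K)
    {F : X → E} (hF : ContinuousOn F K) (h : ∀ x ∈ K, F x ≠ 0) :
    ∃ c > 0, ∀ x ∈ K, c ≤ ‖F x‖ := by
  rcases K.eq_empty_or_nonempty with rfl | hne
  · exact ⟨1, one_pos, by simp⟩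
  · obtain ⟨x, hx, hmin⟩ := hK.exists_isMinOn hne hF.norm
    exact ⟨‖F x‖, norm_pos_iff.2 (h x hx), fun y hy => hmin hy⟩

lemma one_lt_norm_segment {E : Type*} [NormedAddCommGroup E] [NormedSpace ℝ E] {a b u v : E}
    {t : ℝ} (ht : t ∈ Icc (0 : ℝ) 1) (ha : ‖a - u‖ ≤ 1) (hb : ‖b - v‖ ≤ 1)
    (h : 3 ≤ ‖u + t • (v - u)‖) : 1 < ‖a + t • (b - a)‖ := by
  have e : u + t • (v - u) = (a + t • (b - a)) - ((1 - t) • (a - u) + t • (b - v)) := by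
    module
  have h2 : ‖(1 - t) • (a - u) + t • (b - v)‖ ≤ 1 := by
    refine (norm_add_le _ _).trans ?_
    rw [norm_smul, norm_smul, Real.norm_of_nonneg ht.1, Real.norm_of_nonneg (sub_nonneg.2 ht.2)]
    nlinarith [ht.1, ht.2]
  have h3 := norm_sub_le (a + t • (b - a)) ((1 - t) • (a - u) + t • (b - v))
  rw [← e] at h3
  linarith

lemma DegApprox.integral_eq {k : ℕ} {F : Amb k → Amb k} {O : Set (Amb k)} (h : DegAdm F O)
    {g₀ g₁ : Amb k → Amb k} (h₀ : DegApprox F O g₀) (h₁ : DegApprox F O g₁) :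
    ∫ x in O, jacDensity g₀ x = ∫ x in O, jacDensity g₁ x := by
  obtain ⟨c₀, l₀, H₀⟩ := h₀
  obtain ⟨c₁, l₁, H₁⟩ := h₁
  refine integral_jacDensity_eq_of_segment c₀ c₁ h.isOpen h.bdd fun x hx t ht => ?_
  obtain ⟨n₀, p₀, a₀⟩ := H₀ x hx
  obtain ⟨n₁, p₁, a₁⟩ := H₁ x hx
  refine one_lt_norm_segment ht a₀ a₁ ?_
  have e : l₀ • F x + t • (l₁ • F x - l₀ • F x) = (l₀ + t * (l₁ - l₀)) • F x := by module
  rw [norm_smul, Real.norm_of_nonneg p₀.le] at n₀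
  rw [norm_smul, Real.norm_of_nonneg p₁.le] at n₁
  rw [e, norm_smul, Real.norm_eq_abs]
  refine le_trans ?_ (mul_le_mul_of_nonneg_right (le_abs_self _) (norm_nonneg _))
  nlinarith [ht.1, ht.2, norm_nonneg (F x)]

lemma deg_eq {k : ℕ} {F : Amb k → Amb k} {O : Set (Amb k)} (h : DegAdm F O)
    {g : Amb k → Amb k} (hg : DegApprox F O g) : deg F O = ∫ x in O, jacDensity g x := by
  have : ∃ d, ∀ g, DegApprox F O g → ∫ x in O, jacDensity g x = d :=
    ⟨_, fun g' hg' => DegApprox.integral_eq h hg' hg⟩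
  exact (Classical.epsilon_spec this g hg).symm

lemma DegAdm.isCompact_frontier {k : ℕ} {F : Amb k → Amb k} {O : Set (Amb k)} (h : DegAdm F O) :
    IsCompact (frontier O) :=
  h.bdd.isCompact_closure.of_isClosed_subset isClosed_frontier frontier_subset_closure

lemma exists_scale_approx {k : ℕ} {F : Amb k → Amb k} (hF : Continuous F) {c : ℝ} (hc : 0 < c) :
    ∃ l > 0, 3 ≤ l * c ∧
      ∃ g : Amb k → Amb k, ContDiff ℝ 1 g ∧ ∀ x, ‖g x - l • F x‖ ≤ 1 := by
  obtain ⟨g, hg, h⟩ := exists_contDiff_close (hF.const_smul (3 / c)) one_pos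
  exact ⟨3 / c, by positivity, by rw [div_mul_cancel₀ _ hc.ne'], g, hg, fun x => (h x).le⟩

lemma deg_eq_of_segment {k : ℕ} {F₀ F₁ : Amb k → Amb k} {O : Set (Amb k)} (h₀ : DegAdm F₀ O)
    (h₁ : DegAdm F₁ O)
    (h : ∀ x ∈ frontier O, ∀ t ∈ Icc (0 : ℝ) 1, F₀ x + t • (F₁ x - F₀ x) ≠ 0) :
    deg F₀ O = deg F₁ O := by
  let H : Amb k × ℝ → Amb k := fun p => F₀ p.1 + p.2 • (F₁ p.1 - F₀ p.1)
  have hH : Continuous H := by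
    have := h₀.cont; have := h₁.cont
    fun_prop
  obtain ⟨c, hc, hle⟩ := exists_norm_lower_bound (h₀.isCompact_frontier.prod
    (isCompact_Icc (a := (0 : ℝ)) (b := 1))) hH.continuousOn
    (fun p hp => h p.1 hp.1 p.2 hp.2)
  have hl : 0 < 3 / c := by positivity
  have h3 : 3 / c * c = 3 := div_mul_cancel₀ _ hc.ne'
  have key : ∀ x ∈ frontier O, ∀ t ∈ Icc (0 : ℝ) 1,
      3 ≤ ‖(3 / c) • (F₀ x + t • (F₁ x - F₀ x))‖ := by
    intro x hx t ht
    rw [norm_smul, Real.norm_of_nonneg hl.le]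
    refine h3.symm.le.trans ?_
    exact mul_le_mul_of_nonneg_left (hle (x, t) ⟨hx, ht⟩) hl.le
  obtain ⟨g₀, hg₀, a₀⟩ := exists_contDiff_close (h₀.cont.const_smul (3 / c)) one_pos
  obtain ⟨g₁, hg₁, a₁⟩ := exists_contDiff_close (h₁.cont.const_smul (3 / c)) one_pos
  have A₀ : DegApprox F₀ O g₀ := ⟨hg₀, 3 / c, fun x hx => ⟨by
    simpa using key x hx 0 (by simp), hl, (a₀ x).le⟩⟩
  have A₁ : DegApprox F₁ O g₁ := ⟨hg₁, 3 / c, fun x hx => ⟨by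
    simpa using key x hx 1 (by simp), hl, (a₁ x).le⟩⟩
  rw [deg_eq h₀ A₀, deg_eq h₁ A₁]
  refine integral_jacDensity_eq_of_segment hg₀ hg₁ h₀.isOpen h₀.bdd fun x hx t ht => ?_
  refine one_lt_norm_segment ht (a₀ x).le (a₁ x).le ?_
  have e : (3 / c) • F₀ x + t • ((3 / c) • F₁ x - (3 / c) • F₀ x) =
      (3 / c) • (F₀ x + t • (F₁ x - F₀ x)) := by module
  rw [Pi.smul_apply, Pi.smul_apply, e]
  exact key x hx t ht

lemma deg_congr {k : ℕ} {F₀ F₁ : Amb k → Amb k} {O : Set (Amb k)} (h₀ : DegAdm F₀ O)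
    (h₁ : Continuous F₁) (h : ∀ x ∈ frontier O, F₀ x = F₁ x) : deg F₀ O = deg F₁ O := by
  have hA : DegAdm F₁ O := ⟨h₁, h₀.isOpen, h₀.bdd, fun x hx => h x hx ▸ h₀.ne_zero x hx⟩
  refine deg_eq_of_segment h₀ hA fun x hx t ht => ?_
  rw [h x hx, sub_self, smul_zero, add_zero]
  exact hA.ne_zero x hx

lemma deg_eq_of_norm_sub_lt {k : ℕ} {F₀ F₁ : Amb k → Amb k} {O : Set (Amb k)} (h₀ : DegAdm F₀ O)
    (h₁ : Continuous F₁) (h : ∀ x ∈ frontier O, ‖F₁ x - F₀ x‖ < ‖F₀ x‖) :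
    DegAdm F₁ O ∧ deg F₀ O = deg F₁ O := by
  have key : ∀ x ∈ frontier O, ∀ t ∈ Icc (0 : ℝ) 1, F₀ x + t • (F₁ x - F₀ x) ≠ 0 := by
    intro x hx t ht h0
    have h1 : ‖F₀ x‖ = ‖t • (F₁ x - F₀ x)‖ := by
      rw [← norm_neg (t • _), ← eq_neg_of_add_eq_zero_left h0]
    rw [norm_smul, Real.norm_of_nonneg ht.1] at h1
    nlinarith [h x hx, norm_nonneg (F₁ x - F₀ x), ht.2]
  have hA : DegAdm F₁ O := ⟨h₁, h₀.isOpen, h₀.bdd, fun x hx => by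
    simpa using key x hx 1 (by simp)⟩
  exact ⟨hA, deg_eq_of_segment h₀ hA key⟩

lemma frontier_subset_of_disjoint_family {X ι : Type*} [TopologicalSpace X] {O : Set X}
    {s : Set ι} {U : ι → Set X} (hU : ∀ i ∈ s, IsOpen (U i)) (hsub : ∀ i ∈ s, U i ⊆ O)
    (hd : s.PairwiseDisjoint U) {i : ι} (hi : i ∈ s) :
    frontier (U i) ⊆ closure O \ ⋃ j ∈ s, U j := by
  intro x hx
  refine ⟨closure_mono (hsub i hi) (frontier_subset_closure hx), fun h => ?_⟩
  obtain ⟨j, hj, hxj⟩ := mem_iUnion₂.1 h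
  by_cases hij : i = j
  · subst hij
    rw [(hU i hi).frontier_eq] at hx
    exact hx.2 hxj
  · obtain ⟨y, hy, hy'⟩ := mem_closure_iff.1 (frontier_subset_closure hx) _ (hU j hj) hxj
    exact (hd hi hj hij).le_bot ⟨hy', hy⟩

lemma deg_eq_sum {k : ℕ} {F : Amb k → Amb k} {O : Set (Amb k)} (h : DegAdm F O) {ι : Type*}
    (s : Finset ι) (U : ι → Set (Amb k)) (hU : ∀ i ∈ s, IsOpen (U i)) (hsub : ∀ i ∈ s, U i ⊆ O)
    (hd : (s : Set ι).PairwiseDisjoint U) (hz : ∀ x ∈ O, F x = 0 → ∃ i ∈ s, x ∈ U i) :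
    (∀ i ∈ s, DegAdm F (U i)) ∧ deg F O = ∑ i ∈ s, deg F (U i) := by
  have hfr : ∀ i ∈ s, frontier (U i) ⊆ closure O \ ⋃ j ∈ s, U j := fun i hi =>
    frontier_subset_of_disjoint_family (s := (s : Set ι)) hU hsub hd hi
  have hK : IsCompact (closure O \ ⋃ j ∈ s, U j) :=
    h.bdd.isCompact_closure.diff (isOpen_biUnion hU)
  have hF0 : ∀ x ∈ closure O \ ⋃ j ∈ s, U j, F x ≠ 0 := by
    rintro x ⟨hx, hx'⟩ h0
    by_cases hxO : x ∈ O
    · obtain ⟨i, hi, hxi⟩ := hz x hxO h0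
      exact hx' (mem_iUnion₂.2 ⟨i, hi, hxi⟩)
    · exact h.ne_zero x (by rw [h.isOpen.frontier_eq]; exact ⟨hx, hxO⟩) h0
  have hfrO : frontier O ⊆ closure O \ ⋃ j ∈ s, U j := by
    intro x hx
    rw [h.isOpen.frontier_eq] at hx
    refine ⟨hx.1, fun hx' => ?_⟩
    obtain ⟨j, hj, hxj⟩ := mem_iUnion₂.1 hx'
    exact hx.2 (hsub j hj hxj)
  have hadm : ∀ i ∈ s, DegAdm F (U i) := fun i hi =>
    ⟨h.cont, hU i hi, h.bdd.subset (hsub i hi), fun x hx => hF0 x (hfr i hi hx)⟩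
  refine ⟨hadm, ?_⟩
  obtain ⟨c, hc, hle⟩ := exists_norm_lower_bound hK h.cont.continuousOn hF0
  obtain ⟨l, hl, hlc, g, hg, ha⟩ := exists_scale_approx h.cont hc
  have key : ∀ x ∈ closure O \ ⋃ j ∈ s, U j, 3 ≤ ‖l • F x‖ := by
    intro x hx
    rw [norm_smul, Real.norm_of_nonneg hl.le]
    exact hlc.trans (mul_le_mul_of_nonneg_left (hle x hx) hl.le)
  rw [deg_eq h ⟨hg, l, fun x hx => ⟨key x (hfrO hx), hl, ha x⟩⟩]
  rw [Finset.sum_congr rfl fun i hi => deg_eq (hadm i hi) ⟨hg, l, fun x hx =>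
    ⟨key x (hfr i hi hx), hl, ha x⟩⟩]
  rw [← integral_biUnion_finset s (fun i hi => (hU i hi).measurableSet) hd
    (fun i hi => integrableOn_jacDensity hg (hadm i hi).bdd)]
  refine setIntegral_eq_of_subset_of_forall_sdiff_eq_zero h.isOpen.measurableSet
    (iUnion₂_subset hsub) fun x hx => ?_
  have h1 : 1 ≤ ‖g x‖ := by
    have h2 := key x ⟨subset_closure hx.1, hx.2⟩
    have h3 := norm_sub_norm_le (l • F x) (g x)
    rw [norm_sub_rev] at h3
    linarith [ha x]
  rw [jacDensity, jacBump_eq_zero h1, zero_mul]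

lemma deg_eq_zero {k : ℕ} {F : Amb k → Amb k} {O : Set (Amb k)} (h : DegAdm F O)
    (h0 : ∀ x ∈ O, F x ≠ 0) : deg F O = 0 := by
  have := (deg_eq_sum h (∅ : Finset ℕ) (fun _ => ∅) (by simp) (by simp) (by simp)
    (fun x hx hx0 => (h0 x hx hx0).elim)).2
  simpa using this

lemma deg_excision {k : ℕ} {F : Amb k → Amb k} {O U : Set (Amb k)} (h : DegAdm F O)
    (hU : IsOpen U) (hUO : U ⊆ O) (hz : ∀ x ∈ O, F x = 0 → x ∈ U) :
    DegAdm F U ∧ deg F O = deg F U := by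
  have := deg_eq_sum h ({0} : Finset ℕ) (fun _ => U) (by simpa using hU) (by simpa using hUO)
    (by simp) (fun x hx hx0 => ⟨0, by simp, hz x hx hx0⟩)
  simpa using this

lemma deg_sub_const {k : ℕ} {y : Amb k} {O : Set (Amb k)} (hO : IsOpen O)
    (hb : Bornology.IsBounded O) (hy : y ∈ O) :
    DegAdm (fun x => x - y) O ∧ deg (fun x => x - y) O = 1 := by
  have hA : DegAdm (fun x => x - y) O := by
    refine ⟨by fun_prop, hO, hb, fun x hx h0 => ?_⟩
    rw [hO.frontier_eq, sub_eq_zero.1 h0] at hx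
    exact hx.2 hy
  refine ⟨hA, ?_⟩
  obtain ⟨r, hr, hrO⟩ := Metric.isOpen_iff.1 hO y hy
  have hl : 0 < 3 / r := by positivity
  have hr3 : 3 / r * r = 3 := div_mul_cancel₀ _ hr.ne'
  have hnorm : ∀ x, x ∉ O → 3 ≤ ‖(3 / r) • (x - y)‖ := by
    intro x hx
    rw [norm_smul, Real.norm_of_nonneg hl.le]
    refine hr3.symm.le.trans ?_
    refine mul_le_mul_of_nonneg_left ?_ hl.le
    by_contra h
    exact hx (hrO (by rw [mem_ball, dist_eq_norm]; exact not_le.1 h))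
  let g : Amb k → Amb k := fun x => (3 / r) • (x - y)
  have hg : ContDiff ℝ 1 g := by
    simp only [g]
    fun_prop
  rw [deg_eq hA (g := g) ⟨hg, 3 / r, fun x hx => ⟨hnorm x (by
    rw [hO.frontier_eq] at hx; exact hx.2), hl, by simp [g]⟩⟩]
  have hfd : ∀ x, fderiv ℝ g x = (3 / r) • ContinuousLinearMap.id ℝ (Amb k) := fun x =>
    (((hasFDerivAt_id x).sub_const y).const_smul (3 / r)).fderiv
  have hdet : ∀ x, (fderiv ℝ g x).det = (3 / r) ^ (k + 1) := by
    intro x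
    rw [hfd]
    have : ((3 / r) • ContinuousLinearMap.id ℝ (Amb k)).det =
        LinearMap.det ((3 / r) • (LinearMap.id : Amb k →ₗ[ℝ] Amb k)) := rfl
    rw [this, LinearMap.det_smul, LinearMap.det_id, mul_one, finrank_euclideanSpace,
      Fintype.card_fin]
  rw [setIntegral_eq_integral_of_forall_compl_eq_zero fun x hx => by
    rw [jacDensity, jacBump_eq_zero (by linarith [hnorm x hx]), zero_mul]]
  simp only [jacDensity, hdet, g]
  rw [integral_mul_const, integral_sub_right_eq_self (fun x => jacBump k ((3 / r) • x)) y,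
    Measure.integral_comp_smul, integral_jacBump, finrank_euclideanSpace, Fintype.card_fin]
  rw [abs_of_pos (by positivity), smul_eq_mul, mul_one, inv_mul_cancel₀ (by positivity)]

/-- The action of a matrix on Euclidean space. -/
def matAct {k : ℕ} (M : Matrix (Fin (k + 1)) (Fin (k + 1)) ℝ) (y : Amb k) : Amb k :=
  WithLp.toLp 2 (M.mulVec y.ofLp)

lemma continuous_matAct {k : ℕ} (M : Matrix (Fin (k + 1)) (Fin (k + 1)) ℝ) :
    Continuous (matAct M) :=
  (Matrix.toLpLin 2 2 M).continuous_of_finiteDimensional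

lemma matAct_ne_zero {k : ℕ} {M : Matrix (Fin (k + 1)) (Fin (k + 1)) ℝ} (hM : M.det ≠ 0)
    {y : Amb k} (hy : y ≠ 0) : matAct M y ≠ 0 := by
  intro h
  apply hy
  have h1 : M.mulVec y.ofLp = 0 := congrArg WithLp.ofLp h
  have h2 := Matrix.eq_zero_of_mulVec_eq_zero hM h1
  ext i
  exact congrFun h2 i

lemma DegAdm.matAct {k : ℕ} {M : Matrix (Fin (k + 1)) (Fin (k + 1)) ℝ} (hM : M.det ≠ 0)
    {F : Amb k → Amb k} {O : Set (Amb k)} (h : DegAdm F O) :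
    DegAdm (fun x => matAct M (F x)) O :=
  ⟨(continuous_matAct M).comp h.cont, h.isOpen, h.bdd, fun x hx =>
    matAct_ne_zero hM (h.ne_zero x hx)⟩

lemma matAct_segment {k : ℕ} (M N : Matrix (Fin (k + 1)) (Fin (k + 1)) ℝ) (t : ℝ) (y : Amb k) :
    matAct M y + t • (matAct N y - matAct M y) = matAct (M + t • (N - M)) y := by
  ext i
  simp only [matAct, Matrix.add_mulVec, Matrix.smul_mulVec, Matrix.sub_mulVec]
  simp

lemma deg_matAct_eq_of_segment {k : ℕ} {M N : Matrix (Fin (k + 1)) (Fin (k + 1)) ℝ}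
    (hMN : ∀ t ∈ Icc (0 : ℝ) 1, (M + t • (N - M)).det ≠ 0)
    {F : Amb k → Amb k} {O : Set (Amb k)} (h : DegAdm F O) :
    deg (fun x => matAct M (F x)) O = deg (fun x => matAct N (F x)) O := by
  have hM : M.det ≠ 0 := by simpa using hMN 0 (by simp)
  have hN : N.det ≠ 0 := by simpa using hMN 1 (by simp)
  refine deg_eq_of_segment (h.matAct hM) (h.matAct hN) fun x hx t ht => ?_
  rw [matAct_segment]
  exact matAct_ne_zero (hMN t ht) (h.ne_zero x hx)

lemma deg_matAct_sign {k : ℕ} {S : Fin (k + 1) → ℝ} (hS : ∀ i, |S i| = 1)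
    {F : Amb k → Amb k} {O : Set (Amb k)} (h : DegAdm F O) :
    deg (fun x => matAct (Matrix.diagonal S) (F x)) O = (∏ i, S i) * deg F O := by
  have hdet : (Matrix.diagonal S).det ≠ 0 := by
    rw [Matrix.det_diagonal, Finset.prod_ne_zero_iff]
    intro i _ h0
    have := hS i
    rw [h0] at this
    simp at this
  let L : Amb k →L[ℝ] Amb k := LinearMap.toContinuousLinearMap
    (Matrix.toLpLin 2 2 (Matrix.diagonal S))
  have hL : ∀ y, matAct (Matrix.diagonal S) y = L y := fun y => rfl
  have hLi : ∀ (y : Amb k) i, L y i = S i * y i := by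
    intro y i
    rw [← hL]
    simp [matAct, Matrix.mulVec_diagonal]
  have hLn : ∀ y, ‖L y‖ = ‖y‖ := by
    intro y
    rw [EuclideanSpace.norm_eq, EuclideanSpace.norm_eq]
    congr 1
    refine Finset.sum_congr rfl fun i _ => ?_
    rw [hLi, norm_mul, Real.norm_eq_abs (S i), hS, one_mul]
  have hLdet : L.det = ∏ i, S i := by
    rw [← Matrix.det_diagonal]
    have : (L : Amb k →ₗ[ℝ] Amb k) = Matrix.toLpLin 2 2 (Matrix.diagonal S) := rfl
    rw [ContinuousLinearMap.det, this, Matrix.toLpLin_eq_toLin, LinearMap.det_toLin]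
  obtain ⟨c, hc, hle⟩ := exists_norm_lower_bound h.isCompact_frontier h.cont.continuousOn h.ne_zero
  obtain ⟨l, hl, hlc, g, hg, ha⟩ := exists_scale_approx h.cont hc
  have key : ∀ x ∈ frontier O, 3 ≤ ‖l • F x‖ := by
    intro x hx
    rw [norm_smul, Real.norm_of_nonneg hl.le]
    exact hlc.trans (mul_le_mul_of_nonneg_left (hle x hx) hl.le)
  have A : DegApprox F O g := ⟨hg, l, fun x hx => ⟨key x hx, hl, ha x⟩⟩
  have A' : DegApprox (fun x => matAct (Matrix.diagonal S) (F x)) O (fun x => L (g x)) := by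
    refine ⟨L.contDiff.comp hg, l, fun x hx => ⟨?_, hl, ?_⟩⟩
    · simp only [hL]
      rw [← map_smul, hLn]
      exact key x hx
    · simp only [hL]
      rw [← map_smul, ← map_sub, hLn]
      exact ha x
  rw [deg_eq h A, deg_eq (h.matAct hdet) A', ← integral_const_mul]
  congr 1
  ext x
  have hfd : fderiv ℝ (fun x => L (g x)) x = L.comp (fderiv ℝ g x) :=
    (L.hasFDerivAt.comp x (hg.differentiable one_ne_zero x).hasFDerivAt).fderiv
  have hdc : (L.comp (fderiv ℝ g x)).det = L.det * (fderiv ℝ g x).det := LinearMap.det_comp _ _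
  have hb : jacBump k (L (g x)) = jacBump k (g x) := by
    apply jacBump_congr_abs
    intro i
    rw [hLi, abs_mul, hS, one_mul]
  rw [jacDensity, jacDensity, hfd, hdc, hLdet, hb]
  ring

lemma exists_int_deg_matAct {k : ℕ} (M : Matrix (Fin (k + 1)) (Fin (k + 1)) ℝ) (hM : M.det ≠ 0) :
    ∃ s : ℤ, ∀ (F : Amb k → Amb k) (O : Set (Amb k)), DegAdm F O →
      deg (fun x => matAct M (F x)) O = s * deg F O := by
  refine Matrix.diagonal_transvection_induction_of_det_ne_zero
    (fun M => ∃ s : ℤ, ∀ (F : Amb k → Amb k) (O : Set (Amb k)), DegAdm F O →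
      deg (fun x => matAct M (F x)) O = s * deg F O) M hM ?_ ?_ ?_
  · intro D hD
    rw [Matrix.det_diagonal, Finset.prod_ne_zero_iff] at hD
    let S : Fin (k + 1) → ℤ := fun i => SignType.sign (D i)
    have hSD : ∀ i, (0 < D i ∧ S i = 1) ∨ (D i < 0 ∧ S i = -1) := by
      intro i
      rcases lt_or_gt_of_ne (hD i (Finset.mem_univ i)) with h | h
      · right; exact ⟨h, by simp [S, sign_neg h]⟩
      · left; exact ⟨h, by simp [S, sign_pos h]⟩
    refine ⟨∏ i, S i, fun F O h => ?_⟩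
    rw [deg_matAct_eq_of_segment (N := Matrix.diagonal fun i => (S i : ℝ)) _ h,
      deg_matAct_sign _ h]
    · push_cast; rfl
    · intro i
      rcases hSD i with ⟨-, h⟩ | ⟨-, h⟩ <;> simp [h]
    · intro t ht
      rw [Matrix.diagonal_sub, ← Matrix.diagonal_smul, Matrix.diagonal_add, Matrix.det_diagonal,
        Finset.prod_ne_zero_iff]
      intro i _
      rcases hSD i with ⟨h1, h⟩ | ⟨h1, h⟩
      · simp only [h, Pi.smul_apply, smul_eq_mul]
        push_cast
        rcases ht.1.eq_or_lt with h2 | h2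
        · rw [← h2]; simpa using h1.ne'
        · have : 0 ≤ (1 - t) * D i := mul_nonneg (by linarith [ht.2]) h1.le
          nlinarith
      · simp only [h, Pi.smul_apply, smul_eq_mul]
        push_cast
        rcases ht.1.eq_or_lt with h2 | h2
        · rw [← h2]; simpa using h1.ne
        · have : (1 - t) * D i ≤ 0 := mul_nonpos_of_nonneg_of_nonpos (by linarith [ht.2]) h1.le
          nlinarith
  · intro T
    refine ⟨1, fun F O h => ?_⟩
    rw [deg_matAct_eq_of_segment (N := 1) _ h]
    · have : (fun x => matAct (1 : Matrix (Fin (k + 1)) (Fin (k + 1)) ℝ) (F x)) = F := by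
        ext x i
        simp [matAct]
      rw [this]; simp
    · intro t ht
      have : T.toMatrix + t • (1 - T.toMatrix) = Matrix.transvection T.i T.j ((1 - t) * T.c) := by
        rw [Matrix.TransvectionStruct.toMatrix, Matrix.transvection, Matrix.transvection]
        ext a b
        simp [Matrix.single_apply]
        split_ifs <;> ring
      rw [this, Matrix.det_transvection_of_ne _ _ T.hij]
      exact one_ne_zero
  · rintro A B hA hB ⟨s, hs⟩ ⟨u, hu⟩
    refine ⟨s * u, fun F O h => ?_⟩
    have e : (fun x => matAct (A * B) (F x)) = fun x => matAct A (matAct B (F x)) := by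
      ext x i
      simp [matAct, Matrix.mulVec_mulVec]
    rw [e, hs _ O (h.matAct hB), hu F O h]
    push_cast
    ring

lemma exists_int_deg_linear {k : ℕ} (A : Amb k →L[ℝ] Amb k) (hA : A.det ≠ 0) :
    ∃ s : ℤ, ∀ (F : Amb k → Amb k) (O : Set (Amb k)), DegAdm F O →
      deg (fun x => A (F x)) O = s * deg F O := by
  let b := (EuclideanSpace.basisFun (Fin (k + 1)) ℝ).toBasis
  let M := LinearMap.toMatrix b b (A : Amb k →ₗ[ℝ] Amb k)
  have hM : M.det ≠ 0 := by
    rwa [LinearMap.det_toMatrix]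
  obtain ⟨s, hs⟩ := exists_int_deg_matAct M hM
  refine ⟨s, fun F O h => ?_⟩
  rw [← hs F O h]
  congr 1
  ext x i
  have hr : ∀ y : Amb k, (b.repr y : Fin (k + 1) → ℝ) = y.ofLp := by
    intro y
    ext j
    simp [b]
  have := congrFun (LinearMap.toMatrix_mulVec_repr b b (A : Amb k →ₗ[ℝ] Amb k) (F x)) i
  rw [hr, hr] at this
  exact this.symm

lemma exists_regular_translate {k : ℕ} {g : Amb k → Amb k} (hg : ContDiff ℝ 1 g) {ε : ℝ}
    (hε : 0 < ε) : ∃ a : Amb k, ‖a‖ < ε ∧ ∀ x, g x = a → (fderiv ℝ g x).det ≠ 0 := by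
  have h0 := addHaar_image_eq_zero_of_det_fderivWithin_eq_zero (volume : Measure (Amb k))
    (f := g) (s := {x | (fderiv ℝ g x).det = 0}) (f' := fderiv ℝ g)
    (fun x _ => (hg.differentiable one_ne_zero x).hasFDerivAt.hasFDerivWithinAt)
    (fun x hx => hx)
  by_contra hcon
  push Not at hcon
  have hsub : ball (0 : Amb k) ε ⊆ g '' {x | (fderiv ℝ g x).det = 0} := by
    intro a ha
    obtain ⟨x, hx, hx'⟩ := hcon a (by simpa using ha)
    exact ⟨x, hx', hx⟩
  exact (measure_ball_pos volume (0 : Amb k) hε).ne' (measure_mono_null hsub h0)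

lemma eventually_segment_ne_zero {k : ℕ} {g : Amb k → Amb k} {z : Amb k}
    {A : Amb k →L[ℝ] Amb k} (hg : HasFDerivAt g A z) (hz : g z = 0) (hA : A.det ≠ 0) :
    ∀ᶠ x in 𝓝 z, x ≠ z → ∀ t ∈ Icc (0 : ℝ) 1, g x + t • (A (x - z) - g x) ≠ 0 := by
  let e := A.toContinuousLinearEquivOfDetNeZero hA
  have he : ∀ v, e v = A v := fun v => rfl
  let N := ‖(e.symm : Amb k →L[ℝ] Amb k)‖ + 1
  have hN : 0 < N := by positivity
  have hlow : ∀ v, ‖v‖ ≤ N * ‖A v‖ := by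
    intro v
    have h1 := (e.symm : Amb k →L[ℝ] Amb k).le_opNorm (A v)
    have h2 : (e.symm : Amb k →L[ℝ] Amb k) (A v) = v := by
      rw [← he]; exact e.symm_apply_apply v
    rw [h2] at h1
    refine h1.trans (mul_le_mul_of_nonneg_right ?_ (norm_nonneg _))
    simp [N]
  have h1 := hg.isLittleO.def (c := 1 / (2 * N)) (by positivity)
  filter_upwards [h1] with x hx hxz t ht h0
  rw [hz, sub_zero] at hx
  have h2 : A (x - z) = (1 - t) • (A (x - z) - g x) := by
    have : A (x - z) - (1 - t) • (A (x - z) - g x) = g x + t • (A (x - z) - g x) := by module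
    rw [h0] at this
    exact sub_eq_zero.1 this
  have h3 : ‖A (x - z)‖ ≤ ‖g x - A (x - z)‖ := by
    conv_lhs => rw [h2]
    rw [norm_smul, Real.norm_of_nonneg (by linarith [ht.2]), norm_sub_rev]
    nlinarith [ht.1, norm_nonneg (g x - A (x - z))]
  have h4 : 0 < ‖x - z‖ := norm_pos_iff.2 (sub_ne_zero.2 hxz)
  have h5 := hlow (x - z)
  have h6 : N * (1 / (2 * N) * ‖x - z‖) = ‖x - z‖ / 2 := by field_simp
  have h7 := mul_le_mul_of_nonneg_left (h3.trans hx) hN.le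
  linarith

lemma eventually_closedBall_subset_of_nhds {X : Type*} [PseudoMetricSpace X] {z : X} {N : Set X}
    (hN : N ∈ 𝓝 z) : ∀ᶠ r in 𝓝[>] (0 : ℝ), closedBall z r ⊆ N := by
  obtain ⟨ε, hε, h⟩ := Metric.nhds_basis_closedBall.mem_iff.1 hN
  filter_upwards [Ioc_mem_nhdsGT hε] with r hr
  exact (closedBall_subset_closedBall hr.2).trans h

lemma exists_generic_approx {k : ℕ} {G : Amb k → Amb k} (hG : Continuous G) {Q K : Set (Amb k)}
    (hQ : IsOpen Q) (hQb : Bornology.IsBounded Q) (hK : IsCompact K) (hQK : frontier Q ⊆ K)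
    (hGK : ∀ x ∈ K, G x ≠ 0) :
    ∃ g : Amb k → Amb k, Continuous g ∧ (∀ x ∈ K, ‖g x - G x‖ < ‖G x‖) ∧
      ∃ (Z : Finset (Amb k)) (r : ℝ) (A : Amb k → Amb k →L[ℝ] Amb k), 0 < r ∧
        (∀ z ∈ Z, closedBall z r ⊆ Q ∧ (A z).det ≠ 0 ∧ ∀ x ∈ closedBall z r, x ≠ z →
          ∀ t ∈ Icc (0 : ℝ) 1, g x + t • (A z (x - z) - g x) ≠ 0) ∧
        (Z : Set (Amb k)).PairwiseDisjoint (fun z => closedBall z r) ∧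
        ∀ x ∈ Q, g x = 0 → x ∈ Z := by
  obtain ⟨c, hc, hle⟩ := exists_norm_lower_bound hK hG.continuousOn hGK
  obtain ⟨g₀, hg₀, hclose⟩ := exists_contDiff_close hG (half_pos hc)
  obtain ⟨a, ha, hreg⟩ := exists_regular_translate hg₀ (half_pos hc)
  let g : Amb k → Amb k := fun x => g₀ x - a
  have hgd : ∀ x, HasFDerivAt g (fderiv ℝ g₀ x) x := fun x =>
    (hg₀.differentiable one_ne_zero x).hasFDerivAt.sub_const a
  have hgc : Continuous g := hg₀.continuous.sub continuous_const
  have hgK : ∀ x ∈ K, ‖g x - G x‖ < ‖G x‖ := by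
    intro x hx
    have e : g x - G x = (g₀ x - G x) - a := by simp only [g]; abel
    rw [e]
    have := norm_sub_le (g₀ x - G x) a
    linarith [hclose x, hle x hx]
  let Z₀ : Set (Amb k) := closure Q ∩ {x | g x = 0}
  have hZ₀ : IsCompact Z₀ := hQb.isCompact_closure.inter_right
    (isClosed_eq hgc continuous_const)
  have hZ₀Q : Z₀ ⊆ Q := by
    rintro x ⟨hx, hx0⟩
    by_contra hxQ
    have h1 := hgK x (hQK (by rw [hQ.frontier_eq]; exact ⟨hx, hxQ⟩))
    rw [show g x = 0 from hx0, zero_sub, norm_neg] at h1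
    exact lt_irrefl _ h1
  have hdet : ∀ z ∈ Z₀, (fderiv ℝ g₀ z).det ≠ 0 := fun z hz =>
    hreg z (sub_eq_zero.1 hz.2)
  have hloc : ∀ z ∈ Z₀, ∀ᶠ x in 𝓝 z, x ≠ z → ∀ t ∈ Icc (0 : ℝ) 1,
      g x + t • (fderiv ℝ g₀ z (x - z) - g x) ≠ 0 := fun z hz =>
    eventually_segment_ne_zero (hgd z) hz.2 (hdet z hz)
  obtain ⟨Z, hZZ₀, hcov⟩ := hZ₀.elim_nhds_subcover _ hloc
  have hZ₀Z : ∀ x ∈ Z₀, x ∈ Z := by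
    intro x hx
    obtain ⟨z, hz, hxz⟩ := mem_iUnion₂.1 (hcov hx)
    by_cases h : x = z
    · rwa [h]
    · have := hxz h 0 (by simp)
      rw [show g x = 0 from hx.2] at this
      simp at this
  have ev1 : ∀ᶠ r in 𝓝[>] (0 : ℝ), ∀ z ∈ Z, closedBall z r ⊆ Q ∩ {x | x ≠ z →
      ∀ t ∈ Icc (0 : ℝ) 1, g x + t • (fderiv ℝ g₀ z (x - z) - g x) ≠ 0} := by
    rw [Filter.eventually_all_finset]
    intro z hz
    exact eventually_closedBall_subset_of_nhds
      (inter_mem (hQ.mem_nhds (hZ₀Q (hZZ₀ z hz))) (hloc z (hZZ₀ z hz)))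
  have ev2 : ∀ᶠ r in 𝓝[>] (0 : ℝ), ∀ z ∈ Z, ∀ z' ∈ Z, z ≠ z' → r + r < dist z z' := by
    rw [Filter.eventually_all_finset]
    intro z _
    rw [Filter.eventually_all_finset]
    intro z' _
    by_cases h : z = z'
    · exact Eventually.of_forall fun r h' => (h' h).elim
    · filter_upwards [Ioo_mem_nhdsGT (half_pos (dist_pos.2 h))] with r hr _
      linarith [hr.2]
  obtain ⟨r, ⟨hr1, hr2⟩, hr⟩ := ((ev1.and ev2).and self_mem_nhdsWithin).exists
  refine ⟨g, hgc, hgK, Z, r, fderiv ℝ g₀, hr, ?_, ?_, ?_⟩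
  · intro z hz
    exact ⟨fun x hx => (hr1 z hz hx).1, hdet z (hZZ₀ z hz), fun x hx => (hr1 z hz hx).2⟩
  · intro z hz z' hz' h
    exact closedBall_disjoint_closedBall (hr2 z hz z' hz' h)
  · intro x hx hx0
    exact hZ₀Z x ⟨subset_closure hx, hx0⟩

lemma apply_ne_zero_of_det_ne_zero {k : ℕ} {A : Amb k →L[ℝ] Amb k} (hA : A.det ≠ 0) {v : Amb k}
    (hv : v ≠ 0) : A v ≠ 0 := by
  intro h
  have hker : LinearMap.ker (A : Amb k →ₗ[ℝ] Amb k) = ⊥ := by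
    have hu : IsUnit (LinearMap.det (A : Amb k →ₗ[ℝ] Amb k)) := isUnit_iff_ne_zero.2 hA
    exact (LinearMap.isUnit_iff_ker_eq_bot _).1 ((LinearMap.isUnit_iff_isUnit_det _).2 hu)
  exact hv (LinearMap.ker_eq_bot'.1 hker v h)

/-- A universal form of the multiplicativity of the degree. -/
lemma exists_int_deg_comp {k : ℕ} {G : Amb k → Amb k} (hG : Continuous G) {Q K : Set (Amb k)}
    (hQ : IsOpen Q) (hQb : Bornology.IsBounded Q) (hK : IsCompact K) (hQK : frontier Q ⊆ K)
    (hGK : ∀ x ∈ K, G x ≠ 0) :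
    ∃ m : ℤ, ∀ (F : Amb k → Amb k) (O : Set (Amb k)) (d : ℝ), Continuous F → IsOpen O →
      Bornology.IsBounded O → (∀ x ∈ frontier O, F x ∉ Q) →
      (∀ x ∈ closure O, F x ∉ Q → F x ∈ K) → (∀ y ∈ Q, deg (fun x => F x - y) O = d) →
      DegAdm (fun x => G (F x)) O ∧ deg (fun x => G (F x)) O = d * m := by
  obtain ⟨g, hg, hgG, Z, r, A, hr, hZ, hdisj, hzero⟩ :=
    exists_generic_approx hG hQ hQb hK hQK hGK
  choose! s hs using fun z (hz : z ∈ Z) => exists_int_deg_linear (A z) (hZ z hz).2.1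
  refine ⟨∑ z ∈ Z, s z, fun F O d hF hO hOb hfr hFK hd => ?_⟩
  have hadm : DegAdm (fun x => G (F x)) O := ⟨hG.comp hF, hO, hOb, fun x hx =>
    hGK _ (hFK x (frontier_subset_closure hx) (hfr x hx))⟩
  refine ⟨hadm, ?_⟩
  obtain ⟨hadm', e1⟩ := deg_eq_of_norm_sub_lt (F₁ := fun x => g (F x)) hadm (hg.comp hF) fun x hx =>
    hgG _ (hFK x (frontier_subset_closure hx) (hfr x hx))
  have hQz : ∀ z ∈ Z, z ∈ Q := fun z hz => (hZ z hz).1 (mem_closedBall_self hr.le)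
  let U : Amb k → Set (Amb k) := fun z => O ∩ F ⁻¹' (ball z r)
  have hUo : ∀ z ∈ Z, IsOpen (U z) := fun z _ => hO.inter (isOpen_ball.preimage hF)
  have hUd : (Z : Set (Amb k)).PairwiseDisjoint U := fun z hz z' hz' h =>
    ((hdisj hz hz' h).mono ball_subset_closedBall ball_subset_closedBall |>.preimage
      F).mono inter_subset_right inter_subset_right
  have hUz : ∀ x ∈ O, g (F x) = 0 → ∃ z ∈ Z, x ∈ U z := by
    intro x hx hx0
    have hxQ : F x ∈ Q := by
      by_contra hxQ
      have h1 := hgG _ (hFK x (subset_closure hx) hxQ)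
      rw [hx0, zero_sub, norm_neg] at h1
      exact lt_irrefl _ h1
    have hxb : F x ∈ ball (F x) r := mem_ball_self hr
    exact ⟨F x, hzero _ hxQ hx0, hx, hxb⟩
  obtain ⟨hadmU, e2⟩ := deg_eq_sum hadm' Z U hUo
    (fun z _ => inter_subset_left) hUd hUz
  rw [e1, e2]
  push_cast
  rw [Finset.mul_sum]
  refine Finset.sum_congr rfl fun z hz => ?_
  have hA1 : DegAdm (fun x => F x - z) O := ⟨hF.sub continuous_const, hO, hOb, fun x hx h0 =>
    hfr x hx (sub_eq_zero.1 h0 ▸ hQz z hz)⟩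
  obtain ⟨hA2, e3⟩ := deg_excision hA1 (hUo z hz) inter_subset_left (fun x hx h0 =>
    ⟨hx, by rw [mem_preimage, sub_eq_zero.1 h0]; exact mem_ball_self hr⟩)
  rw [← hd z (hQz z hz), e3, mul_comm, ← hs z hz _ _ hA2]
  have hA3 : DegAdm (fun x => A z (F x - z)) (U z) := by
    refine ⟨(A z).continuous.comp hA2.cont, hUo z hz, hA2.bdd, fun x hx h0 => ?_⟩
    exact apply_ne_zero_of_det_ne_zero (hZ z hz).2.1 (hA2.ne_zero x hx) h0
  refine deg_eq_of_segment (hadmU z hz) hA3 fun x hx t ht => ?_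
  have hxc : F x ∈ closedBall z r := by
    have : closure (U z) ⊆ F ⁻¹' closedBall z r :=
      closure_minimal (fun y hy => mem_preimage.2 (ball_subset_closedBall
        (mem_preimage.1 hy.2))) (isClosed_closedBall.preimage hF)
    exact this (frontier_subset_closure hx)
  refine (hZ z hz).2.2 (F x) hxc (fun h => ?_) t ht
  exact hA2.ne_zero x hx (sub_eq_zero.2 h)

lemma exists_int_deg {k : ℕ} {G : Amb k → Amb k} {Q : Set (Amb k)} (h : DegAdm G Q) :
    ∃ m : ℤ, deg G Q = m := by
  obtain ⟨m, hm⟩ := exists_int_deg_comp h.cont h.isOpen h.bdd h.isCompact_frontier subset_rfl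
    h.ne_zero
  refine ⟨m, ?_⟩
  have := (hm id Q 1 continuous_id h.isOpen h.bdd
    (fun x hx hxQ => by rw [h.isOpen.frontier_eq] at hx; exact hx.2 hxQ)
    (fun x hx hxQ => by rw [h.isOpen.frontier_eq]; exact ⟨hx, hxQ⟩)
    (fun y hy => (deg_sub_const h.isOpen h.bdd hy).2)).2
  simpa using this

/-- Multiplicativity of the degree under composition. -/
lemma deg_comp {k : ℕ} {F G : Amb k → Amb k} {O Q : Set (Amb k)} {d : ℝ} (hF : Continuous F)
    (hO : IsOpen O) (hOb : Bornology.IsBounded O) (hQ : DegAdm G Q)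
    (hfr : ∀ x ∈ frontier O, F x ∉ Q) (hG : ∀ x ∈ closure O, F x ∉ Q → G (F x) ≠ 0)
    (hd : ∀ y ∈ Q, deg (fun x => F x - y) O = d) :
    DegAdm (fun x => G (F x)) O ∧ deg (fun x => G (F x)) O = d * deg G Q := by
  have hK : IsCompact (frontier Q ∪ ((F '' closure O) \ Q)) :=
    hQ.isCompact_frontier.union ((hOb.isCompact_closure.image hF).diff hQ.isOpen)
  obtain ⟨m, hm⟩ := exists_int_deg_comp hQ.cont hQ.isOpen hQ.bdd hK subset_union_left (by
    rintro x (hx | ⟨⟨y, hy, rfl⟩, hx⟩)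
    · exact hQ.ne_zero x hx
    · exact hG y hy hx)
  have h1 := hm F O d hF hO hOb hfr (fun x hx hxQ => Or.inr ⟨⟨x, hx, rfl⟩, hxQ⟩) hd
  have h2 := (hm id Q 1 continuous_id hQ.isOpen hQ.bdd
    (fun x hx hxQ => by rw [hQ.isOpen.frontier_eq] at hx; exact hx.2 hxQ)
    (fun x hx hxQ => by rw [hQ.isOpen.frontier_eq]; exact Or.inl ⟨hx, hxQ⟩)
    (fun y hy => (deg_sub_const hQ.isOpen hQ.bdd hy).2)).2
  simp only [id, one_mul] at h2
  rw [h2]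
  exact h1

lemma deg_sub_eventually_eq {k : ℕ} {F : Amb k → Amb k} {O : Set (Amb k)} {y : Amb k}
    (h : DegAdm (fun x => F x - y) O) (hF : Continuous F) :
    ∃ c > 0, ∀ y', dist y' y < c → DegAdm (fun x => F x - y') O ∧
      deg (fun x => F x - y) O = deg (fun x => F x - y') O := by
  obtain ⟨c, hc, hlow⟩ := exists_norm_lower_bound h.isCompact_frontier
    (F := fun x => F x - y) (by fun_prop) h.ne_zero
  refine ⟨c, hc, fun y' hy' => deg_eq_of_norm_sub_lt h (by fun_prop) fun x hx => ?_⟩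
  have h1 : F x - y' - (F x - y) = y - y' := by abel
  rw [h1, ← dist_eq_norm, dist_comm]
  exact hy'.trans_le (hlow x hx)

lemma deg_sub_eq_of_isPreconnected {k : ℕ} {F : Amb k → Amb k} {O S : Set (Amb k)}
    (hF : Continuous F) (hO : IsOpen O) (hOb : Bornology.IsBounded O) (hS : IsPreconnected S)
    (h : ∀ y ∈ S, ∀ x ∈ frontier O, F x ≠ y) {p q : Amb k} (hp : p ∈ S) (hq : q ∈ S) :
    deg (fun x => F x - p) O = deg (fun x => F x - q) O := by
  refine hS.induction₂ (fun p q => deg (fun x => F x - p) O = deg (fun x => F x - q) O)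
    (fun y hy => ?_) (fun _ _ _ _ _ _ => Eq.trans) (fun _ _ _ _ => Eq.symm) hp hq
  have hadm : DegAdm (fun x => F x - y) O :=
    ⟨by fun_prop, hO, hOb, fun x hx => sub_ne_zero.2 (h y hy x hx)⟩
  obtain ⟨c, hc, h1⟩ := deg_sub_eventually_eq hadm hF
  filter_upwards [mem_nhdsWithin_of_mem_nhds (ball_mem_nhds y hc)] with y' hy'
  exact (h1 y' hy').2

lemma exists_continuous_extension {X E : Type*} [TopologicalSpace X] [NormalSpace X]
    [NormedAddCommGroup E] [NormedSpace ℝ E] [FiniteDimensional ℝ E] {s : Set X} {f : X → E}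
    (hs : IsClosed s) (hf : ContinuousOn f s) : ∃ g : X → E, Continuous g ∧ EqOn g f s := by
  have : TietzeExtension E := TietzeExtension.of_tvs ℝ
  obtain ⟨g, hg⟩ := ContinuousMap.exists_restrict_eq hs ⟨s.domRestrict f, hf.domRestrict⟩
  exact ⟨g, g.continuous, fun x hx => congrArg (fun F : C(s, E) => F ⟨x, hx⟩) hg⟩

/-- `S` is a topologically embedded `k`-sphere in `ℝ^{k+1}` and `U` is a bounded component of its
complement. -/
structure CellData {k : ℕ} (S U : Set (Amb k)) : Prop where
  emb : ∃ e : sphere (0 : Amb k) 1 → Amb k, Continuous e ∧ Function.Injective e ∧ range e = S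
  isOpen : IsOpen U
  nonempty : U.Nonempty
  preconn : IsPreconnected U
  bdd : Bornology.IsBounded U
  disj : Disjoint S U
  frontier_subset : frontier U ⊆ S

lemma exists_sphere_inverse {k : ℕ} {e : sphere (0 : Amb k) 1 → Amb k} (he : Continuous e)
    (hi : Function.Injective e) : ∃ g : Amb k → Amb k, Continuous g ∧ ∀ u, g (e u) = u := by
  have : TietzeExtension (Amb k) := TietzeExtension.of_tvs ℝ
  have : CompactSpace (sphere (0 : Amb k) 1) := isCompact_iff_compactSpace.1 (isCompact_sphere 0 1)
  have hce : IsClosedEmbedding e := he.isClosedEmbedding hi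
  obtain ⟨g, hg⟩ := ContinuousMap.exists_extension' hce ⟨Subtype.val, continuous_subtype_val⟩
  exact ⟨g, g.continuous, fun u => congrFun hg u⟩

lemma exists_retraction_punctured {k : ℕ} {e : sphere (0 : Amb k) 1 → Amb k} (he : Continuous e)
    (hi : Function.Injective e) {K : Set (Amb k)} (hK : IsClosed K) (hKS : K ⊆ range e)
    {x : Amb k} (hx : x ∈ range e) (hxK : x ∉ K) :
    ∃ ρ : Amb k → Amb k, Continuous ρ ∧ (∀ y, ρ y ∈ range e) ∧ (∀ y, ρ y ≠ x) ∧
      ∀ y ∈ K, ρ y = y := by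
  obtain ⟨g, hg, hge⟩ := exists_sphere_inverse he hi
  obtain ⟨u, rfl⟩ := hx
  have hu : ‖(u : Amb k)‖ = 1 := by simp
  have hne : ∀ y ∈ K, innerSL ℝ (u : Amb k) (g y) ≠ 1 := by
    intro y hy h1
    obtain ⟨w, rfl⟩ := hKS hy
    rw [hge] at h1
    have hw : ‖(w : Amb k)‖ = 1 := by simp
    have := (inner_eq_one_iff_of_norm_eq_one (𝕜 := ℝ) hu hw).1 (by simpa using h1)
    exact hxK (by rw [Subtype.ext this]; exact hy)
  obtain ⟨Φ, hΦ, hΦK⟩ := exists_continuous_extension (f := fun y => stereoToFun (u : Amb k) (g y))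
    hK (continuousOn_stereoToFun.comp hg.continuousOn hne)
  refine ⟨fun y => e (stereoInvFun hu (Φ y)), by
    exact he.comp ((continuous_stereoInvFun hu).comp hΦ), fun y => mem_range_self _,
    fun y h => ?_, fun y hy => ?_⟩
  · exact stereoInvFun_ne_north_pole hu (Φ y) (hi h)
  · obtain ⟨w, rfl⟩ := hKS hy
    have h1 : Φ (e w) = stereoToFun (u : Amb k) (w : Amb k) := by rw [hΦK hy]; simp only [hge]
    have h2 : (w : Amb k) ≠ u := by
      intro h; exact hxK (by rw [← Subtype.ext h]; exact hy)
    simp only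
    rw [h1, stereo_left_inv hu h2]

lemma frontier_component_subset {k : ℕ} {V : Set (Amb k)} (hV : IsOpen V) {p : Amb k} :
    frontier (connectedComponentIn V p) ⊆ Vᶜ := by
  intro y hy hyV
  have ho : IsOpen (connectedComponentIn V p) := hV.connectedComponentIn
  rw [ho.frontier_eq] at hy
  have hyo : IsOpen (connectedComponentIn V y) := hV.connectedComponentIn
  obtain ⟨z, hz1, hz2⟩ := mem_closure_iff.1 hy.1 _ hyo (mem_connectedComponentIn hyV)
  have h1 := connectedComponentIn_eq hz1
  have h2 := connectedComponentIn_eq hz2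
  exact hy.2 (by rw [h2, ← h1]; exact mem_connectedComponentIn hyV)

namespace CellData

variable {k : ℕ} {S U : Set (Amb k)}

lemma isCompact_bd (h : CellData S U) : IsCompact S := by
  have : CompactSpace (sphere (0 : Amb k) 1) := isCompact_iff_compactSpace.1 (isCompact_sphere 0 1)
  obtain ⟨e, he, -, rfl⟩ := h.emb
  exact isCompact_range he

lemma retraction (h : CellData S U) {K : Set (Amb k)} (hK : IsClosed K) (hKS : K ⊆ S)
    {x : Amb k} (hx : x ∈ S) (hxK : x ∉ K) :
    ∃ ρ : Amb k → Amb k, Continuous ρ ∧ (∀ y, ρ y ∈ S) ∧ (∀ y, ρ y ≠ x) ∧ ∀ y ∈ K, ρ y = y := by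
  obtain ⟨e, he, hi, rfl⟩ := h.emb
  exact exists_retraction_punctured he hi hK hKS hx hxK

lemma not_mem_bd (h : CellData S U) {x : Amb k} (hx : x ∈ U) : x ∉ S :=
  fun hS => h.disj.ne_of_mem hS hx rfl

lemma closure_subset (h : CellData S U) : closure U ⊆ S ∪ U := by
  rw [closure_eq_self_union_frontier]
  exact union_subset subset_union_right (h.frontier_subset.trans subset_union_left)

lemma isClosed_carrier (h : CellData S U) : IsClosed (S ∪ U) := by
  have : S ∪ U = S ∪ closure U :=
    (union_subset_union_right _ subset_closure).antisymm
      (union_subset subset_union_left h.closure_subset)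
  rw [this]
  exact h.isCompact_bd.isClosed.union isClosed_closure

lemma isCompact_carrier (h : CellData S U) : IsCompact (S ∪ U) :=
  isCompact_of_isClosed_isBounded h.isClosed_carrier (h.isCompact_bd.isBounded.union h.bdd)

lemma bd_subset_closure (h : CellData S U) : S ⊆ closure U := by
  intro x hx
  by_contra hxU
  obtain ⟨p, hp⟩ := h.nonempty
  obtain ⟨ρ, hρ, hρS, hρx, hρK⟩ := h.retraction (K := frontier U) isClosed_frontier
    h.frontier_subset hx (fun hf => hxU (frontier_subset_closure hf))
  have h1 := deg_sub_const h.isOpen h.bdd hp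
  have h2 := deg_congr (F₁ := fun y => ρ y - p) h1.1 (by fun_prop)
    (fun y hy => by simp only [hρK y hy])
  have hadm : DegAdm (fun y => ρ y - p) U := ⟨by fun_prop, h.isOpen, h.bdd,
    fun y _ => sub_ne_zero.2 fun he => h.not_mem_bd hp (he ▸ hρS y)⟩
  have h3 := deg_eq_zero hadm
    (fun y _ => sub_ne_zero.2 fun he => h.not_mem_bd hp (he ▸ hρS y))
  rw [← h2, h1.2] at h3
  exact one_ne_zero h3

lemma joinedIn_of_near (h : CellData S U) {x : Amb k} (hx : x ∈ S) {ε : ℝ} (hε : 0 < ε) :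
    ∃ δ > 0, ∀ p ∈ U ∩ ball x δ, ∀ q ∈ U ∩ ball x δ, JoinedIn (U ∩ ball x ε) p q := by
  obtain ⟨ρ, hρ, hρS, hρx, hρK⟩ := h.retraction (K := S \ ball x (ε / 2))
    (h.isCompact_bd.isClosed.sdiff isOpen_ball) sdiff_subset hx
    (fun hh => hh.2 (mem_ball_self (half_pos hε)))
  obtain ⟨c, hc, hclow⟩ := exists_norm_lower_bound (isCompact_closedBall x ε)
    (F := fun y => ρ y - x) (by fun_prop) (fun y _ => sub_ne_zero.2 (hρx y))
  set δ := min c (ε / 2) with hδ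
  have hδ0 : 0 < δ := lt_min hc (half_pos hε)
  have hδε : δ ≤ ε / 2 := min_le_right _ _
  refine ⟨δ, hδ0, fun p hp q hq => ?_⟩
  have hsub : ball x δ ⊆ ball x ε := ball_subset_ball (by linarith)
  have hVo : IsOpen (U ∩ ball x ε) := h.isOpen.inter isOpen_ball
  have hpV : p ∈ U ∩ ball x ε := ⟨hp.1, hsub hp.2⟩
  have hqV : q ∈ U ∩ ball x ε := ⟨hq.1, hsub hq.2⟩
  set P := connectedComponentIn (U ∩ ball x ε) p with hP
  have hPo : IsOpen P := hVo.connectedComponentIn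
  have hpP : p ∈ P := mem_connectedComponentIn hpV
  have hPV : P ⊆ U ∩ ball x ε := connectedComponentIn_subset _ _
  suffices hqP : q ∈ P by
    have hpc : IsPathConnected P := hPo.isConnected_iff_isPathConnected.1
      (isConnected_connectedComponentIn_iff.2 hpV)
    exact (hpc.joinedIn p hpP q hqP).mono hPV
  by_contra hqP
  have hPb : Bornology.IsBounded P := isBounded_ball.subset (hPV.trans inter_subset_right)
  let χ : Amb k → ℝ := fun y => max 0 (min 1 ((dist y x - ε / 2) / (ε / 2)))
  let F : Amb k → Amb k := fun y => y + χ y • (ρ y - y)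
  have hχ : Continuous χ := by fun_prop
  have hF : Continuous F := by fun_prop
  have hF1 : ∀ y, dist y x ≤ ε / 2 → F y = y := by
    intro y hy
    have : χ y = 0 := by
      have h1 : (dist y x - ε / 2) / (ε / 2) ≤ 0 := div_nonpos_of_nonpos_of_nonneg (by linarith)
        (by linarith)
      exact max_eq_left ((min_le_right _ _).trans h1)
    simp [F, this]
  have hF2 : ∀ y, dist y x = ε → F y = ρ y := by
    intro y hy
    have : χ y = 1 := by
      have h1 : (dist y x - ε / 2) / (ε / 2) = 1 := by rw [hy]; field_simp; norm_num
      simp only [χ, h1]; norm_num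
    simp [F, this]
  have hfr : ∀ y ∈ frontier P, F y ∈ S ∧ (ε / 2 ≤ dist y x → F y ∉ ball x δ) := by
    intro y hy
    have hyV : y ∉ U ∩ ball x ε := frontier_component_subset hVo hy
    have hyc : y ∈ closure (U ∩ ball x ε) := closure_mono hPV (frontier_subset_closure hy)
    have hyU : y ∈ closure U := closure_mono inter_subset_left hyc
    have hyb : dist y x ≤ ε :=
      closure_ball_subset_closedBall (closure_mono inter_subset_right hyc)
    rcases hyb.eq_or_lt with he | hlt
    · rw [hF2 y he]
      refine ⟨hρS y, fun _ hb => ?_⟩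
      have h1 := hclow y (mem_closedBall.2 hyb)
      rw [← dist_eq_norm] at h1
      exact absurd (mem_ball.1 hb) (not_lt.2 ((min_le_left _ _).trans h1))
    · have hyS : y ∈ S := by
        rcases h.closure_subset hyU with h1 | h1
        · exact h1
        · exact absurd ⟨h1, mem_ball.2 hlt⟩ hyV
      have hFy : F y = y := by
        rcases le_or_gt (dist y x) (ε / 2) with h1 | h1
        · exact hF1 y h1
        · have : ρ y = y := hρK y ⟨hyS, fun hb => absurd (mem_ball.1 hb) (not_lt.2 h1.le)⟩
          simp [F, this]
      rw [hFy]
      exact ⟨hyS, fun h1 hb => absurd (mem_ball.1 hb) (not_lt.2 (hδε.trans h1))⟩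
  have hpq : deg (fun y => F y - p) P = deg (fun y => F y - q) P :=
    deg_sub_eq_of_isPreconnected hF hPo hPb h.preconn
      (fun y hy z hz he => h.not_mem_bd hy (he ▸ (hfr z hz).1)) hp.1 hq.1
  have hO1o : IsOpen (P ∩ ball x (ε / 2)) := hPo.inter isOpen_ball
  have hO2o : IsOpen (P \ closedBall x (ε / 2)) := hPo.sdiff isClosed_closedBall
  have hO1b : Bornology.IsBounded (P ∩ ball x (ε / 2)) := hPb.subset inter_subset_left
  have hO2b : Bornology.IsBounded (P \ closedBall x (ε / 2)) := hPb.subset sdiff_subset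
  have hsplit : ∀ r ∈ U ∩ ball x δ,
      (DegAdm (fun y => F y - r) (P ∩ ball x (ε / 2))) ∧ deg (fun y => F y - r) P =
        deg (fun y => F y - r) (P ∩ ball x (ε / 2)) +
        deg (fun y => F y - r) (P \ closedBall x (ε / 2)) := by
    intro r hr
    have hadm : DegAdm (fun y => F y - r) P := ⟨by fun_prop, hPo, hPb,
      fun y hy => sub_ne_zero.2 fun he => h.not_mem_bd hr.1 (he ▸ (hfr y hy).1)⟩
    have h1 := deg_eq_sum hadm (Finset.univ : Finset Bool)
      (fun b => cond b (P ∩ ball x (ε / 2)) (P \ closedBall x (ε / 2)))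
      (by rintro (_ | _) -; exacts [hO2o, hO1o])
      (by rintro (_ | _) -; exacts [sdiff_subset, inter_subset_left])
      (by
        have hd : Disjoint (P ∩ ball x (ε / 2)) (P \ closedBall x (ε / 2)) :=
          disjoint_left.2 fun y hy hy' => hy'.2 (ball_subset_closedBall hy.2)
        rintro (_ | _) - (_ | _) - hne
        · exact absurd rfl hne
        · exact hd.symm
        · exact hd
        · exact absurd rfl hne)
      (by
        intro y hy hy0
        rcases lt_trichotomy (dist y x) (ε / 2) with h2 | h2 | h2
        · exact ⟨true, Finset.mem_univ _, hy, mem_ball.2 h2⟩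
        · have h3 : y = r := by rw [← hF1 y h2.le]; exact sub_eq_zero.1 hy0
          have h4 : dist y x < δ := by rw [h3]; exact hr.2
          linarith
        · exact ⟨false, Finset.mem_univ _, hy, fun h3 => absurd (mem_closedBall.1 h3) (not_le.2 h2)⟩)
    refine ⟨h1.1 true (Finset.mem_univ _), h1.2.trans ?_⟩
    rw [Fintype.sum_bool]
    rfl
  have h2 : deg (fun y => F y - p) (P \ closedBall x (ε / 2)) =
      deg (fun y => F y - q) (P \ closedBall x (ε / 2)) := by
    refine deg_sub_eq_of_isPreconnected hF hO2o hO2b (convex_ball x δ).isPreconnected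
      (fun y hy z hz he => ?_) hp.2 hq.2
    rw [hO2o.frontier_eq] at hz
    have hzP : z ∈ closure P := closure_mono sdiff_subset hz.1
    have hzb : z ∈ closure (ball x (ε / 2))ᶜ := closure_mono
      (fun w hw hw' => hw.2 (ball_subset_closedBall hw')) hz.1
    rw [isOpen_ball.isClosed_compl.closure_eq] at hzb
    have hzd : ε / 2 ≤ dist z x := not_lt.1 fun hlt => hzb (mem_ball.2 hlt)
    rcases hzd.eq_or_lt with h3 | h3
    · rw [hF1 z h3.ge] at he
      have := mem_ball.1 hy
      rw [← he] at this
      linarith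
    · have hzfr : z ∈ frontier P := by
        rw [hPo.frontier_eq]
        exact ⟨hzP, fun hzP' => hz.2 ⟨hzP', fun h4 => absurd (mem_closedBall.1 h4) (not_le.2 h3)⟩⟩
      exact (hfr z hzfr).2 hzd (he ▸ hy)
  have hpb : p ∈ P ∩ ball x (ε / 2) := ⟨hpP, ball_subset_ball hδε hp.2⟩
  have h3 : deg (fun y => F y - p) (P ∩ ball x (ε / 2)) = 1 := by
    have h4 := deg_sub_const hO1o hO1b hpb
    rw [← h4.2]
    refine deg_congr (hsplit p hp).1 (by fun_prop) fun y hy => ?_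
    have : y ∈ closedBall x (ε / 2) := closure_ball_subset_closedBall
      (closure_mono inter_subset_right (frontier_subset_closure hy))
    rw [hF1 y this]
  have h4 : deg (fun y => F y - q) (P ∩ ball x (ε / 2)) = 0 := by
    refine deg_eq_zero (hsplit q hq).1 fun y hy => sub_ne_zero.2 fun he => hqP ?_
    rw [hF1 y (mem_ball.1 hy.2).le] at he
    exact he ▸ hy.1
  have h5 := (hsplit p hp).2
  have h6 := (hsplit q hq).2
  rw [hpq, h6, h2, h3, h4] at h5
  linarith

end CellData

lemma exists_sphere_extension {k : ℕ} {e : sphere (0 : Amb k) 1 → Amb k} (he : Continuous e) :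
    ∃ F : Amb k → Amb k, Continuous F ∧ ∀ u : sphere (0 : Amb k) 1, F u = e u := by
  have : TietzeExtension (Amb k) := TietzeExtension.of_tvs ℝ
  obtain ⟨g, hg⟩ := ContinuousMap.exists_restrict_eq isClosed_sphere ⟨e, he⟩
  exact ⟨g, g.continuous, fun u => congrArg (fun F : C(sphere (0 : Amb k) 1, Amb k) => F u) hg⟩

lemma CellData.exists_neighborhood_retraction {k : ℕ} {S U : Set (Amb k)} (h : CellData S U) :
    ∃ N : Set (Amb k), ∃ r : Amb k → Amb k, IsOpen N ∧ S ∪ U ⊆ N ∧ ContinuousOn r N ∧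
      MapsTo r N (S ∪ U) ∧ ∀ y ∈ S ∪ U, r y = y := by
  classical
  obtain ⟨e, he, hi, heS⟩ := h.emb
  obtain ⟨g, hg, hge⟩ := exists_sphere_inverse he hi
  obtain ⟨F, hF, hFe⟩ := exists_sphere_extension he
  let R : Amb k → Amb k := fun y => F (‖g y‖⁻¹ • g y)
  have hRS : ∀ y, g y ≠ 0 → R y ∈ S := by
    intro y hy
    have h1 : ‖g y‖⁻¹ • g y ∈ sphere (0 : Amb k) 1 := by
      rw [mem_sphere_zero_iff_norm, norm_smul, norm_inv, norm_norm,
        inv_mul_cancel₀ (norm_ne_zero_iff.2 hy)]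
    rw [← heS]
    exact ⟨⟨_, h1⟩, (hFe ⟨_, h1⟩).symm⟩
  have hg1 : ∀ y ∈ S, ‖g y‖ = 1 := by
    intro y hy
    rw [← heS] at hy
    obtain ⟨u, rfl⟩ := hy
    rw [hge]; simp
  have hRid : ∀ y ∈ S, R y = y := by
    intro y hy
    simp only [R, hg1 y hy, inv_one, one_smul]
    rw [← heS] at hy
    obtain ⟨u, rfl⟩ := hy
    rw [hge, hFe]
  have hg0 : ∀ y ∈ S, g y ≠ 0 := fun y hy h0 => by
    have := hg1 y hy
    rw [h0, norm_zero] at this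
    exact zero_ne_one this
  refine ⟨U ∪ {y | g y ≠ 0}, U.piecewise id R, h.isOpen.union (isOpen_ne_fun hg continuous_const),
    union_subset (fun y hy => Or.inr (hg0 y hy)) subset_union_left, ?_, ?_, ?_⟩
  · refine ContinuousOn.piecewise ?_ continuousOn_id ?_
    · intro y hy
      exact (hRid y (h.frontier_subset hy.2)).symm
    · rw [h.isOpen.isClosed_compl.closure_eq]
      have hsub : (U ∪ {y | g y ≠ 0}) ∩ Uᶜ ⊆ {y | g y ≠ 0} := by
        rintro y ⟨h1 | h1, h2⟩
        · exact absurd h1 h2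
        · exact h1
      refine ContinuousOn.mono ?_ hsub
      refine hF.comp_continuousOn (ContinuousOn.fun_smul ?_ hg.continuousOn)
      exact hg.norm.continuousOn.inv₀ fun y hy => norm_ne_zero_iff.2 hy
  · intro y hy
    by_cases hyU : y ∈ U
    · rw [piecewise_eq_of_mem _ _ _ hyU]; exact Or.inr hyU
    · rw [piecewise_eq_of_notMem _ _ _ hyU]
      exact Or.inl (hRS y (hy.resolve_left hyU))
  · intro y hy
    by_cases hyU : y ∈ U
    · rw [piecewise_eq_of_mem _ _ _ hyU]; rfl
    · rw [piecewise_eq_of_notMem _ _ _ hyU]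
      exact hRid y (hy.resolve_right hyU)

lemma exists_bounded_open_frontier_subset_range {k : ℕ} {e : sphere (0 : Amb k) 1 → Amb k}
    (he : Continuous e) (hi : Function.Injective e) :
    ∃ W : Set (Amb k), IsOpen W ∧ W.Nonempty ∧ Bornology.IsBounded W ∧ Disjoint (range e) W ∧
      frontier W ⊆ range e := by
  obtain ⟨g, hg, hge⟩ := exists_sphere_inverse he hi
  obtain ⟨F, hF, hFe⟩ := exists_sphere_extension he
  have : CompactSpace (sphere (0 : Amb k) 1) := isCompact_iff_compactSpace.1 (isCompact_sphere 0 1)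
  have hSc : IsClosed (range e) := (isCompact_range he).isClosed
  have hfrO : frontier (ball (0 : Amb k) 1) = sphere 0 1 := frontier_ball 0 one_ne_zero
  have hFfr : ∀ x ∈ frontier (ball (0 : Amb k) 1), F x ∈ range e := by
    intro x hx
    rw [hfrO] at hx
    exact ⟨⟨x, hx⟩, (hFe ⟨x, hx⟩).symm⟩
  have hadm : ∀ y ∉ range e, DegAdm (fun x => F x - y) (ball 0 1) := fun y hy =>
    ⟨by fun_prop, isOpen_ball, isBounded_ball,
      fun x hx => sub_ne_zero.2 fun h => hy (h ▸ hFfr x hx)⟩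
  obtain ⟨R, hR0, hR⟩ : ∃ R > 0, ∀ x ∈ closedBall (0 : Amb k) 1, ‖F x‖ ≤ R := by
    obtain ⟨R, hR⟩ := (isCompact_closedBall (0 : Amb k) 1).exists_bound_of_continuousOn
      hF.continuousOn
    exact ⟨max R 1, by positivity, fun x hx => (hR x hx).trans (le_max_left _ _)⟩
  have heR : ∀ u, ‖e u‖ ≤ R := fun u => by
    rw [← hFe]; exact hR _ (sphere_subset_closedBall u.2)
  set W : Set (Amb k) := {y | y ∉ range e ∧ deg (fun x => F x - y) (ball 0 1) ≠ 0} with hW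
  have hloc : ∀ y ∉ range e, ∀ᶠ y' in 𝓝 y, y' ∉ range e ∧
      deg (fun x => F x - y) (ball 0 1) = deg (fun x => F x - y') (ball 0 1) := by
    intro y hy
    obtain ⟨c, hc, h1⟩ := deg_sub_eventually_eq (hadm y hy) hF
    filter_upwards [hSc.isOpen_compl.mem_nhds hy, ball_mem_nhds y hc] with y' h2 h3
    exact ⟨h2, (h1 y' h3).2⟩
  refine ⟨W, ?_, ?_, ?_, ?_, ?_⟩
  · refine isOpen_iff_mem_nhds.2 fun y hy => ?_
    filter_upwards [hloc y hy.1] with y' h1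
    exact ⟨h1.1, h1.2 ▸ hy.2⟩
  · by_contra hemp
    have hD : ∀ y ∉ range e, deg (fun x => F x - y) (ball 0 1) = 0 := by
      intro y hy
      by_contra h0
      exact hemp ⟨y, hy, h0⟩
    obtain ⟨M, hM⟩ := (isCompact_closedBall (0 : Amb k) (R + 1)).exists_bound_of_continuousOn
      hg.continuousOn
    obtain ⟨c, hc⟩ : ∃ c : Amb k, M < ‖c‖ := by
      obtain ⟨c, hc⟩ := NormedSpace.exists_lt_norm ℝ (Amb k) M
      exact ⟨c, hc⟩
    let G : Amb k → Amb k := fun y => g y + max 0 (‖y‖ - R) • c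
    have hG : Continuous G := by fun_prop
    have hGe : ∀ u, G (e u) = u := by
      intro u
      have h1 : max 0 (‖e u‖ - R) = 0 := max_eq_left (by linarith [heR u])
      simp only [G, h1, zero_smul, add_zero, hge]
    have hGe0 : ∀ y ∈ range e, G y ≠ 0 := by
      rintro _ ⟨u, rfl⟩ h0
      rw [hGe] at h0
      have : ‖(u : Amb k)‖ = 1 := by simp
      rw [h0, norm_zero] at this
      exact zero_ne_one this
    have hQ : DegAdm G (ball 0 (R + 1) \ range e) := by
      refine ⟨hG, isOpen_ball.sdiff hSc, isBounded_ball.subset sdiff_subset, fun y hy => ?_⟩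
      have hcl : y ∈ closedBall (0 : Amb k) (R + 1) := closure_ball_subset_closedBall
        (closure_mono sdiff_subset (frontier_subset_closure hy))
      rw [(isOpen_ball.sdiff hSc).frontier_eq] at hy
      by_cases hye : y ∈ range e
      · exact hGe0 y hye
      · have h2 : ¬ ‖y‖ < R + 1 := fun h => hy.2 ⟨by simpa using h, hye⟩
        have h3 : ‖y‖ = R + 1 := le_antisymm (by simpa using hcl) (not_lt.1 h2)
        have h4 : max 0 (‖y‖ - R) = 1 := by rw [h3]; norm_num
        intro h0
        simp only [G, h4, one_smul] at h0
        have h5 : ‖g y‖ = ‖c‖ := by rw [eq_neg_of_add_eq_zero_left h0, norm_neg]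
        linarith [hM y hcl]
    have h1 := deg_comp hF isOpen_ball isBounded_ball hQ
      (fun x hx hq => hq.2 (hFfr x hx))
      (fun x hx hq => by
        refine hGe0 _ ?_
        by_contra hne
        refine hq ⟨?_, hne⟩
        have := hR x (closure_ball_subset_closedBall hx)
        rw [mem_ball_zero_iff]; linarith)
      (fun y hy => hD y hy.2)
    have h2 := deg_sub_const (isOpen_ball (x := (0 : Amb k)) (ε := 1)) isBounded_ball
      (mem_ball_self one_pos)
    have h3 := deg_congr (F₁ := fun x => G (F x)) h2.1 (hG.comp hF) (by
      intro x hx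
      rw [hfrO] at hx
      have := hGe ⟨x, hx⟩
      rw [← hFe] at this
      simp only [sub_zero]
      exact this.symm)
    rw [h2.2, h1.2, zero_mul] at h3
    exact one_ne_zero h3
  · refine (isBounded_closedBall (x := (0 : Amb k)) (r := R)).subset fun y hy => ?_
    by_contra hyR
    have hyR' : R < ‖y‖ := by simpa using hyR
    refine hy.2 (deg_eq_zero (hadm y hy.1) fun x hx => sub_ne_zero.2 fun h => ?_)
    have := hR x (ball_subset_closedBall hx)
    rw [h] at this
    linarith
  · exact disjoint_left.2 fun y hy hyW => hyW.1 hy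
  · intro y hy
    by_contra hye
    obtain ⟨y1, h1, h2⟩ := mem_closure_iff_nhds.1 (frontier_subset_closure hy) _ (hloc y hye)
    have hyc : y ∈ closure Wᶜ := by rw [frontier_eq_closure_inter_closure] at hy; exact hy.2
    obtain ⟨y2, h3, h4⟩ := mem_closure_iff_nhds.1 hyc _ (hloc y hye)
    exact h4 ⟨h3.1, by rw [← h3.2, h1.2]; exact h2.2⟩

open Path.Homotopic (Quotient) in
/-- The set of endpoints `w` of paths `τ` from `w₀` whose image under `φ` represents `q` followed by
a path in `B`. -/
def liftSet {A X : Type*} [TopologicalSpace A] [TopologicalSpace X] (φ : C(A, X)) (w₀ : A) {x : X}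
    (q : Path.Homotopic.Quotient (φ w₀) x) (B : Set X) : Set A :=
  {w | ∃ s : Path x (φ w), (∀ t, s t ∈ B) ∧ ∃ τ : Path w₀ w,
    q.trans (.mk s) = .mk (τ.map φ.continuous)}

/-- Any two paths in `B` with the same endpoints are homotopic in the ambient space. -/
def PathsHomotopicIn {X : Type*} [TopologicalSpace X] (B : Set X) : Prop :=
  ∀ ⦃x y : X⦄ (s s' : Path x y), (∀ t, s t ∈ B) → (∀ t, s' t ∈ B) → s.Homotopic s'

section LiftSet

variable {A X : Type*} [TopologicalSpace A] [TopologicalSpace X] {φ : C(A, X)} {w₀ : A}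

lemma liftSet_subset_preimage {x : X} (q : Path.Homotopic.Quotient (φ w₀) x) (B : Set X) :
    liftSet φ w₀ q B ⊆ φ ⁻¹' B := by
  rintro w ⟨s, hs, -⟩
  have := hs 1
  rwa [s.target] at this

lemma mem_liftSet_of_joinedIn {x : X} {q : Path.Homotopic.Quotient (φ w₀) x} {B : Set X} {w w' : A}
    (hw : w ∈ liftSet φ w₀ q B) (h : JoinedIn (φ ⁻¹' B) w w') : w' ∈ liftSet φ w₀ q B := by
  obtain ⟨s, hs, τ, hτ⟩ := hw
  obtain ⟨γ, hγ⟩ := h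
  refine ⟨s.trans (γ.map φ.continuous), fun t => ?_, τ.trans γ, ?_⟩
  · have : s.trans (γ.map φ.continuous) t ∈ range (s.trans (γ.map φ.continuous)) := mem_range_self t
    rw [Path.trans_range] at this
    rcases this with ⟨u, hu⟩ | ⟨u, hu⟩
    · rw [← hu]; exact hs u
    · rw [← hu]; exact hγ u
  · rw [Path.map_trans, Path.Homotopic.Quotient.mk_trans, Path.Homotopic.Quotient.mk_trans, ← hτ,
      Path.Homotopic.Quotient.trans_assoc]

lemma isOpen_liftSet [LocallyPathConnectedSpace A] {x : X} (q : Path.Homotopic.Quotient (φ w₀) x)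
    {B : Set X} (hB : IsOpen B) : IsOpen (liftSet φ w₀ q B) := by
  refine isOpen_iff_mem_nhds.2 fun w hw => ?_
  have h1 : IsOpen (φ ⁻¹' B) := hB.preimage φ.continuous
  have hwB : w ∈ φ ⁻¹' B := liftSet_subset_preimage q B hw
  filter_upwards [h1.pathComponentIn w |>.mem_nhds (mem_pathComponentIn_self hwB)] with w' hw'
  exact mem_liftSet_of_joinedIn hw hw'

lemma mem_liftSet_of_mem_closure [LocallyPathConnectedSpace A] {x : X}
    {q : Path.Homotopic.Quotient (φ w₀) x} {B : Set X} (hB : IsOpen B) {w : A}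
    (hw : w ∈ closure (liftSet φ w₀ q B)) (hwB : φ w ∈ B) : w ∈ liftSet φ w₀ q B := by
  have h1 : IsOpen (φ ⁻¹' B) := hB.preimage φ.continuous
  obtain ⟨w', h2, h3⟩ := mem_closure_iff.1 hw _ (h1.pathComponentIn w)
    (mem_pathComponentIn_self hwB)
  exact mem_liftSet_of_joinedIn h3 h2.symm

lemma mem_liftSet_trans_iff {x : X} {q : Path.Homotopic.Quotient (φ w₀) x} {B B' : Set X}
    (hB' : PathsHomotopicIn B') {x' : X} (s : Path x x')
    (hs : ∀ t, s t ∈ B) (hB : PathsHomotopicIn B) (hx' : x' ∈ B') {w : A} (hw : φ w = x') :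
    w ∈ liftSet φ w₀ (q.trans (.mk s)) B' ↔ w ∈ liftSet φ w₀ q B := by
  subst hw
  constructor
  · rintro ⟨c, hc, τ, hτ⟩
    refine ⟨s, hs, τ, ?_⟩
    rw [← hτ, Path.Homotopic.Quotient.eq.2 (hB' c (Path.refl _) hc fun _ => hx'),
      Path.Homotopic.Quotient.mk_refl, Path.Homotopic.Quotient.trans_refl]
  · rintro ⟨c, hc, τ, hτ⟩
    refine ⟨Path.refl _, fun _ => hx', τ, ?_⟩
    rw [← hτ, Path.Homotopic.Quotient.eq.2 (hB c s hc hs),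
      Path.Homotopic.Quotient.mk_refl, Path.Homotopic.Quotient.trans_refl]

lemma mem_liftSet_of_map {w : A} (τ : Path w₀ w) {x : X} (h : x = φ w) {B : Set X} (hx : x ∈ B) :
    w ∈ liftSet φ w₀ (.mk ((τ.map φ.continuous).cast rfl h)) B := by
  subst h
  exact ⟨Path.refl _, fun _ => hx, τ, by
    rw [Path.Homotopic.Quotient.mk_refl, Path.Homotopic.Quotient.trans_refl]; rfl⟩

lemma liftSet_subset_of_mem {x : X} {q q' : Path.Homotopic.Quotient (φ w₀) x} {B : Set X}
    (hB : PathsHomotopicIn B) {w : A} (h : w ∈ liftSet φ w₀ q B) (h' : w ∈ liftSet φ w₀ q' B) :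
    liftSet φ w₀ q B ⊆ liftSet φ w₀ q' B := by
  rintro z ⟨u, hu, κ, hκ⟩
  obtain ⟨s, hs, τ, hτ⟩ := h
  obtain ⟨s', hs', τ', hτ'⟩ := h'
  refine ⟨u, hu, (τ'.trans τ.symm).trans κ, ?_⟩
  rw [Path.map_trans, Path.map_trans, ← Path.map_symm, Path.Homotopic.Quotient.mk_trans,
    Path.Homotopic.Quotient.mk_trans, Path.Homotopic.Quotient.mk_symm, ← hκ, ← hτ', ← hτ,
    Path.Homotopic.Quotient.eq.2 (hB s' s hs' hs)]
  induction q using Path.Homotopic.Quotient.ind with | _ p => ?_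
  induction q' using Path.Homotopic.Quotient.ind with | _ p' => ?_
  change _ = ((Path.Homotopic.Quotient.mk p').trans _ |>.trans
    (Path.Homotopic.Quotient.mk (p.trans s).symm)).trans _
  rw [Path.trans_symm, Path.Homotopic.Quotient.mk_trans, Path.Homotopic.Quotient.mk_symm,
    Path.Homotopic.Quotient.mk_symm]
  simp only [Path.Homotopic.Quotient.trans_assoc]
  rw [← Path.Homotopic.Quotient.trans_assoc (.symm (.mk p)), Path.Homotopic.Quotient.symm_trans,
    Path.Homotopic.Quotient.refl_trans, ← Path.Homotopic.Quotient.trans_assoc (.mk s),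
    Path.Homotopic.Quotient.trans_symm, Path.Homotopic.Quotient.refl_trans]

lemma exists_loop_of_mem_liftSet {α : Path (φ w₀) (φ w₀)} {B : Set X}
    (hB : PathsHomotopicIn B) {w : A} (h : w ∈ liftSet φ w₀ (.mk α) B)
    (h' : w ∈ liftSet φ w₀ (.mk (Path.refl _)) B) :
    ∃ τ : Path w₀ w₀, α.Homotopic (τ.map φ.continuous) := by
  obtain ⟨s, hs, τ, hτ⟩ := h
  obtain ⟨s', hs', τ', hτ'⟩ := h'
  refine ⟨τ.trans τ'.symm, Path.Homotopic.Quotient.eq.1 ?_⟩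
  rw [Path.map_trans, ← Path.map_symm, Path.Homotopic.Quotient.mk_trans,
    Path.Homotopic.Quotient.mk_symm, ← hτ', ← hτ, Path.Homotopic.Quotient.eq.2 (hB s' s hs' hs),
    Path.Homotopic.Quotient.mk_refl, Path.Homotopic.Quotient.refl_trans,
    Path.Homotopic.Quotient.trans_assoc, Path.Homotopic.Quotient.trans_symm,
    Path.Homotopic.Quotient.trans_refl]

end LiftSet

lemma eq_of_locally_constant_along_paths {X Y : Type*} [TopologicalSpace X] {x₀ : X}
    (D : ∀ {x : X}, Path.Homotopic.Quotient x₀ x → Y) {V : Set X}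
    (hD : ∀ x ∈ V, ∃ B ∈ 𝓝 x, ∀ (q : Path.Homotopic.Quotient x₀ x) {x' : X} (s : Path x x'),
      (∀ t, s t ∈ B) → D (q.trans (.mk s)) = D q)
    {x y : X} (q : Path.Homotopic.Quotient x₀ x) (γ : Path x y) (hγ : ∀ t, γ t ∈ V) :
    D (q.trans (.mk γ)) = D q := by
  suffices H : ∀ (g : C(I, X)) (x y : X) (hx : g 0 = x) (hy : g 1 = y)
      (q : Path.Homotopic.Quotient x₀ x), (∀ t, g t ∈ V) →
      D (q.trans (.mk (⟨g, hx, hy⟩ : Path x y))) = D q from H γ.toContinuousMap x y _ _ q hγ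
  clear q γ hγ
  rintro g x y rfl rfl q hγ
  let γ : Path (g 0) (g 1) := ⟨g, rfl, rfl⟩
  have key : D (q.trans (.mk (γ.subpath 0 0))) = D (q.trans (.mk (γ.subpath 0 1))) := by
    refine isPreconnected_univ.induction₂
      (fun t t' => D (q.trans (.mk (γ.subpath 0 t))) = D (q.trans (.mk (γ.subpath 0 t'))))
      (fun t _ => ?_) (fun _ _ _ _ _ _ => Eq.trans) (fun _ _ _ _ => Eq.symm) (mem_univ 0)
      (mem_univ 1)
    obtain ⟨B, hB, h⟩ := hD (γ t) (hγ t)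
    rw [nhdsWithin_univ]
    obtain ⟨r, hr, hrB⟩ := Metric.mem_nhds_iff.1 (γ.continuous.continuousAt hB)
    filter_upwards [ball_mem_nhds t hr] with t' ht'
    have h1 := h (q.trans (.mk (γ.subpath 0 t))) (γ.subpath t t') (fun u => by
      have h2 : γ.subpath t t' u ∈ range (γ.subpath t t') := mem_range_self u
      rw [Path.range_subpath] at h2
      obtain ⟨v, hv, hvu⟩ := h2
      rw [← hvu]
      refine hrB ?_
      have h3 : dist (v : ℝ) t ≤ dist (t' : ℝ) t := by
        rcases le_total t t' with h4 | h4
        · rw [uIcc_of_le h4] at hv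
          have h5 : (t : ℝ) ≤ v := hv.1
          have h6 : (v : ℝ) ≤ t' := hv.2
          rw [Real.dist_eq, Real.dist_eq, abs_of_nonneg (by linarith), abs_of_nonneg (by linarith)]
          linarith
        · rw [uIcc_of_ge h4] at hv
          have h5 : (t' : ℝ) ≤ v := hv.1
          have h6 : (v : ℝ) ≤ t := hv.2
          rw [Real.dist_eq, Real.dist_eq, abs_of_nonpos (by linarith), abs_of_nonpos (by linarith)]
          linarith
      exact h3.trans_lt (mem_ball.1 ht'))
    rw [← h1, Path.Homotopic.Quotient.trans_assoc, ← Path.Homotopic.Quotient.mk_trans,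
      Path.Homotopic.Quotient.eq.2 ⟨Path.Homotopy.subpathTransSubpath γ 0 t t'⟩]
  rw [Path.subpath_self, Path.subpath_zero_one] at key
  have h1 : q.trans (.mk (Path.refl (g 0))) = q := by
    rw [Path.Homotopic.Quotient.mk_refl, Path.Homotopic.Quotient.trans_refl]
  exact key.symm.trans (congrArg D h1)

lemma pathsHomotopicIn_of_convex {E : Type*} [NormedAddCommGroup E] [NormedSpace ℝ E] {V K : Set E}
    (hK : Convex ℝ K) (hKV : K ⊆ V) : PathsHomotopicIn ((↑) ⁻¹' K : Set V) := by
  intro x y s s' hs hs'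
  refine ⟨⟨⟨⟨fun p => ⟨(1 - (p.1 : ℝ)) • (s p.2 : E) + (p.1 : ℝ) • (s' p.2 : E), hKV ?_⟩,
    ?_⟩, ?_, ?_⟩, ?_⟩⟩
  · exact hK (hs p.2) (hs' p.2) (by linarith [p.1.2.2]) p.1.2.1 (by ring)
  · refine Continuous.subtype_mk ?_ _
    have h1 : Continuous fun p : I × I => (s p.2 : E) := by fun_prop
    have h2 : Continuous fun p : I × I => (s' p.2 : E) := by fun_prop
    fun_prop
  · intro t; ext; simp
  · intro t; ext; simp
  · rintro t u (rfl | rfl)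
    · ext; simp [← add_smul]
    · ext; simp [← add_smul]

/-- The restriction of a continuous map to subtypes. -/
def restrictMap {E F : Type*} [TopologicalSpace E] [TopologicalSpace F] {f : E → F}
    (hf : Continuous f) {W : Set E} {V : Set F} (h : MapsTo f W V) : C(W, V) :=
  ⟨h.restrict f W V, hf.restrict h⟩

section LiftDegree

variable {k : ℕ} {S U S' V : Set (Amb k)} {f : Amb k → Amb k} {W Vb V2 : Set (Amb k)}

/-- The image in `ℝ^{k+1}` of the set of lifts over the ball of radius `r`. -/
def liftBall (hf : Continuous f) (hWV : MapsTo f W Vb) (w₀ : W) {x : Vb}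
    (q : Path.Homotopic.Quotient (restrictMap hf hWV w₀) x) (r : ℝ) : Set (Amb k) :=
  (↑) '' liftSet (restrictMap hf hWV) w₀ q ((↑) ⁻¹' ball (x : Amb k) r : Set Vb)

lemma degAdm_liftBall (hC : CellData S U) (hD : CellData S' V) (hf : Continuous f)
    (hSS : MapsTo f S S') (hW : IsOpen W) (hWU : W ⊆ U) (hWV : MapsTo f W Vb)
    (hVb : Vb ⊆ V) (hV2b : V2 ⊆ Vb) (hV2W : ∀ w ∈ U, f w ∈ V2 → w ∈ W)
    (w₀ : W) {x : Vb} (q : Path.Homotopic.Quotient (restrictMap hf hWV w₀) x) {r : ℝ}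
    (hr : ball (x : Amb k) r ⊆ V2) {y : Amb k} (hy : y ∈ ball (x : Amb k) r) :
    DegAdm (fun z => f z - y) (liftBall hf hWV w₀ q r) := by
  have hlpc : LocallyPathConnectedSpace W := hW.locallyPathConnectedSpace
  have hBo : IsOpen ((↑) ⁻¹' ball (x : Amb k) r : Set Vb) := isOpen_ball.preimage continuous_subtype_val
  have hsub : liftBall hf hWV w₀ q r ⊆ U := by
    rintro _ ⟨w, -, rfl⟩
    exact hWU w.2
  have ho : IsOpen (liftBall hf hWV w₀ q r) :=
    hW.isOpenMap_subtype_val _ (isOpen_liftSet q hBo)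
  refine ⟨by fun_prop, ho, hC.bdd.subset hsub, fun z hz => sub_ne_zero.2 fun h => ?_⟩
  have hzV : f z ∈ V := h ▸ hVb (hV2b (hr hy))
  have hzU : z ∈ U := by
    rcases hC.closure_subset (closure_mono hsub (frontier_subset_closure hz)) with h1 | h1
    · exact absurd (hSS h1) (hD.not_mem_bd hzV)
    · exact h1
  have hzW : z ∈ W := hV2W z hzU (h ▸ hr hy)
  have hcl : (⟨z, hzW⟩ : W) ∈ closure (liftSet (restrictMap hf hWV) w₀ q
      ((↑) ⁻¹' ball (x : Amb k) r : Set Vb)) :=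
    closure_subtype.2 (frontier_subset_closure hz)
  have hmem := mem_liftSet_of_mem_closure hBo hcl (by
    change f z ∈ ball (x : Amb k) r
    rw [h]; exact hy)
  rw [ho.frontier_eq] at hz
  exact hz.2 ⟨_, hmem, rfl⟩

/-- The local degree of `f` on the set of lifts over a small ball around the endpoint of `q`. -/
def liftDeg (hf : Continuous f) (hWV : MapsTo f W Vb) (w₀ : W) (rad : Amb k → ℝ) {x : Vb}
    (q : Path.Homotopic.Quotient (restrictMap hf hWV w₀) x) : ℝ :=
  deg (fun z => f z - x) (liftBall hf hWV w₀ q (rad x))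

lemma liftDeg_trans (hf : Continuous f) (hWV : MapsTo f W Vb) (w₀ : W) (rad : Amb k → ℝ)
    (hrad : ∀ x, x ∈ V2 → 0 < rad x ∧ ball x (rad x) ⊆ V2)
    (hadm : ∀ {x : Vb} (q : Path.Homotopic.Quotient (restrictMap hf hWV w₀) x), (x : Amb k) ∈ V2 →
      ∀ y ∈ ball (x : Amb k) (rad x), DegAdm (fun z => f z - y) (liftBall hf hWV w₀ q (rad x)))
    (hSC : ∀ x : Vb, (x : Amb k) ∈ V2 →
      PathsHomotopicIn (Subtype.val ⁻¹' ball (x : Amb k) (rad x) : Set Vb))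
    {x y : Vb} (q : Path.Homotopic.Quotient (restrictMap hf hWV w₀) x) (γ : Path x y)
    (hγ : ∀ t, (γ t : Amb k) ∈ V2) :
    liftDeg hf hWV w₀ rad (q.trans (.mk γ)) = liftDeg hf hWV w₀ rad q := by
  refine eq_of_locally_constant_along_paths (fun {x} q => liftDeg hf hWV w₀ rad (x := x) q)
    (V := {x : Vb | (x : Amb k) ∈ V2}) (fun x hx => ?_) q γ hγ
  have hx2 : (x : Amb k) ∈ V2 := hx
  obtain ⟨hr0, hr2⟩ := hrad _ hx2
  have hxx : (x : Amb k) ∈ ball (x : Amb k) (rad x) := mem_ball_self hr0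
  have hnb : (Subtype.val ⁻¹' ball (x : Amb k) (rad x) : Set Vb) ∈ 𝓝 x :=
    continuous_subtype_val.continuousAt (isOpen_ball.mem_nhds hxx)
  refine ⟨_, hnb, fun q x' s hs => ?_⟩
  have hx'b : (x' : Amb k) ∈ ball (x : Amb k) (rad x) := by
    have h := hs 1
    rw [s.target] at h
    exact h
  have hx' : (x' : Amb k) ∈ V2 := hr2 hx'b
  have hr' := (hrad _ hx').1
  have hx'x : (x' : Amb k) ∈ ball (x' : Amb k) (rad x') := mem_ball_self hr'
  have hiff : ∀ z, f z = x' → (z ∈ liftBall hf hWV w₀ (q.trans (.mk s)) (rad x') ↔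
      z ∈ liftBall hf hWV w₀ q (rad x)) := by
    intro z hz
    constructor
    · rintro ⟨w, hw, rfl⟩
      exact ⟨w, (mem_liftSet_trans_iff (q := q) (hSC x' hx') s
        hs (hSC x hx2) (mem_preimage.2 hx'x) (Subtype.ext hz)).1 hw, rfl⟩
    · rintro ⟨w, hw, rfl⟩
      exact ⟨w, (mem_liftSet_trans_iff (q := q) (hSC x' hx') s
        hs (hSC x hx2) (mem_preimage.2 hx'x) (Subtype.ext hz)).2 hw, rfl⟩
  have hA := hadm (q.trans (.mk s)) hx' x' hx'x
  have hB := hadm q hx2 x' hx'b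
  have h1 := deg_excision hA (hA.isOpen.inter hB.isOpen) inter_subset_left
    (fun z hz h0 => ⟨hz, (hiff z (sub_eq_zero.1 h0)).1 hz⟩)
  have h2 := deg_excision hB (hA.isOpen.inter hB.isOpen) inter_subset_right
    (fun z hz h0 => ⟨(hiff z (sub_eq_zero.1 h0)).2 hz, hz⟩)
  have h3 := deg_sub_eq_of_isPreconnected hf hB.isOpen hB.bdd
    (convex_ball (x : Amb k) (rad x)).isPreconnected
    (fun y hy z hz h => (hadm q hx2 y hy).ne_zero z hz (sub_eq_zero.2 h)) hx'b
    hxx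
  exact h1.2.trans (h2.2.symm.trans h3)

lemma exists_loop_lift (hC : CellData S U) (hD : CellData S' V) (hf : Continuous f)
    (hSS : MapsTo f S S') {d : ℝ} (hd : d = 1 ∨ d = -1)
    (hW : IsOpen W) (hWU : W ⊆ U) (hWV : MapsTo f W Vb)
    (hVb : Vb ⊆ V) (hV2 : IsOpen V2) (hV2b : V2 ⊆ Vb) (hV2W : ∀ w ∈ U, f w ∈ V2 → w ∈ W)
    (w₀ : W) (hw₀ : f w₀ ∈ V2) (hdeg : deg (fun z => f z - f w₀) U = d)
    (hjoin : ∀ w ∈ U, f w = f w₀ → JoinedIn (U ∩ f ⁻¹' V2) w₀ w)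
    (α : Path (restrictMap hf hWV w₀) (restrictMap hf hWV w₀)) (hα : ∀ t, (α t : Amb k) ∈ V2) :
    ∃ τ : Path w₀ w₀, α.Homotopic (τ.map (restrictMap hf hWV).continuous) := by
  classical
  revert α
  set φ := restrictMap hf hWV with hφ
  intro α hα
  have hφv : ∀ w, (φ w : Amb k) = f w := fun _ => rfl
  have hrad : ∀ x : Amb k, ∃ r : ℝ, x ∈ V2 → 0 < r ∧ ball x r ⊆ V2 := by
    intro x
    by_cases hx : x ∈ V2
    · obtain ⟨r, hr, h⟩ := Metric.isOpen_iff.1 hV2 x hx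
      exact ⟨r, fun _ => ⟨hr, h⟩⟩
    · exact ⟨0, fun h => absurd h hx⟩
  choose rad hrad using hrad
  have hadm : ∀ {x : Vb} (q : Path.Homotopic.Quotient (φ w₀) x), (x : Amb k) ∈ V2 →
      ∀ y ∈ ball (x : Amb k) (rad x), DegAdm (fun z => f z - y) (liftBall hf hWV w₀ q (rad x)) :=
    fun q hx y hy => degAdm_liftBall hC hD hf hSS hW hWU hWV hVb hV2b hV2W w₀ q (hrad _ hx).2 hy
  have hSC : ∀ x : Vb, (x : Amb k) ∈ V2 →
      PathsHomotopicIn (Subtype.val ⁻¹' ball (x : Amb k) (rad x) : Set Vb) :=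
    fun x hx => pathsHomotopicIn_of_convex (convex_ball _ _) ((hrad _ hx).2.trans hV2b)
  let D : ∀ {x : Vb}, Path.Homotopic.Quotient (φ w₀) x → ℝ :=
    fun {x} q => liftDeg hf hWV w₀ rad q
  have hDinv : ∀ {x y : Vb} (q : Path.Homotopic.Quotient (φ w₀) x) (γ : Path x y),
      (∀ t, (γ t : Amb k) ∈ V2) → D (q.trans (.mk γ)) = D q :=
    fun q γ hγ => liftDeg_trans hf hWV w₀ rad hrad hadm hSC q γ hγ
  have hx0 : ((φ w₀ : Vb) : Amb k) ∈ V2 := hw₀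
  obtain ⟨hr0, hr2⟩ := hrad _ hx0
  have hDinv' : ∀ γ : Path (φ w₀) (φ w₀), (∀ t, (γ t : Amb k) ∈ V2) →
      D (.mk γ) = D (.mk (Path.refl (φ w₀))) := by
    intro γ hγ
    have := hDinv (.mk (Path.refl (φ w₀))) γ hγ
    rwa [Path.Homotopic.Quotient.mk_refl, Path.Homotopic.Quotient.refl_trans] at this
  obtain ⟨m, hm⟩ := exists_int_deg (hadm (.mk (Path.refl (φ w₀))) hx0 _ (mem_ball_self hr0))
  have hm' : D (.mk (Path.refl (φ w₀))) = m := hm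
  set Z : Set (Amb k) := {w | w ∈ S ∪ U ∧ f w = f w₀} with hZ
  have hw₀V : f w₀ ∈ V := hVb (hV2b hw₀)
  have hZU : ∀ w ∈ Z, w ∈ U := by
    rintro w ⟨h1 | h1, h2⟩
    · exact absurd (hSS h1) (hD.not_mem_bd (h2 ▸ hw₀V))
    · exact h1
  have hZc : IsCompact Z := hC.isCompact_carrier.inter_right (isClosed_eq hf continuous_const)
  have hcov : ∀ w ∈ Z, ∃ q : Path.Homotopic.Quotient (φ w₀) (φ w₀), D q = m ∧
      w ∈ liftBall hf hWV w₀ q (rad (φ w₀)) := by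
    intro w hw
    obtain ⟨γ, hγ⟩ := hjoin w (hZU w hw) hw.2
    have hγW : ∀ t, γ t ∈ W := fun t => hV2W _ (hγ t).1 (hγ t).2
    have hwW : w ∈ W := hV2W _ (hZU w hw) (by rw [hw.2]; exact hw₀)
    let τ : Path w₀ ⟨w, hwW⟩ := ⟨⟨fun t => ⟨γ t, hγW t⟩, by fun_prop⟩,
      Subtype.ext γ.source, Subtype.ext γ.target⟩
    have hend : φ w₀ = φ ⟨w, hwW⟩ := Subtype.ext hw.2.symm
    refine ⟨.mk ((τ.map φ.continuous).cast rfl hend), ?_, ⟨w, hwW⟩, ?_, rfl⟩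
    · rw [hDinv' ((τ.map φ.continuous).cast rfl hend) fun t => (hγ t).2]
      exact hm'
    · exact mem_liftSet_of_map τ hend (mem_preimage.2 (mem_ball_self hr0))
  have : Nonempty (Path.Homotopic.Quotient (φ w₀) (φ w₀)) := ⟨.mk (Path.refl _)⟩
  choose! Q hQD hQm using hcov
  let OO : Amb k → Set (Amb k) := fun w => liftBall hf hWV w₀ (Q w) (rad (φ w₀))
  have hOadm : ∀ w, DegAdm (fun z => f z - f w₀) (OO w) := fun w =>
    hadm (Q w) hx0 _ (mem_ball_self hr0)
  have hOsub : ∀ (q q' : Path.Homotopic.Quotient (φ w₀) (φ w₀)) (z : Amb k),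
      z ∈ liftBall hf hWV w₀ q (rad (φ w₀)) → z ∈ liftBall hf hWV w₀ q' (rad (φ w₀)) →
      liftBall hf hWV w₀ q (rad (φ w₀)) ⊆ liftBall hf hWV w₀ q' (rad (φ w₀)) := by
    rintro q q' z ⟨w, hw, rfl⟩ ⟨w', hw', h⟩
    obtain rfl := Subtype.ext h
    exact image_mono (liftSet_subset_of_mem (hSC _ hx0) hw hw')
  obtain ⟨t, htZ, ht⟩ := hZc.elim_nhds_subcover OO
    (fun w hw => (hOadm w).isOpen.mem_nhds (hQm w hw))
  let s : Finset (Set (Amb k)) := t.image OO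
  have hs : ∀ O ∈ s, ∃ w ∈ t, OO w = O := fun O hO => Finset.mem_image.1 hO
  have hUadm : DegAdm (fun z => f z - f w₀) U := ⟨by fun_prop, hC.isOpen, hC.bdd,
    fun z hz => sub_ne_zero.2 fun h =>
      absurd (hSS (hC.frontier_subset hz)) (hD.not_mem_bd (h ▸ hw₀V))⟩
  have hzs : ∀ z ∈ U, f z = f w₀ → ∃ O ∈ s, z ∈ O := by
    intro z hz h
    obtain ⟨w, hw, hzw⟩ := mem_iUnion₂.1 (ht ⟨Or.inr hz, h⟩)
    exact ⟨OO w, Finset.mem_image_of_mem _ hw, hzw⟩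
  have hsum := (deg_eq_sum hUadm s id
    (fun O hO => by obtain ⟨w, -, rfl⟩ := hs O hO; exact (hOadm w).isOpen)
    (fun O hO => by
      obtain ⟨w, -, rfl⟩ := hs O hO
      rintro _ ⟨z, -, rfl⟩
      exact hWU z.2)
    (fun O hO O' hO' hne => by
      obtain ⟨w, -, rfl⟩ := hs O hO
      obtain ⟨w', -, rfl⟩ := hs O' hO'
      refine disjoint_left.2 fun z hz hz' => hne ?_
      exact (hOsub _ _ z hz hz').antisymm (hOsub _ _ z hz' hz))
    (fun z hz h0 => hzs z hz (sub_eq_zero.1 h0))).2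
  rw [hdeg, Finset.sum_congr rfl (fun O hO => show _ = (m : ℝ) by
    obtain ⟨w, hw, rfl⟩ := hs O hO
    exact hQD w (htZ w hw)), Finset.sum_const, nsmul_eq_mul] at hsum
  have hcm : s.card * m.natAbs = 1 := by
    have h1 : ((s.card : ℤ) * m = 1) ∨ ((s.card : ℤ) * m = -1) := by
      rcases hd with hd | hd
      · left; rw [hd] at hsum; exact_mod_cast hsum.symm
      · right; rw [hd] at hsum; exact_mod_cast hsum.symm
    have h2 : ((s.card : ℤ) * m).natAbs = 1 := by rcases h1 with h | h <;> rw [h] <;> rfl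
    rwa [Int.natAbs_mul, Int.natAbs_natCast] at h2
  have hcard : s.card = 1 := Nat.dvd_one.1 ⟨_, hcm.symm⟩
  have hm0 : (m : ℝ) ≠ 0 := by
    rintro h
    have : m = 0 := by exact_mod_cast h
    simp [this] at hcm
  obtain ⟨O, hO⟩ := Finset.card_eq_one.1 hcard
  have hmemO : ∀ z ∈ U, f z = f w₀ → z ∈ O := by
    intro z hz h
    obtain ⟨O', hO', hz'⟩ := hzs z hz h
    rw [hO, Finset.mem_singleton] at hO'
    exact hO' ▸ hz'
  obtain ⟨w, -, hwO⟩ := hs O (by rw [hO]; exact Finset.mem_singleton_self _)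
  have hrefl : (w₀ : Amb k) ∈ liftBall hf hWV w₀ (.mk (Path.refl (φ w₀))) (rad (φ w₀)) :=
    ⟨w₀, mem_liftSet_of_map (Path.refl w₀) rfl (mem_preimage.2 (mem_ball_self hr0)), rfl⟩
  have hαm : ∃ z ∈ liftBall hf hWV w₀ (.mk α) (rad (φ w₀)), f z = f w₀ := by
    by_contra hcon
    push Not at hcon
    have h1 : D (.mk α) = 0 := deg_eq_zero (hadm (.mk α) hx0 _ (mem_ball_self hr0))
      (fun z hz => sub_ne_zero.2 (hcon z hz))
    rw [hDinv' α hα, hm'] at h1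
    exact hm0 h1
  obtain ⟨z, hz, hzf⟩ := hαm
  have hzU : z ∈ U := by
    obtain ⟨w', -, rfl⟩ := hz
    exact hWU w'.2
  have hz2 : z ∈ liftBall hf hWV w₀ (.mk (Path.refl (φ w₀))) (rad (φ w₀)) := by
    have h1 := hmemO z hzU hzf
    have h2 := hmemO w₀ (hWU w₀.2) rfl
    rw [← hwO] at h1 h2
    exact hOsub _ _ _ h2 hrefl h1
  obtain ⟨z1, hz1, rfl⟩ := hz
  obtain ⟨z2, hz2, h⟩ := hz2
  obtain rfl := Subtype.ext h
  exact exists_loop_of_mem_liftSet (hSC _ hx0) hz1 hz2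

end LiftDegree

section CellMap

variable {k : ℕ} {S U S' V : Set (Amb k)} {f : Amb k → Amb k}

lemma deg_sub_eq_one_or_neg_one (hC : CellData S U) (hD : CellData S' V) (hf : Continuous f)
    (hSS : MapsTo f S S') (hUV : MapsTo f U V) {G : Amb k → Amb k} (hG : Continuous G)
    (hGS : MapsTo G S' S) (hGf : ∀ x ∈ S, G (f x) = x) :
    ∃ d : ℝ, (d = 1 ∨ d = -1) ∧ ∀ y ∈ V, deg (fun z => f z - y) U = d := by
  obtain ⟨p, hp⟩ := hC.nonempty
  have hfr : ∀ x ∈ frontier U, f x ∈ S' := fun x hx => hSS (hC.frontier_subset hx)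
  have hconst : ∀ y ∈ V, deg (fun z => f z - y) U = deg (fun z => f z - f p) U := fun y hy =>
    deg_sub_eq_of_isPreconnected hf hC.isOpen hC.bdd hD.preconn
      (fun y hy x hx h => hD.not_mem_bd hy (h ▸ hfr x hx)) hy (hUV hp)
  have hadm : DegAdm (fun z => f z - f p) U := ⟨by fun_prop, hC.isOpen, hC.bdd,
    fun x hx => sub_ne_zero.2 fun h => hD.not_mem_bd (hUV hp) (h ▸ hfr x hx)⟩
  have hGadm : DegAdm (fun y => G y - p) V := ⟨by fun_prop, hD.isOpen, hD.bdd,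
    fun y hy => sub_ne_zero.2 fun h => hC.not_mem_bd hp (h ▸ hGS (hD.frontier_subset hy))⟩
  have hcomp := deg_comp hf hC.isOpen hC.bdd hGadm
    (fun x hx h => hD.not_mem_bd h (hfr x hx))
    (fun x hx h => by
      rcases hC.closure_subset hx with h1 | h1
      · rw [hGf x h1]
        exact sub_ne_zero.2 fun h2 => hC.not_mem_bd hp (h2 ▸ h1)
      · exact absurd (hUV h1) h)
    hconst
  have hone := deg_sub_const hC.isOpen hC.bdd hp
  have h1 : deg (fun x => G (f x) - p) U = 1 := by
    rw [← hone.2]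
    exact deg_congr hcomp.1 (by fun_prop)
      (fun x hx => by simp only [hGf x (hC.frontier_subset hx)])
  obtain ⟨m, hm⟩ := exists_int_deg hadm
  obtain ⟨l, hl⟩ := exists_int_deg hGadm
  refine ⟨m, ?_, fun y hy => (hconst y hy).trans hm⟩
  have h2 : (m : ℝ) * l = 1 := by rw [← hm, ← hl, ← h1]; exact hcomp.2.symm
  have h3 : m * l = 1 := by exact_mod_cast h2
  rcases Int.isUnit_iff.1 (IsUnit.of_mul_eq_one l h3) with h | h <;> simp [h]

lemma CellData.exists_ball_preimage_subset (hC : CellData S U) (hD : CellData S' V)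
    (hf : Continuous f) (hUV : MapsTo f U V) {G : Amb k → Amb k}
    (hGf : ∀ x ∈ S, G (f x) = x)
    {x : Amb k} (hx : x ∈ S') {η : ℝ} (hη : 0 < η) :
    ∃ δ > 0, ∀ w ∈ U, f w ∈ ball x δ → w ∈ ball (G x) η := by
  obtain ⟨c, hc, h⟩ := exists_norm_lower_bound (K := (S ∪ U) \ ball (G x) η)
    (F := fun w => f w - x) (hC.isCompact_carrier.diff isOpen_ball) (by fun_prop) (by
      rintro w ⟨hw | hw, hw2⟩ h
      · refine hw2 ?_
        rw [← sub_eq_zero.1 h, hGf w hw]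
        exact mem_ball_self hη
      · exact hD.not_mem_bd (hUV hw) (sub_eq_zero.1 h ▸ hx))
  refine ⟨c, hc, fun w hw hfw => ?_⟩
  by_contra hcon
  have := h w ⟨Or.inr hw, hcon⟩
  rw [mem_ball, dist_eq_norm] at hfw
  linarith

/-- Small loops in `V` near a point of `S'` lift, up to a homotopy near that point, to small loops
in `U`. -/
lemma exists_local_loop_lift (hC : CellData S U) (hD : CellData S' V) (hf : Continuous f)
    (hSS : MapsTo f S S') (hUV : MapsTo f U V) {G : Amb k → Amb k} (hG : Continuous G)
    (hGS : MapsTo G S' S) (hGf : ∀ x ∈ S, G (f x) = x) (hfG : ∀ y ∈ S', f (G y) = y)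
    {x : Amb k} (hx : x ∈ S') {ε η : ℝ} (hε : 0 < ε) (hη : 0 < η)
    (hm : MapsTo f (U ∩ ball (G x) η) (V ∩ ball x ε)) :
    ∃ δ > 0, ∀ y : ↥(V ∩ ball x ε), ∀ α : Path y y, (∀ t, (α t : Amb k) ∈ ball x δ) →
      ∃ (w₀ : _) (τ : Path w₀ w₀) (hw : y = restrictMap hf hm w₀),
        α.Homotopic ((τ.map (restrictMap hf hm).continuous).cast hw hw) := by
  obtain ⟨d, hd1, hd⟩ := deg_sub_eq_one_or_neg_one hC hD hf hSS hUV hG hGS hGf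
  obtain ⟨ε2, hε2, h2⟩ := hC.exists_ball_preimage_subset hD hf hUV hGf hx hη
  have hmin : 0 < min ε ε2 := lt_min hε hε2
  obtain ⟨η2, hη2, hη2f⟩ := Metric.continuousAt_iff.1 (hf.continuousAt (x := G x)) _ hmin
  rw [hfG x hx] at hη2f
  obtain ⟨δ', hδ', hjoin⟩ := hC.joinedIn_of_near (hGS hx) hη2
  obtain ⟨δ, hδ, h3⟩ := hC.exists_ball_preimage_subset hD hf hUV hGf hx hδ'
  refine ⟨min δ (min ε ε2), lt_min hδ hmin, fun y α hα => ?_⟩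
  have hyV := y.2.1
  have hyδ : (y : Amb k) ∈ ball x (min δ (min ε ε2)) := by simpa using hα 0
  have hyδ2 := ball_subset_ball (min_le_right _ _) hyδ
  obtain ⟨w, hw, hwy⟩ : ∃ w ∈ U, f w = y := by
    by_contra hcon
    push Not at hcon
    have hadm : DegAdm (fun z => f z - y) U := ⟨by fun_prop, hC.isOpen, hC.bdd,
      fun z hz => sub_ne_zero.2 fun h => hD.not_mem_bd hyV (h ▸ hSS (hC.frontier_subset hz))⟩
    have h0 := deg_eq_zero hadm fun z hz => sub_ne_zero.2 (hcon z hz)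
    rw [hd y hyV] at h0
    rcases hd1 with h | h <;> linarith
  have hwW : w ∈ U ∩ ball (G x) η :=
    ⟨hw, h2 w hw (hwy ▸ ball_subset_ball (min_le_right _ _) hyδ2)⟩
  have hyw : y = restrictMap hf hm ⟨w, hwW⟩ := Subtype.ext hwy.symm
  subst hyw
  have hfw : f w ∈ V ∩ ball x (min ε ε2) := ⟨hyV, hyδ2⟩
  obtain ⟨τ, hτ⟩ := exists_loop_lift hC hD hf hSS hd1 (hC.isOpen.inter isOpen_ball)
    inter_subset_left hm inter_subset_left (V2 := V ∩ ball x (min ε ε2))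
    (hD.isOpen.inter isOpen_ball)
    (inter_subset_inter_right _ (ball_subset_ball (min_le_left _ _)))
    (fun z hz hfz => ⟨hz, h2 z hz (ball_subset_ball (min_le_right _ _) hfz.2)⟩) ⟨w, hwW⟩ hfw
    (hd _ hyV)
    (fun z hz hfz => by
      have hzδ : f z ∈ ball x δ := hfz ▸ ball_subset_ball (min_le_left _ _) hyδ
      have hwδ : f w ∈ ball x δ := ball_subset_ball (min_le_left _ _) hyδ
      exact (hjoin w ⟨hw, h3 w hw hwδ⟩ z ⟨hz, h3 z hz hzδ⟩).mono fun v hv =>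
        ⟨hv.1, hUV hv.1, hη2f hv.2⟩)
    α (fun t => ⟨(α t).2.1, ball_subset_ball (min_le_right _ _) (hα t)⟩)
  exact ⟨_, τ, rfl, hτ⟩

end CellMap

section Square

/-- The map of the square to itself collapsing the edges `τ = 0` and `τ = 1` to corners. -/
def squareCollapse (z : I × I) : ℝ × ℝ :=
  ((1 - (z.1 : ℝ)) * min (2 * (z.2 : ℝ)) 1 + z.1 * max (2 * (z.2 : ℝ) - 1) 0,
    (1 - (z.1 : ℝ)) * max (2 * (z.2 : ℝ) - 1) 0 + z.1 * min (2 * (z.2 : ℝ)) 1)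

lemma continuous_squareCollapse : Continuous squareCollapse := by
  unfold squareCollapse
  fun_prop

lemma squareCollapse_mem (z : I × I) :
    (squareCollapse z).1 ∈ Icc (0 : ℝ) 1 ∧ (squareCollapse z).2 ∈ Icc (0 : ℝ) 1 := by
  obtain ⟨⟨s, hs0, hs1⟩, ⟨t, ht0, ht1⟩⟩ := z
  have hu0 : 0 ≤ min (2 * t) 1 := le_min (by linarith) zero_le_one
  have hu1 : min (2 * t) 1 ≤ 1 := min_le_right _ _
  have hv0 : 0 ≤ max (2 * t - 1) 0 := le_max_right _ _
  have hv1 : max (2 * t - 1) 0 ≤ 1 := max_le (by linarith) zero_le_one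
  simp only [squareCollapse, mem_Icc]
  refine ⟨⟨?_, ?_⟩, ?_, ?_⟩ <;> nlinarith

lemma min_add_max_half (t : ℝ) : min (2 * t) 1 + max (2 * t - 1) 0 = 2 * t := by
  rcases le_total (2 * t) 1 with h | h
  · rw [min_eq_left h, max_eq_right (by linarith)]; ring
  · rw [min_eq_right h, max_eq_left (by linarith)]; ring

lemma squareCollapse_eq {z w : I × I} (h : squareCollapse z = squareCollapse w) :
    z.2 = w.2 ∧ (z.1 = w.1 ∨ z.2 = 0 ∨ z.2 = 1) := by
  obtain ⟨⟨s, hs0, hs1⟩, ⟨t, ht0, ht1⟩⟩ := z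
  obtain ⟨⟨s', hs0', hs1'⟩, ⟨t', ht0', ht1'⟩⟩ := w
  simp only [squareCollapse, Prod.mk.injEq] at h
  obtain ⟨h1, h2⟩ := h
  have ht := min_add_max_half t
  have ht' := min_add_max_half t'
  have htt : t = t' := by nlinarith
  subst htt
  refine ⟨rfl, ?_⟩
  simp only [← Subtype.coe_inj, Icc.coe_zero, Icc.coe_one]
  by_contra! hne
  obtain ⟨hne, ht0n, ht1n⟩ := hne
  have h3 : (s - s') * (min (2 * t) 1 - max (2 * t - 1) 0) = 0 := by nlinarith
  rcases mul_eq_zero.1 h3 with h4 | h4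
  · exact hne (by linarith)
  · rcases le_total (2 * t) 1 with h | h
    · rw [min_eq_left h, max_eq_right (by linarith)] at h4
      exact ht0n (by linarith)
    · rw [min_eq_right h, max_eq_left (by linarith)] at h4
      exact ht1n (by linarith)

lemma exists_squareCollapse_eq (x y : I) : ∃ z, squareCollapse z = ((x : ℝ), (y : ℝ)) := by
  obtain ⟨x, hx0, hx1⟩ := x
  obtain ⟨y, hy0, hy1⟩ := y
  have ht := min_add_max_half ((x + y) / 2)
  set t := (x + y) / 2 with htd
  set u := min (2 * t) 1 with hu
  set v := max (2 * t - 1) 0 with hv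
  have hxy : x - y ≤ u - v ∧ y - x ≤ u - v := by
    rcases le_total (2 * t) 1 with h | h
    · rw [hu, hv, min_eq_left h, max_eq_right (by linarith)]
      constructor <;> linarith
    · rw [hu, hv, min_eq_right h, max_eq_left (by linarith)]
      constructor <;> linarith
  have htI : t ∈ Icc (0 : ℝ) 1 := ⟨by linarith, by linarith⟩
  rcases eq_or_lt_of_le (show 0 ≤ u - v by linarith) with h0 | h0
  · refine ⟨(0, ⟨t, htI⟩), ?_⟩
    simp only [squareCollapse, Icc.coe_zero, ← hu, ← hv, Prod.mk.injEq]
    constructor <;> linarith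
  · set s := (1 - (x - y) / (u - v)) / 2 with hs
    have hsw : s * (u - v) = ((u - v) - (x - y)) / 2 := by rw [hs]; field_simp
    have h1 : (x - y) / (u - v) ≤ 1 := (div_le_one h0).2 hxy.1
    have h2 : -1 ≤ (x - y) / (u - v) := by rw [le_div_iff₀ h0]; linarith
    have hsI : s ∈ Icc (0 : ℝ) 1 := ⟨by linarith, by linarith⟩
    refine ⟨(⟨s, hsI⟩, ⟨t, htI⟩), ?_⟩
    simp only [squareCollapse, ← hu, ← hv, Prod.mk.injEq]
    constructor <;> linarith

lemma exists_square_of_homotopic {X : Type*} [TopologicalSpace X] {a b c d : X}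
    (B : Path a b) (R : Path b c) (L : Path a d) (T : Path d c)
    (h : (B.trans R).Homotopic (L.trans T)) :
    ∃ F : C(I × I, X), (∀ t, F (t, 0) = B t) ∧ (∀ t, F (1, t) = R t) ∧ (∀ t, F (0, t) = L t) ∧
      ∀ t, F (t, 1) = T t := by
  obtain ⟨H⟩ := h
  let q : I × I → I × I := fun z => (⟨_, (squareCollapse_mem z).1⟩, ⟨_, (squareCollapse_mem z).2⟩)
  have hqc : Continuous q := by
    have := continuous_squareCollapse
    fun_prop
  have hq2 : ∀ z w, q z = q w → squareCollapse z = squareCollapse w := fun z w hzw =>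
    Prod.ext (congrArg (fun p : I × I => (p.1 : ℝ)) hzw)
      (congrArg (fun p : I × I => (p.2 : ℝ)) hzw)
  have hqs : Function.Surjective q := by
    rintro ⟨x, y⟩
    obtain ⟨z, hz⟩ := exists_squareCollapse_eq x y
    exact ⟨z, Prod.ext (Subtype.ext (congrArg Prod.fst hz)) (Subtype.ext (congrArg Prod.snd hz))⟩
  have hq : IsQuotientMap q := hqc.isClosedMap.isQuotientMap hqc hqs
  have hfac : ∀ z w, q z = q w → H z = H w := by
    rintro ⟨s, t⟩ ⟨s', t'⟩ hzw
    obtain ⟨h1, h2⟩ := squareCollapse_eq (hq2 _ _ hzw)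
    simp only at h1 h2
    subst h1
    rcases h2 with rfl | rfl | rfl
    · rfl
    · rw [H.source, H.source]
    · rw [H.target, H.target]
  have hq' : IsQuotientMap (⟨q, hqc⟩ : C(I × I, I × I)) := hq
  let F : C(I × I, X) := hq'.lift (H : C(I × I, X)) fun z w => hfac z w
  have hF : ∀ z, F (q z) = H z := fun z =>
    DFunLike.congr_fun (hq'.lift_comp (H : C(I × I, X)) fun z w => hfac z w) z
  have hhalf : ∀ t : I, (t : ℝ) / 2 ∈ Icc (0 : ℝ) 1 := fun t =>
    ⟨by linarith [t.2.1], by linarith [t.2.2]⟩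
  have hhalf' : ∀ t : I, ((t : ℝ) + 1) / 2 ∈ Icc (0 : ℝ) 1 := fun t =>
    ⟨by linarith [t.2.1], by linarith [t.2.2]⟩
  have e1 : ∀ t : I, min (2 * ((t : ℝ) / 2)) 1 = t := fun t => by
    rw [min_eq_left] <;> linarith [t.2.2]
  have e2 : ∀ t : I, max (2 * ((t : ℝ) / 2) - 1) 0 = 0 := fun t => by
    rw [max_eq_right]; linarith [t.2.2]
  have e3 : ∀ t : I, min (2 * (((t : ℝ) + 1) / 2)) 1 = 1 := fun t => by
    rw [min_eq_right]; linarith [t.2.1]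
  have e4 : ∀ t : I, max (2 * (((t : ℝ) + 1) / 2) - 1) 0 = t := fun t => by
    rw [max_eq_left] <;> linarith [t.2.1]
  have tl : ∀ {a b c : X} (γ : Path a b) (γ' : Path b c) (t : I),
      γ.trans γ' ⟨(t : ℝ) / 2, hhalf t⟩ = γ t := fun γ γ' t => by
    rw [Path.trans_apply, dif_pos (by simp only; linarith [t.2.2])]
    congr 1
    exact Subtype.ext (by simp only; ring)
  have tr : ∀ {a b c : X} (γ : Path a b) (γ' : Path b c) (t : I),
      γ.trans γ' ⟨((t : ℝ) + 1) / 2, hhalf' t⟩ = γ' t := fun γ γ' t => by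
    rw [Path.trans_apply]
    split_ifs with h
    · have ht : (t : ℝ) = 0 := by simp only at h; linarith [t.2.1]
      have ht' : t = 0 := Subtype.ext ht
      subst ht'
      rw [γ'.source]
      convert γ.target
      simp
    · congr 1
      exact Subtype.ext (by simp only; ring)
  refine ⟨F, fun t => ?_, fun t => ?_, fun t => ?_, fun t => ?_⟩
  · have h1 : ((t, 0) : I × I) = q (0, ⟨(t : ℝ) / 2, hhalf t⟩) := by
      refine Prod.ext (Subtype.ext ?_) (Subtype.ext ?_) <;> simp [q, squareCollapse, e1, e2]
    rw [h1, hF, H.apply_zero]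
    exact tl _ _ _
  · have h1 : ((1, t) : I × I) = q (0, ⟨((t : ℝ) + 1) / 2, hhalf' t⟩) := by
      refine Prod.ext (Subtype.ext ?_) (Subtype.ext ?_) <;>
        simp only [q, squareCollapse, e3, e4] <;> simp
    rw [h1, hF, H.apply_zero]
    exact tr _ _ _
  · have h1 : ((0, t) : I × I) = q (1, ⟨(t : ℝ) / 2, hhalf t⟩) := by
      refine Prod.ext (Subtype.ext ?_) (Subtype.ext ?_) <;>
        simp only [q, squareCollapse, e1, e2] <;> simp
    rw [h1, hF, H.apply_one]
    exact tl _ _ _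
  · have h1 : ((t, 1) : I × I) = q (1, ⟨((t : ℝ) + 1) / 2, hhalf' t⟩) := by
      refine Prod.ext (Subtype.ext ?_) (Subtype.ext ?_) <;>
        simp only [q, squareCollapse, e3, e4] <;> simp
    rw [h1, hF, H.apply_one]
    exact tr _ _ _

end Square

/-- Compatible maps on the cells of an `N × N` grid glue to a map on the square. -/
lemma exists_map_of_grid {E : Type*} [TopologicalSpace E] {N : ℕ} (hN : 0 < N)
    (F : ℕ → ℕ → C(I × I, E)) (hh : ∀ i j t, F i j (1, t) = F (i + 1) j (0, t))
    (hv : ∀ i j t, F i j (t, 1) = F i (j + 1) (t, 0)) :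
    ∃ m : C(I × I, E), ∀ z : I × I, ∃ (i j : ℕ) (w : I × I), (N : ℝ) * z.1 = i + w.1 ∧
      (N : ℝ) * z.2 = j + w.2 ∧ m z = F i j w := by
  have hN' : (0 : ℝ) < N := by exact_mod_cast hN
  have hcell : ∀ s : I, ∃ i : Fin N, (N : ℝ) * s - i ∈ Icc (0 : ℝ) 1 := by
    intro s
    have h0 : 0 ≤ (N : ℝ) * s := mul_nonneg hN'.le s.2.1
    have h1 : (N : ℝ) * s ≤ N := by nlinarith [s.2.2]
    by_cases hs : (N : ℝ) * s < N
    · have h2 : ⌊(N : ℝ) * s⌋₊ < N := (Nat.floor_lt h0).2 hs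
      refine ⟨⟨_, h2⟩, ?_, ?_⟩
      · have := Nat.floor_le h0
        simp only; linarith
      · have := Nat.lt_floor_add_one ((N : ℝ) * s)
        simp only; linarith
    · refine ⟨⟨N - 1, by omega⟩, ?_⟩
      have : ((N - 1 : ℕ) : ℝ) = N - 1 := by rw [Nat.cast_sub hN]; simp
      simp only [this]
      constructor <;> linarith
  have key1 : ∀ (s : I) (i i' : ℕ) (h : (N : ℝ) * s - i ∈ Icc (0 : ℝ) 1)
      (h' : (N : ℝ) * s - i' ∈ Icc (0 : ℝ) 1) (j : ℕ) (t : I),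
      F i j (⟨_, h⟩, t) = F i' j (⟨_, h'⟩, t) ∧ F j i (t, ⟨_, h⟩) = F j i' (t, ⟨_, h'⟩) := by
    intro s i i' h h' j t
    wlog hle : i ≤ i' generalizing i i'
    · exact ⟨(this i' i h' h (le_of_not_ge hle)).1.symm, (this i' i h' h (le_of_not_ge hle)).2.symm⟩
    rcases hle.eq_or_lt with rfl | hlt
    · exact ⟨rfl, rfl⟩
    have h1 : ((i + 1 : ℕ) : ℝ) ≤ i' := by exact_mod_cast hlt
    have h2 : ((i + 1 : ℕ) : ℝ) = i + 1 := by push_cast; ring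
    have h3 : (i' : ℝ) = ((i + 1 : ℕ) : ℝ) := by linarith [h.2, h'.1]
    have h4 : i' = i + 1 := by exact_mod_cast h3
    subst h4
    have e1 : (⟨_, h⟩ : I) = 1 := Subtype.ext (by simp only [Icc.coe_one]; linarith [h.2, h'.1])
    have e2 : (⟨_, h'⟩ : I) = 0 := Subtype.ext (by simp only [Icc.coe_zero]; linarith [h.2, h'.1])
    rw [e1, e2]
    exact ⟨hh _ _ _, hv _ _ _⟩
  choose c hc using hcell
  let m : I × I → E := fun z => F (c z.1) (c z.2) (⟨_, hc z.1⟩, ⟨_, hc z.2⟩)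
  have hm : ∀ (z : I × I) (i j : ℕ) (h : (N : ℝ) * z.1 - i ∈ Icc (0 : ℝ) 1)
      (h' : (N : ℝ) * z.2 - j ∈ Icc (0 : ℝ) 1), m z = F i j (⟨_, h⟩, ⟨_, h'⟩) :=
    fun z i j h h' => (key1 z.1 _ i (hc z.1) h _ _).1.trans (key1 z.2 _ j (hc z.2) h' _ _).2
  let Q : Fin N × Fin N → Set (I × I) := fun p =>
    {z | (N : ℝ) * z.1 - (p.1 : ℕ) ∈ Icc (0 : ℝ) 1 ∧ (N : ℝ) * z.2 - (p.2 : ℕ) ∈ Icc (0 : ℝ) 1}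
  have hmc : Continuous m := by
    refine (locallyFinite_of_finite Q).continuous (iUnion_eq_univ_iff.2 fun z =>
      ⟨(c z.1, c z.2), hc z.1, hc z.2⟩) (fun p => ?_) fun p => ?_
    · exact (isClosed_Icc.preimage (by fun_prop : Continuous fun z : I × I =>
        (N : ℝ) * z.1 - (p.1 : ℕ))).inter (isClosed_Icc.preimage (by fun_prop :
          Continuous fun z : I × I => (N : ℝ) * z.2 - (p.2 : ℕ)))
    · have h1 : ContinuousOn (fun z : I × I => F p.1 p.2 (projIcc 0 1 zero_le_one
          ((N : ℝ) * z.1 - (p.1 : ℕ)), projIcc 0 1 zero_le_one ((N : ℝ) * z.2 - (p.2 : ℕ)))) (Q p) := by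
        have := continuous_projIcc (a := (0 : ℝ)) (b := 1) (h := zero_le_one)
        fun_prop
      refine h1.congr fun z hz => ?_
      rw [hm z p.1 p.2 hz.1 hz.2]
      simp only
      rw [projIcc_of_mem _ hz.1, projIcc_of_mem _ hz.2]
  refine ⟨⟨m, hmc⟩, fun z => ⟨c z.1, c z.2, (⟨_, hc z.1⟩, ⟨_, hc z.2⟩), ?_, ?_, rfl⟩⟩ <;>
    simp only <;> ring

/-- Property of pairs of sets that holds locally at small scale holds uniformly on compact sets. -/
lemma exists_uniform_ball {E : Type*} [PseudoMetricSpace E] {K : Set E} (hK : IsCompact K)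
    (P : Set E → Set E → Prop) (hP : ∀ {A A' B B'}, A' ⊆ A → B ⊆ B' → P A B → P A' B')
    (h : ∀ x ∈ K, ∀ ε > 0, ∃ δ > 0, P (ball x δ) (ball x ε)) {ε : ℝ} (hε : 0 < ε) :
    ∃ δ > 0, ∀ x ∈ K, P (ball x δ) (ball x ε) := by
  classical
  have h' : ∀ x ∈ K, ∃ δ > 0, δ ≤ ε / 2 ∧ P (ball x (2 * δ)) (ball x (ε / 2)) := by
    intro x hx
    obtain ⟨δ, hδ, hp⟩ := h x hx (ε / 2) (by linarith)
    refine ⟨min (δ / 2) (ε / 2), by positivity, min_le_right _ _, hP (ball_subset_ball ?_)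
      Subset.rfl hp⟩
    linarith [min_le_left (δ / 2) (ε / 2)]
  choose! δ hδ hδε hδP using h'
  obtain ⟨t, htK, ht⟩ := hK.elim_nhds_subcover (fun x => ball x (δ x))
    (fun x hx => ball_mem_nhds x (hδ x hx))
  have hfin : ∃ δ' > 0, ∀ x ∈ t, δ' ≤ δ x := by
    clear ht
    induction t using Finset.induction_on with
    | empty => exact ⟨1, one_pos, by simp⟩
    | insert a t _ ih =>
      obtain ⟨e, he, hle⟩ := ih fun x hx => htK x (Finset.mem_insert_of_mem hx)
      refine ⟨min e (δ a), lt_min he (hδ a (htK a (Finset.mem_insert_self _ _))), fun x hx => ?_⟩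
      rcases Finset.mem_insert.1 hx with rfl | hx
      · exact min_le_right _ _
      · exact (min_le_left _ _).trans (hle x hx)
  obtain ⟨δ', hδ', hle⟩ := hfin
  refine ⟨δ', hδ', fun x hx => ?_⟩
  obtain ⟨c, hc, hxc⟩ := mem_iUnion₂.1 (ht hx)
  rw [mem_ball] at hxc
  refine hP (ball_subset_ball' ?_) (ball_subset_ball' ?_) (hδP c (htK c hc))
  · linarith [hle c hc]
  · rw [dist_comm]; linarith [hδε c (htK c hc)]

section Taming

variable {k : ℕ} {S U S' V T : Set (Amb k)} {f : Amb k → Amb k}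

/-- Maps of the square into `S ∪ U` can be approximated by maps into `T ∪ U`. -/
def SquaresApprox (T S U : Set (Amb k)) : Prop :=
  ∀ m : C(I × I, Amb k), (∀ z, m z ∈ S ∪ U) → ∀ ε > 0, ∃ m' : C(I × I, Amb k),
    (∀ z, dist (m z) (m' z) < ε) ∧ ∀ z, m' z ∈ T ∪ U

/-- Boundaries of squares in `V ∩ A` bound squares in `X ∩ B`. -/
def SquaresFill (V X A B : Set (Amb k)) : Prop :=
  ∀ ⦃a b c d : Amb k⦄ (p : Path a b) (q : Path b c) (r : Path a d) (s : Path d c),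
    (∀ t, p t ∈ V ∩ A) → (∀ t, q t ∈ V ∩ A) → (∀ t, r t ∈ V ∩ A) → (∀ t, s t ∈ V ∩ A) →
    ∃ F : C(I × I, Amb k), (∀ z, F z ∈ X ∩ B) ∧ (∀ t, F (t, 0) = p t) ∧ (∀ t, F (1, t) = q t) ∧
      (∀ t, F (0, t) = r t) ∧ ∀ t, F (t, 1) = s t

lemma SquaresApprox.exists_rel (hC : CellData S U) (hT : SquaresApprox T S U)
    (m : C(I × I, Amb k)) (hm : ∀ z, m z ∈ S ∪ U) {Q : Set (I × I)} (hQ : IsCompact Q)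
    (hQn : Q.Nonempty) (hQU : ∀ z ∈ Q, m z ∈ U) {ε : ℝ} (hε : 0 < ε) :
    ∃ m' : C(I × I, Amb k), (∀ z, dist (m z) (m' z) < ε) ∧ (∀ z, m' z ∈ T ∪ U) ∧
      ∀ z ∈ Q, m' z = m z := by
  have hK : IsCompact (m '' Q) := hQ.image m.continuous
  have hKn : (m '' Q).Nonempty := hQn.image m
  obtain ⟨c, hc, hcU⟩ := hK.exists_thickening_subset_open hC.isOpen (by
    rintro _ ⟨z, hz, rfl⟩
    exact hQU z hz)
  obtain ⟨m₁, hm₁, hm₁T⟩ := hT m hm (min (c / 2) ε) (lt_min (by linarith) hε)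
  let χ : I × I → ℝ := fun z => max 0 (1 - infDist (m z) (m '' Q) / (c / 2))
  have hχc : Continuous χ := by
    have := (continuous_infDist_pt (m '' Q)).comp m.continuous
    exact continuous_const.max (continuous_const.sub (this.div_const _))
  have hχ0 : ∀ z, 0 ≤ χ z := fun z => le_max_left _ _
  have hχ1 : ∀ z, χ z ≤ 1 := fun z => max_le zero_le_one (by
    have : 0 ≤ infDist (m z) (m '' Q) / (c / 2) := div_nonneg infDist_nonneg (by linarith)
    linarith)
  have hdist : ∀ z, dist (m z) (m₁ z + χ z • (m z - m₁ z)) ≤ dist (m z) (m₁ z) := fun z => by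
    rw [dist_eq_norm, dist_eq_norm, show m z - (m₁ z + χ z • (m z - m₁ z)) =
      (1 - χ z) • (m z - m₁ z) by module, norm_smul, Real.norm_eq_abs,
      abs_of_nonneg (by linarith [hχ1 z])]
    exact mul_le_of_le_one_left (norm_nonneg _) (by linarith [hχ0 z])
  refine ⟨⟨fun z => m₁ z + χ z • (m z - m₁ z), by fun_prop⟩, fun z => ?_, fun z => ?_,
    fun z hz => ?_⟩
  · exact (hdist z).trans_lt ((hm₁ z).trans_le (min_le_right _ _))
  · change m₁ z + χ z • (m z - m₁ z) ∈ T ∪ U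
    rcases (hχ0 z).eq_or_lt with h | h
    · rw [← h, zero_smul, add_zero]
      exact hm₁T z
    · right
      apply hcU
      have h1 : infDist (m z) (m '' Q) / (c / 2) < 1 := by
        rcases lt_max_iff.1 h with h | h
        · exact absurd h (lt_irrefl _)
        · linarith
      rw [div_lt_one (by linarith)] at h1
      rw [mem_thickening_iff_infDist_lt hKn]
      have h2 := infDist_le_infDist_add_dist (s := m '' Q) (x := m₁ z + χ z • (m z - m₁ z))
        (y := m z)
      rw [dist_comm] at h2
      have h3 := (hm₁ z).trans_le (min_le_left _ _)
      linarith [hdist z]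
  · have h1 : infDist (m z) (m '' Q) = 0 := infDist_zero_of_mem (mem_image_of_mem _ hz)
    change m₁ z + χ z • (m z - m₁ z) = m z
    have : χ z = 1 := by simp [χ, h1]
    rw [this]
    module

lemma SquaresApprox.exists_nullhomotopy (hC : CellData S U) (hT : SquaresApprox T S U)
    {x : Amb k} (hx : x ∈ S) {ε : ℝ} (hε : 0 < ε) :
    ∃ η > 0, ∀ (w : Amb k) (τ : Path w w), (∀ t, τ t ∈ U ∩ ball x η) → ∃ H : C(I × I, Amb k),
      (∀ z, H z ∈ (T ∪ U) ∩ ball x ε) ∧ (∀ t, H (0, t) = τ t) ∧ (∀ t, H (1, t) = w) ∧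
      (∀ s, H (s, 0) = w) ∧ ∀ s, H (s, 1) = w := by
  obtain ⟨N, r, hN, hSN, hrc, hrm, hrid⟩ := hC.exists_neighborhood_retraction
  have hxN : x ∈ N := hSN (Or.inl hx)
  have hrx : r x = x := hrid x (Or.inl hx)
  have h1 : ∀ᶠ y in 𝓝 x, y ∈ N ∧ r y ∈ ball x (ε / 2) := by
    refine (hN.eventually_mem hxN).and ?_
    refine (hrc.continuousAt (hN.mem_nhds hxN)).eventually_mem ?_
    rw [hrx]
    exact ball_mem_nhds x (by linarith)
  obtain ⟨η, hη, hη1⟩ := Metric.eventually_nhds_iff_ball.1 h1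
  refine ⟨η, hη, fun w τ hτ => ?_⟩
  have hw : w ∈ U ∩ ball x η := by simpa using hτ 0
  let g : I × I → Amb k := fun z => (1 - (z.1 : ℝ)) • τ z.2 + (z.1 : ℝ) • w
  have hg : ∀ z, g z ∈ ball x η := fun z => convex_ball x η (hτ z.2).2 hw.2
    (by linarith [z.1.2.2]) z.1.2.1 (by ring)
  let m : C(I × I, Amb k) := ⟨fun z => r (g z), hrc.comp_continuous (by fun_prop)
    fun z => (hη1 _ (hg z)).1⟩
  have e0 : ∀ t, m (0, t) = τ t := fun t => by
    have : g (0, t) = τ t := by simp [g]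
    change r (g (0, t)) = _
    rw [this, hrid _ (Or.inr (hτ t).1)]
  have e1 : ∀ t, m (1, t) = w := fun t => by
    have : g (1, t) = w := by simp [g]
    change r (g (1, t)) = _
    rw [this, hrid _ (Or.inr hw.1)]
  have e2 : ∀ s, m (s, 0) = w := fun s => by
    have : g (s, 0) = w := by simp only [g, τ.source]; module
    change r (g (s, 0)) = _
    rw [this, hrid _ (Or.inr hw.1)]
  have e3 : ∀ s, m (s, 1) = w := fun s => by
    have : g (s, 1) = w := by simp only [g, τ.target]; module
    change r (g (s, 1)) = _
    rw [this, hrid _ (Or.inr hw.1)]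
  let Q : Set (I × I) := {z | z.1 = 0 ∨ z.1 = 1 ∨ z.2 = 0 ∨ z.2 = 1}
  have hQ : IsClosed Q :=
    (isClosed_eq continuous_fst continuous_const).union <|
      (isClosed_eq continuous_fst continuous_const).union <|
        (isClosed_eq continuous_snd continuous_const).union
          (isClosed_eq continuous_snd continuous_const)
  obtain ⟨H, hH1, hH2, hH3⟩ := hT.exists_rel hC m (fun z => hrm (hη1 _ (hg z)).1) hQ.isCompact
    ⟨(0, 0), Or.inl rfl⟩ (by
      rintro ⟨s, t⟩ (h | h | h | h) <;> simp only at h <;> subst h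
      · rw [e0]; exact (hτ t).1
      · rw [e1]; exact hw.1
      · rw [e2]; exact hw.1
      · rw [e3]; exact hw.1) (half_pos hε)
  refine ⟨H, fun z => ⟨hH2 z, ?_⟩, fun t => ?_, fun t => ?_, fun s => ?_, fun s => ?_⟩
  · have h2 : dist (m z) x < ε / 2 := (hη1 _ (hg z)).2
    have h3 := hH1 z
    rw [dist_comm] at h3
    exact mem_ball.2 ((dist_triangle _ (m z) _).trans_lt (by linarith))
  · rw [hH3 _ (Or.inl rfl), e0]
  · rw [hH3 _ (Or.inr (Or.inl rfl)), e1]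
  · rw [hH3 _ (Or.inr (Or.inr (Or.inl rfl))), e2]
  · rw [hH3 _ (Or.inr (Or.inr (Or.inr rfl))), e3]

end Taming

section TamingTransfer

variable {k : ℕ} {S U S' V T : Set (Amb k)} {f : Amb k → Amb k}

/-- A path with values in a set, as a path in the subtype. -/
def codPath {E : Type*} [TopologicalSpace E] {Y : Set E} {a b : E} (p : Path a b)
    (h : ∀ t, p t ∈ Y) (ha : a ∈ Y) (hb : b ∈ Y) : Path (⟨a, ha⟩ : Y) ⟨b, hb⟩ :=
  ⟨⟨fun t => ⟨p t, h t⟩, by fun_prop⟩, Subtype.ext p.source, Subtype.ext p.target⟩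

lemma Path.Homotopic.of_trans_symm {Y : Type*} [TopologicalSpace Y] {a b : Y} {p q : Path a b}
    (h : (p.trans q.symm).Homotopic (Path.refl a)) : p.Homotopic q := by
  refine Path.Homotopic.Quotient.eq.1 ?_
  have h1 := Path.Homotopic.Quotient.eq.2 h
  rw [Path.Homotopic.Quotient.mk_trans, Path.Homotopic.Quotient.mk_symm,
    Path.Homotopic.Quotient.mk_refl] at h1
  rw [← Path.Homotopic.Quotient.trans_refl (.mk p), ← Path.Homotopic.Quotient.symm_trans (.mk q),
    ← Path.Homotopic.Quotient.trans_assoc, h1, Path.Homotopic.Quotient.refl_trans]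

lemma exists_square_of_homotopic_in {E : Type*} [TopologicalSpace E] {Y : Set E} {a b c d : E}
    (p : Path a b) (q : Path b c) (r : Path a d) (s : Path d c) (ha : a ∈ Y) (hb : b ∈ Y)
    (hc : c ∈ Y) (hd : d ∈ Y) (hp : ∀ t, p t ∈ Y) (hq : ∀ t, q t ∈ Y) (hr : ∀ t, r t ∈ Y)
    (hs : ∀ t, s t ∈ Y)
    (h : ((codPath p hp ha hb).trans (codPath q hq hb hc)).Homotopic
      ((codPath r hr ha hd).trans (codPath s hs hd hc))) :
    ∃ F : C(I × I, E), (∀ z, F z ∈ Y) ∧ (∀ t, F (t, 0) = p t) ∧ (∀ t, F (1, t) = q t) ∧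
      (∀ t, F (0, t) = r t) ∧ ∀ t, F (t, 1) = s t := by
  obtain ⟨F, h1, h2, h3, h4⟩ := exists_square_of_homotopic _ _ _ _ h
  exact ⟨⟨fun z => F z, by fun_prop⟩, fun z => (F z).2, fun t => congrArg Subtype.val (h1 t),
    fun t => congrArg Subtype.val (h2 t), fun t => congrArg Subtype.val (h3 t),
    fun t => congrArg Subtype.val (h4 t)⟩

lemma mem_of_path_trans {Y : Type*} [TopologicalSpace Y] {a b c : Y} {p : Path a b} {q : Path b c}
    {s : Set Y} (hp : ∀ t, p t ∈ s) (hq : ∀ t, q t ∈ s) (t : I) : p.trans q t ∈ s := by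
  have : p.trans q t ∈ range (p.trans q) := mem_range_self t
  rw [Path.trans_range] at this
  rcases this with ⟨u, hu⟩ | ⟨u, hu⟩
  · rw [← hu]; exact hp u
  · rw [← hu]; exact hq u

lemma squaresFill_of_mem_open {X : Set (Amb k)} (hV : IsOpen V) (hVX : V ⊆ X) {x : Amb k}
    (hx : x ∈ V) {ε : ℝ} (hε : 0 < ε) : ∃ δ > 0, SquaresFill V X (ball x δ) (ball x ε) := by
  obtain ⟨δ, hδ, hδV⟩ := Metric.isOpen_iff.1 hV x hx
  refine ⟨min δ ε, lt_min hδ hε, fun a b c d p q r s hp hq hr hs => ?_⟩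
  have hsub : ball x (min δ ε) ⊆ X ∩ ball x ε := fun y hy =>
    ⟨hVX (hδV (ball_subset_ball (min_le_left _ _) hy)), ball_subset_ball (min_le_right _ _) hy⟩
  have ha : a ∈ ball x (min δ ε) := by simpa using (hp 0).2
  have hb : b ∈ ball x (min δ ε) := by simpa using (hq 0).2
  have hc : c ∈ ball x (min δ ε) := by simpa using (hq 1).2
  have hd : d ∈ ball x (min δ ε) := by simpa using (hs 0).2
  refine exists_square_of_homotopic_in p q r s (hsub ha) (hsub hb) (hsub hc) (hsub hd)
    (fun t => hsub (hp t).2) (fun t => hsub (hq t).2) (fun t => hsub (hr t).2)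
    (fun t => hsub (hs t).2) ?_
  exact pathsHomotopicIn_of_convex (convex_ball x (min δ ε)) hsub _ _
    (mem_of_path_trans (s := Subtype.val ⁻¹' ball x (min δ ε)) (fun t => (hp t).2) fun t => (hq t).2)
    (mem_of_path_trans (s := Subtype.val ⁻¹' ball x (min δ ε)) (fun t => (hr t).2) fun t => (hs t).2)

lemma squaresFill_of_mem_bd (hC : CellData S U) (hD : CellData S' V) (hf : Continuous f)
    (hSS : MapsTo f S S') (hUV : MapsTo f U V) {G : Amb k → Amb k} (hG : Continuous G)
    (hGS : MapsTo G S' S) (hGf : ∀ x ∈ S, G (f x) = x) (hfG : ∀ y ∈ S', f (G y) = y)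
    (hT : SquaresApprox T S U) {x : Amb k} (hx : x ∈ S') {ε : ℝ} (hε : 0 < ε) :
    ∃ δ > 0, SquaresFill V (f '' T ∪ V) (ball x δ) (ball x ε) := by
  obtain ⟨η', hη', hfη⟩ := Metric.continuousAt_iff.1 (hf.continuousAt (x := G x)) _ hε
  rw [hfG x hx] at hfη
  obtain ⟨η₀, hη₀, hnull⟩ := hT.exists_nullhomotopy hC (hGS hx) hη'
  set η := min η₀ η' with hηd
  have hη : 0 < η := lt_min hη₀ hη'
  have hm : MapsTo f (U ∩ ball (G x) η) (V ∩ ball x ε) := fun w hw =>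
    ⟨hUV hw.1, hfη (ball_subset_ball (min_le_right _ _) hw.2)⟩
  obtain ⟨δ, hδ, hlift⟩ := exists_local_loop_lift hC hD hf hSS hUV hG hGS hGf hfG hx hε hη hm
  refine ⟨min δ ε, lt_min hδ hε, fun a b c d p q r s hp hq hr hs => ?_⟩
  have hsub : V ∩ ball x (min δ ε) ⊆ V ∩ ball x ε :=
    inter_subset_inter_right _ (ball_subset_ball (min_le_right _ _))
  have hsubδ : V ∩ ball x (min δ ε) ⊆ ball x δ := fun y hy =>
    ball_subset_ball (min_le_left _ _) hy.2
  have hX : V ∩ ball x ε ⊆ (f '' T ∪ V) ∩ ball x ε :=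
    inter_subset_inter_left _ subset_union_right
  have ha : a ∈ V ∩ ball x (min δ ε) := by simpa using hp 0
  have hb : b ∈ V ∩ ball x (min δ ε) := by simpa using hq 0
  have hc : c ∈ V ∩ ball x (min δ ε) := by simpa using hq 1
  have hd : d ∈ V ∩ ball x (min δ ε) := by simpa using hs 0
  refine exists_square_of_homotopic_in p q r s (hX (hsub ha)) (hX (hsub hb)) (hX (hsub hc))
    (hX (hsub hd)) (fun t => hX (hsub (hp t))) (fun t => hX (hsub (hq t)))
    (fun t => hX (hsub (hr t))) (fun t => hX (hsub (hs t))) ?_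
  let p' := codPath p (fun t => hsub (hp t)) (hsub ha) (hsub hb)
  let q' := codPath q (fun t => hsub (hq t)) (hsub hb) (hsub hc)
  let r' := codPath r (fun t => hsub (hr t)) (hsub ha) (hsub hd)
  let s' := codPath s (fun t => hsub (hs t)) (hsub hd) (hsub hc)
  let α := (p'.trans q').trans (r'.trans s').symm
  obtain ⟨w₀, τ, hw, hα⟩ := hlift _ α (by
    refine fun t => mem_of_path_trans (s := {y : ↥(V ∩ ball x ε) | (y : Amb k) ∈ ball x δ})
      (mem_of_path_trans (fun t => hsubδ (hp t)) fun t => hsubδ (hq t)) (fun t => ?_) t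
    rw [Path.symm_apply]
    exact mem_of_path_trans (s := {y : ↥(V ∩ ball x ε) | (y : Amb k) ∈ ball x δ})
      (fun t => hsubδ (hr t)) (fun t => hsubδ (hs t)) _)
  let ι : C(↥(V ∩ ball x ε), ↥((f '' T ∪ V) ∩ ball x ε)) := ⟨inclusion hX, continuous_inclusion hX⟩
  have hwτ : ∀ t, (τ.map continuous_subtype_val) t ∈ U ∩ ball (G x) η₀ := fun t =>
    ⟨(τ t).2.1, ball_subset_ball (min_le_left _ _) (τ t).2.2⟩
  obtain ⟨H, hH, hH0, hH1, hH2, hH3⟩ := hnull _ (τ.map continuous_subtype_val) hwτ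
  have hfH : ∀ z, f (H z) ∈ (f '' T ∪ V) ∩ ball x ε := fun z => by
    refine ⟨?_, hfη (hH z).2⟩
    rcases (hH z).1 with h | h
    · exact Or.inl ⟨_, h, rfl⟩
    · exact Or.inr (hUV h)
  refine Path.Homotopic.of_trans_symm ?_
  have h1 : (α.map ι.continuous).Homotopic (((τ.map (restrictMap hf hm).continuous).cast hw hw).map
    ι.continuous) := hα.map ι
  have h2 : (((τ.map (restrictMap hf hm).continuous).cast hw hw).map ι.continuous).Homotopic
      (Path.refl _) := by
    have hfw : f w₀ = a := congrArg Subtype.val hw.symm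
    refine ⟨⟨⟨⟨fun z => ⟨f (H z), hfH z⟩, by fun_prop⟩, fun t => ?_, fun t => ?_⟩, ?_⟩⟩
    · exact Subtype.ext (congrArg f (hH0 t))
    · refine Subtype.ext ?_
      change f (H (1, t)) = a
      rw [hH1, hfw]
    · rintro t z (rfl | rfl)
      · refine Subtype.ext ?_
        change f (H (t, 0)) = f (τ 0)
        rw [hH2, τ.source]
      · refine Subtype.ext ?_
        change f (H (t, 1)) = f (τ 1)
        rw [hH3, τ.target]
  have h3 : α.map ι.continuous = ((p'.map ι.continuous).trans (q'.map ι.continuous)).trans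
      ((r'.map ι.continuous).trans (s'.map ι.continuous)).symm := by
    simp only [α, Path.map_trans, ← Path.map_symm]
  rw [h3] at h1
  exact h1.trans h2

end TamingTransfer

section TamingAssembly

variable {k : ℕ} {S U S' V T X : Set (Amb k)} {f : Amb k → Amb k}

lemma CellData.exists_uniform_joinedIn (hD : CellData S V) {ε : ℝ} (hε : 0 < ε) :
    ∃ δ > 0, ∀ x ∈ S ∪ V, ∀ p ∈ V ∩ ball x δ, ∀ q ∈ V ∩ ball x δ,
      JoinedIn (V ∩ ball x ε) p q := by
  refine exists_uniform_ball hD.isCompact_carrier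
    (fun A B => ∀ p ∈ V ∩ A, ∀ q ∈ V ∩ A, JoinedIn (V ∩ B) p q)
    (fun hA hB h p hp q hq => (h p ⟨hp.1, hA hp.2⟩ q ⟨hq.1, hA hq.2⟩).mono
      (inter_subset_inter_right _ hB)) ?_ hε
  rintro x (hx | hx) ε hε
  · exact hD.joinedIn_of_near hx hε
  · obtain ⟨δ, hδ, hδV⟩ := Metric.isOpen_iff.1 hD.isOpen x hx
    refine ⟨min δ ε, lt_min hδ hε, fun p hp q hq => ?_⟩
    have hsub : ball x (min δ ε) ⊆ V ∩ ball x ε := fun y hy =>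
      ⟨hδV (ball_subset_ball (min_le_left _ _) hy), ball_subset_ball (min_le_right _ _) hy⟩
    exact (JoinedIn.of_segment_subset ((convex_ball x _).segment_subset hp.2 hq.2)).mono hsub

/-- The point of the unit square with grid coordinates `i / N` and `j / N`. -/
def gridPoint (N i j : ℕ) : I × I :=
  (projIcc 0 1 zero_le_one ((i : ℝ) / N), projIcc 0 1 zero_le_one ((j : ℝ) / N))

lemma dist_projIcc_le (x y : ℝ) :
    dist (projIcc (0 : ℝ) 1 zero_le_one x) (projIcc (0 : ℝ) 1 zero_le_one y) ≤ |x - y| := by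
  rw [Subtype.dist_eq, Real.dist_eq]
  exact abs_projIcc_sub_projIcc _

lemma dist_gridPoint_le {N i j i' j' : ℕ} (hi : i' = i ∨ i' = i + 1)
    (hj : j' = j ∨ j' = j + 1) : dist (gridPoint N i' j') (gridPoint N i j) ≤ 1 / N := by
  have key : ∀ {i i' : ℕ}, (i' = i ∨ i' = i + 1) →
      dist (projIcc (0 : ℝ) 1 zero_le_one ((i' : ℝ) / N))
        (projIcc (0 : ℝ) 1 zero_le_one ((i : ℝ) / N)) ≤ 1 / N := by
    rintro i i' (rfl | rfl)
    · rw [dist_self]; positivity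
    · refine (dist_projIcc_le _ _).trans ?_
      rw [← sub_div]
      simp
  exact max_le (key hi) (key hj)

lemma dist_gridPoint_le_of_eq {N i j : ℕ} (hN : 0 < N) {z w : I × I} (h1 : (N : ℝ) * z.1 = i + w.1)
    (h2 : (N : ℝ) * z.2 = j + w.2) : dist z (gridPoint N i j) ≤ 1 / N := by
  have hN' : (0 : ℝ) < N := by exact_mod_cast hN
  have key : ∀ {s t : I} {i : ℕ}, (N : ℝ) * s = i + t →
      dist s (projIcc (0 : ℝ) 1 zero_le_one ((i : ℝ) / N)) ≤ 1 / N := by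
    intro s t i h
    have := dist_projIcc_le (s : ℝ) ((i : ℝ) / N)
    rw [projIcc_val] at this
    refine this.trans ?_
    have h3 : (s : ℝ) - i / N = t / N := by field_simp; linarith
    rw [h3, abs_of_nonneg (div_nonneg t.2.1 hN'.le)]
    exact div_le_div_of_nonneg_right t.2.2 hN'.le
  exact max_le (key h1) (key h2)

lemma squaresApprox_of_squaresFill (hD : CellData S V) (hfill : ∀ x ∈ S ∪ V, ∀ ε > 0, ∃ δ > 0,
    SquaresFill V (T ∪ V) (ball x δ) (ball x ε)) : SquaresApprox T S V := by
  intro m hm ε hε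
  obtain ⟨δ₁, hδ₁, hF⟩ := exists_uniform_ball hD.isCompact_carrier
    (fun A B => SquaresFill V (T ∪ V) A B)
    (fun hA hB h a b c d p q r s hp hq hr hs => by
      have hA' := inter_subset_inter_right V hA
      obtain ⟨F, h1, h2⟩ := h p q r s (fun t => hA' (hp t)) (fun t => hA' (hq t))
        (fun t => hA' (hr t)) (fun t => hA' (hs t))
      exact ⟨F, fun z => inter_subset_inter_right _ hB (h1 z), h2⟩) hfill (half_pos hε)
  obtain ⟨δ₂, hδ₂, hJ⟩ := hD.exists_uniform_joinedIn (half_pos hδ₁)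
  have huc : UniformContinuous m := CompactSpace.uniformContinuous_of_continuous m.continuous
  obtain ⟨ρ, hρ, hρm⟩ := Metric.uniformContinuous_iff.1 huc (min (δ₂ / 2) (min (δ₁ / 2) (ε / 2)))
    (by positivity)
  obtain ⟨n, hn⟩ := exists_nat_one_div_lt hρ
  set N := n + 1 with hNd
  have hN : 0 < N := Nat.succ_pos n
  have hNρ : 1 / (N : ℝ) < ρ := by rw [hNd]; push_cast; exact hn
  let v : ℕ → ℕ → Amb k := fun i j => m (gridPoint N i j)
  have hvm : ∀ i j, v i j ∈ S ∪ V := fun i j => hm _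
  have hpt : ∀ i j, ∃ p ∈ V, dist p (v i j) < δ₂ / 2 := by
    intro i j
    have hcl : v i j ∈ closure V := by
      rcases hvm i j with h | h
      · exact hD.bd_subset_closure h
      · exact subset_closure h
    obtain ⟨p, hp, hd⟩ := Metric.mem_closure_iff.1 hcl _ (half_pos hδ₂)
    exact ⟨p, hp, by rwa [dist_comm]⟩
  choose P hPV hPd using hpt
  have hvv : ∀ {i j i' j' : ℕ}, (i' = i ∨ i' = i + 1) → (j' = j ∨ j' = j + 1) →
      dist (v i' j') (v i j) < min (δ₂ / 2) (min (δ₁ / 2) (ε / 2)) := fun hi hj =>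
    hρm ((dist_gridPoint_le hi hj).trans_lt hNρ)
  have hPb : ∀ {i j i' j' : ℕ}, (i' = i ∨ i' = i + 1) → (j' = j ∨ j' = j + 1) →
      P i' j' ∈ V ∩ ball (v i j) δ₂ := fun {i j i' j'} hi hj => by
    refine ⟨hPV _ _, mem_ball.2 ((dist_triangle _ (v i' j') _).trans_lt ?_)⟩
    linarith [hPd i' j', (hvv hi hj).trans_le (min_le_left _ _)]
  choose hor hhor using fun i j => hJ (v i j) (hvm i j) (P i j) (hPb (Or.inl rfl) (Or.inl rfl))
    (P (i + 1) j) (hPb (Or.inr rfl) (Or.inl rfl))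
  choose ver hver using fun i j => hJ (v i j) (hvm i j) (P i j) (hPb (Or.inl rfl) (Or.inl rfl))
    (P i (j + 1)) (hPb (Or.inl rfl) (Or.inr rfl))
  have hsub : ∀ {i j i' j' : ℕ}, (i' = i ∨ i' = i + 1) → (j' = j ∨ j' = j + 1) →
      V ∩ ball (v i' j') (δ₁ / 2) ⊆ V ∩ ball (v i j) δ₁ := fun hi hj =>
    inter_subset_inter_right _ (ball_subset_ball' (by
      linarith [(hvv hi hj).trans_le ((min_le_right _ _).trans (min_le_left _ _))]))
  choose F hFm hF0 hF1 hF2 hF3 using fun i j => hF (v i j) (hvm i j) (hor i j) (ver (i + 1) j)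
    (ver i j) (hor i (j + 1)) (fun t => hsub (Or.inl rfl) (Or.inl rfl) (hhor i j t))
    (fun t => hsub (Or.inr rfl) (Or.inl rfl) (hver (i + 1) j t))
    (fun t => hsub (Or.inl rfl) (Or.inl rfl) (hver i j t))
    (fun t => hsub (Or.inl rfl) (Or.inr rfl) (hhor i (j + 1) t))
  obtain ⟨m', hm'⟩ := exists_map_of_grid hN F (fun i j t => by rw [hF1, hF2])
    (fun i j t => by rw [hF3, hF0])
  refine ⟨m', fun z => ?_, fun z => ?_⟩
  · obtain ⟨i, j, w, h1, h2, h3⟩ := hm' z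
    have h4 : dist (m z) (v i j) < _ := hρm ((dist_gridPoint_le_of_eq hN h1 h2).trans_lt hNρ)
    have h5 : dist (F i j w) (v i j) < ε / 2 := (hFm i j w).2
    rw [h3]
    rw [dist_comm] at h5
    linarith [dist_triangle (m z) (v i j) (F i j w),
      h4.trans_le ((min_le_right _ _).trans (min_le_right _ _))]
  · obtain ⟨i, j, w, -, -, h3⟩ := hm' z
    rw [h3]
    exact (hFm i j w).1

lemma SquaresApprox.image (hC : CellData S U) (hD : CellData S' V) (hf : Continuous f)
    (hSS : MapsTo f S S') (hUV : MapsTo f U V) {G : Amb k → Amb k} (hG : Continuous G)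
    (hGS : MapsTo G S' S) (hGf : ∀ x ∈ S, G (f x) = x) (hfG : ∀ y ∈ S', f (G y) = y)
    (hT : SquaresApprox T S U) : SquaresApprox (f '' T) S' V := by
  refine squaresApprox_of_squaresFill hD ?_
  rintro x (hx | hx) ε hε
  · exact squaresFill_of_mem_bd hC hD hf hSS hUV hG hGS hGf hfG hT hx hε
  · exact squaresFill_of_mem_open hD.isOpen subset_union_right hx hε

end TamingAssembly

/-- Stereographic projection from `v`, as a pair of maps between the ambient spaces. -/
lemma exists_stereographic {k : ℕ} {v : Amb (k + 1)} (hv : v ∈ Sph (k + 1)) :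
    ∃ (Φ : Amb (k + 1) → Amb k) (Ψ : Amb k → Amb (k + 1)), ContinuousOn Φ (Sph (k + 1) \ {v}) ∧
      Continuous Ψ ∧ (∀ y, Ψ y ∈ Sph (k + 1) \ {v}) ∧ (∀ y, Φ (Ψ y) = y) ∧
      ∀ x ∈ Sph (k + 1) \ {v}, Ψ (Φ x) = x := by
  classical
  have : Fact (Module.finrank ℝ (Amb (k + 1)) = k + 1 + 1) := ⟨by simp⟩
  let c := stereographic' (E := Amb (k + 1)) (k + 1) ⟨v, hv⟩
  have hsrc : c.source = {⟨v, hv⟩}ᶜ := stereographic'_source _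
  have htgt : c.target = univ := stereographic'_target _
  refine ⟨fun x => if h : x ∈ Sph (k + 1) then c ⟨x, h⟩ else 0, fun y => (c.symm y : Amb (k + 1)),
    ?_, ?_, fun y => ?_, fun y => ?_, fun x hx => ?_⟩
  · rw [continuousOn_iff_continuous_domRestrict]
    have h1 : Continuous fun x : ↥(Sph (k + 1) \ {v}) => c ⟨x, x.2.1⟩ := by
      refine c.continuousOn.comp_continuous (by fun_prop) fun x => ?_
      rw [hsrc]
      exact fun h => x.2.2 (congrArg Subtype.val h)
    refine h1.congr fun x => ?_
    simp only [domRestrict_apply]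
    rw [dif_pos x.2.1]
  · have h1 : Continuous c.symm := by
      rw [← continuousOn_univ, ← htgt]
      exact c.continuousOn_symm
    exact continuous_subtype_val.comp h1
  · refine ⟨(c.symm y).2, fun h => ?_⟩
    have h1 : c.symm y ∈ c.source := c.map_target (by rw [htgt]; trivial)
    rw [hsrc] at h1
    exact h1 (Subtype.ext h)
  · have h1 : (c.symm y : Amb (k + 1)) ∈ Sph (k + 1) := (c.symm y).2
    simp only [dif_pos h1]
    exact c.right_inv (by rw [htgt]; trivial)
  · simp only [dif_pos hx.1]
    rw [c.left_inv]
    rw [hsrc]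
    exact fun h => hx.2 (congrArg Subtype.val h)

namespace CrumpledCube

variable {n : ℕ} (C : CrumpledCube n)

lemma int_subset : C.int ⊆ Sph n \ C.bd := by
  obtain ⟨x, -, h⟩ := C.int_component
  rw [h]
  exact connectedComponentIn_subset _ _

lemma int_nonempty : C.int.Nonempty := by
  obtain ⟨x, hx, h⟩ := C.int_component
  exact ⟨x, h ▸ mem_connectedComponentIn hx⟩

lemma isPreconnected_int : IsPreconnected C.int := by
  obtain ⟨x, hx, h⟩ := C.int_component
  rw [h]
  exact isPreconnected_connectedComponentIn

lemma subset_int {s : Set (Amb n)} (hs : IsPreconnected s) (hsub : s ⊆ Sph n \ C.bd)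
    (h : (s ∩ C.int).Nonempty) : s ⊆ C.int := by
  obtain ⟨y, hys, hy⟩ := h
  obtain ⟨x, hx, hint⟩ := C.int_component
  rw [hint] at hy ⊢
  rw [connectedComponentIn_eq hy]
  exact hs.subset_connectedComponentIn hys hsub

lemma carrier_subset : C.carrier ⊆ Sph n :=
  union_subset C.bd_subset_sphere (C.int_subset.trans sdiff_subset)

lemma isCompact_bd : IsCompact C.bd := by
  obtain ⟨e, he, -, h⟩ := C.exists_embedding
  have : CompactSpace ↥(Sph (n - 1)) := isCompact_iff_compactSpace.1 (isCompact_sphere 0 1)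
  rw [← h]
  exact isCompact_range he

lemma isCompact_carrier : IsCompact C.carrier := by
  refine (isCompact_sphere (0 : Amb n) 1).of_isClosed_subset ?_ C.carrier_subset
  refine isClosed_of_closure_subset ?_
  unfold carrier
  rw [closure_union, C.isCompact_bd.isClosed.closure_eq]
  refine union_subset subset_union_left fun x hx => ?_
  by_cases hxb : x ∈ C.bd
  · exact Or.inl hxb
  · right
    have hxS : x ∈ Sph n := closure_minimal (C.int_subset.trans sdiff_subset) isClosed_sphere hx
    refine C.subset_int (s := insert x C.int) (C.isPreconnected_int.subset_closure
      (subset_insert _ _) (insert_subset hx subset_closure))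
      (insert_subset ⟨hxS, hxb⟩ C.int_subset) ?_ (mem_insert _ _)
    obtain ⟨y, hy⟩ := C.int_nonempty
    exact ⟨y, mem_insert_of_mem _ hy, hy⟩

end CrumpledCube

section Chart

variable {k : ℕ} (C : CrumpledCube (k + 1))

lemma CrumpledCube.exists_not_mem_carrier : ∃ v ∈ Sph (k + 1), v ∉ C.carrier := by
  by_contra! hcon
  obtain ⟨v, hv⟩ := C.int_nonempty
  obtain ⟨hvS, hvb⟩ := C.int_subset hv
  obtain ⟨Φ, Ψ, hΦ, hΨ, hΨS, hΦΨ, hΨΦ⟩ := exists_stereographic hvS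
  obtain ⟨e, he, hi, heb⟩ := C.exists_embedding
  have hbd : ∀ x ∈ C.bd, x ∈ Sph (k + 1) \ {v} := fun x hx =>
    ⟨C.bd_subset_sphere hx, fun h => hvb (h ▸ hx)⟩
  have heS : ∀ u, e u ∈ Sph (k + 1) \ {v} := fun u => hbd _ (heb ▸ mem_range_self u)
  have hec : Continuous fun u => Φ (e u) := hΦ.comp_continuous he heS
  have hei : Function.Injective fun u => Φ (e u) := fun u u' h => hi (by
    rw [← hΨΦ _ (heS u), ← hΨΦ _ (heS u')]
    exact congrArg Ψ h)
  obtain ⟨W, hWo, ⟨w, hw⟩, hWb, hWd, hWf⟩ := exists_bounded_open_frontier_subset_range hec hei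
  have hcl : IsCompact (closure W) := hWb.isCompact_closure
  obtain ⟨O, hO, hOW⟩ := continuousOn_iff'.1 hΦ W hWo
  have hrange : ∀ y, Ψ y ∈ C.bd → y ∈ range fun u => Φ (e u) := by
    intro y hy
    rw [← heb] at hy
    obtain ⟨u, hu⟩ := hy
    exact ⟨u, by simp only [hu, hΦΨ]⟩
  have hWint : ∀ y ∈ W, Ψ y ∈ C.int := fun y hy => by
    rcases hcon _ (hΨS y).1 with h | h
    · exact absurd hy (disjoint_left.1 hWd (hrange y h))
    · exact h
  have hclO : IsOpen (Ψ '' closure W)ᶜ := (hcl.image hΨ).isClosed.isOpen_compl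
  obtain ⟨x, hx, ⟨hxO, hxv⟩, hxc⟩ := C.isPreconnected_int (O ∩ {v}ᶜ) (Ψ '' closure W)ᶜ
    (hO.inter isOpen_compl_singleton) hclO (by
      intro x hx
      by_cases hxW : x ∈ Ψ '' closure W
      · left
        obtain ⟨y, hy, rfl⟩ := hxW
        have hyW : y ∈ W := by
          by_contra hyW
          have h1 : y ∈ frontier W := ⟨hy, fun h => hyW (interior_subset h)⟩
          obtain ⟨u, hu⟩ := hWf h1
          refine (C.int_subset hx).2 ?_
          rw [← hu]
          simp only
          rw [hΨΦ _ (heS u), ← heb]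
          exact mem_range_self u
        have h2 : Ψ y ∈ Φ ⁻¹' W ∩ (Sph (k + 1) \ {v}) := ⟨by rwa [mem_preimage, hΦΨ], hΨS y⟩
        rw [hOW] at h2
        exact ⟨h2.1, (hΨS y).2⟩
      · exact Or.inr hxW)
    ⟨Ψ w, hWint w hw, by
      have h2 : Ψ w ∈ Φ ⁻¹' W ∩ (Sph (k + 1) \ {v}) := ⟨by rwa [mem_preimage, hΦΨ], hΨS w⟩
      rw [hOW] at h2
      exact ⟨h2.1, (hΨS w).2⟩⟩
    ⟨v, hv, by
      rintro ⟨y, -, hy⟩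
      exact (hΨS y).2 hy⟩
  have hxS : x ∈ Sph (k + 1) \ {v} := ⟨(C.int_subset hx).1, hxv⟩
  have h3 : x ∈ Φ ⁻¹' W ∩ (Sph (k + 1) \ {v}) := by
    rw [hOW]
    exact ⟨hxO, hxS⟩
  exact hxc ⟨Φ x, subset_closure h3.1, hΨΦ x hxS⟩

lemma CrumpledCube.exists_chart : ∃ (Φ : Amb (k + 1) → Amb k) (Ψ : Amb k → Amb (k + 1)),
    ContinuousOn Φ C.carrier ∧ Continuous Ψ ∧ (∀ y, Φ (Ψ y) = y) ∧ (∀ x ∈ C.carrier, Ψ (Φ x) = x) ∧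
      CellData (Φ '' C.bd) (Φ '' C.int) := by
  obtain ⟨v, hvS, hvC⟩ := C.exists_not_mem_carrier
  obtain ⟨Φ, Ψ, hΦ, hΨ, hΨS, hΦΨ, hΨΦ⟩ := exists_stereographic hvS
  have hCS : C.carrier ⊆ Sph (k + 1) \ {v} := fun x hx =>
    ⟨C.carrier_subset hx, fun h => hvC (h ▸ hx)⟩
  have hΦC := hΦ.mono hCS
  have hinv : ∀ x ∈ C.carrier, Ψ (Φ x) = x := fun x hx => hΨΦ x (hCS hx)
  have himage : Φ '' C.int = Ψ ⁻¹' C.int := by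
    ext y
    constructor
    · rintro ⟨x, hx, rfl⟩
      rwa [mem_preimage, hinv x (Or.inr hx)]
    · exact fun hy => ⟨Ψ y, hy, hΦΨ y⟩
  have hopen : IsOpen (Φ '' C.int) := by
    rw [himage, Metric.isOpen_iff]
    intro y hy
    have h1 : IsOpen (Ψ ⁻¹' C.bd)ᶜ := (C.isCompact_bd.isClosed.preimage hΨ).isOpen_compl
    obtain ⟨r, hr, hrb⟩ := Metric.isOpen_iff.1 h1 y fun h => (C.int_subset hy).2 h
    refine ⟨r, hr, image_subset_iff.1 ?_⟩
    refine C.subset_int ((convex_ball y r).isPreconnected.image Ψ hΨ.continuousOn) ?_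
      ⟨Ψ y, mem_image_of_mem _ (mem_ball_self hr), hy⟩
    rintro _ ⟨z, hz, rfl⟩
    exact ⟨(hΨS z).1, hrb hz⟩
  have hcomp : IsCompact (Φ '' C.carrier) := C.isCompact_carrier.image_of_continuousOn hΦC
  have hunion : Φ '' C.carrier = Φ '' C.bd ∪ Φ '' C.int := image_union _ _ _
  obtain ⟨e, he, hi, heb⟩ := C.exists_embedding
  have heC : ∀ u, e u ∈ C.carrier := fun u => Or.inl (heb ▸ mem_range_self u)
  refine ⟨Φ, Ψ, hΦC, hΨ, hΦΨ, hinv, ⟨fun u => Φ (e u), hΦC.comp_continuous he heC, ?_, ?_⟩, hopen,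
    C.int_nonempty.image _, C.isPreconnected_int.image _ (hΦC.mono subset_union_right),
    hcomp.isBounded.subset (image_mono subset_union_right), ?_, ?_⟩
  · intro u u' h
    apply hi
    rw [← hinv _ (heC u), ← hinv _ (heC u')]
    exact congrArg Ψ h
  · rw [← heb, ← range_comp]
    rfl
  · refine disjoint_left.2 ?_
    rintro _ ⟨x, hx, rfl⟩ ⟨x', hx', h⟩
    have h1 := congrArg Ψ h
    rw [hinv x (Or.inl hx), hinv x' (Or.inr hx')] at h1
    exact (C.int_subset hx').2 (h1 ▸ hx)
  · rw [hopen.frontier_eq]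
    rintro y ⟨hy, hyi⟩
    have h1 : y ∈ Φ '' C.carrier :=
      closure_minimal (image_mono subset_union_right) hcomp.isClosed hy
    rw [hunion] at h1
    exact h1.resolve_right hyi

end Chart

lemma IsHomotopyTamingSet.squaresApprox_image {k : ℕ} {C : CrumpledCube (k + 1)}
    {T : Set (Amb (k + 1))} (hT : IsHomotopyTamingSet C T) {Φ : Amb (k + 1) → Amb k}
    {Ψ : Amb k → Amb (k + 1)} (hΦ : ContinuousOn Φ C.carrier) (hΨ : Continuous Ψ)
    (hΦΨ : ∀ y, Φ (Ψ y) = y) (hΨΦ : ∀ x ∈ C.carrier, Ψ (Φ x) = x) :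
    SquaresApprox (Φ '' T) (Φ '' C.bd) (Φ '' C.int) := by
  intro m hm ε hε
  have hmC : ∀ z, Ψ (m z) ∈ C.carrier := by
    intro z
    have h1 := hm z
    rw [← image_union] at h1
    obtain ⟨x, hx, hxz⟩ := h1
    rw [← hxz, hΨΦ x hx]
    exact hx
  obtain ⟨δ, hδ, hδε⟩ := Metric.uniformContinuousOn_iff.1
    (C.isCompact_carrier.uniformContinuousOn_of_continuous hΦ) ε hε
  obtain ⟨m', hm', hmT⟩ := hT.2
    ⟨fun z => ⟨Ψ (m z), hmC z⟩, (hΨ.comp m.continuous).subtype_mk _⟩ δ hδ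
  refine ⟨⟨fun z => Φ (m' z), hΦ.comp_continuous (by fun_prop) fun z => (m' z).2⟩,
    fun z => ?_, fun z => ?_⟩
  · have h1 := hδε _ (hmC z) _ (m' z).2 (hm' z)
    rwa [hΦΨ] at h1
  · rw [← image_union]
    exact mem_image_of_mem Φ (hmT z)

lemma SquaresApprox.isHomotopyTamingSet {k : ℕ} {D : CrumpledCube (k + 1)}
    {T : Set (Amb k)} {Φ : Amb (k + 1) → Amb k} {Ψ : Amb k → Amb (k + 1)}
    (hΦ : ContinuousOn Φ D.carrier) (hΨ : Continuous Ψ)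
    (hΨΦ : ∀ x ∈ D.carrier, Ψ (Φ x) = x) (hT : SquaresApprox T (Φ '' D.bd) (Φ '' D.int))
    {T' : Set (Amb (k + 1))} (hT' : T' ⊆ D.bd) (hTT' : MapsTo Ψ T T') :
    IsHomotopyTamingSet D T' := by
  refine ⟨hT', fun m ε hε => ?_⟩
  let m₀ : C(I × I, Amb k) :=
    ⟨fun z => Φ (m z), hΦ.comp_continuous (by fun_prop) fun z => (m z).2⟩
  have hcomp : IsCompact (range m₀) := isCompact_range m₀.continuous
  obtain ⟨δ, hδ, hδε⟩ := Metric.uniformContinuousOn_iff.1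
    ((hcomp.cthickening (r := 1)).uniformContinuousOn_of_continuous hΨ.continuousOn) ε hε
  obtain ⟨m₁, hm₁, hmT⟩ := hT m₀ (fun z => by
    rw [← image_union]
    exact mem_image_of_mem Φ (m z).2) (min δ 1) (lt_min hδ one_pos)
  have hmem : ∀ z, Ψ (m₁ z) ∈ T' ∪ D.int := fun z => by
    rcases hmT z with h | ⟨x, hx, hxz⟩
    · exact Or.inl (hTT' h)
    · right
      rwa [← hxz, hΨΦ x (Or.inr hx)]
  refine ⟨⟨fun z => ⟨Ψ (m₁ z), union_subset_union_left _ hT' (hmem z)⟩,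
    (hΨ.comp m₁.continuous).subtype_mk _⟩, fun z => ?_, hmem⟩
  have h1 : dist (Ψ (m₀ z)) (Ψ (m₁ z)) < ε := by
    refine hδε _ (self_subset_cthickening _ (mem_range_self z)) _ ?_
      ((hm₁ z).trans_le (min_le_left _ _))
    refine mem_cthickening_of_dist_le _ (m₀ z) _ _ (mem_range_self z) ?_
    rw [dist_comm]
    exact ((hm₁ z).trans_le (min_le_right _ _)).le
  have h2 : Ψ (m₀ z) = m z := hΨΦ _ (m z).2
  rw [h2] at h1
  exact h1

lemma IsHomotopyTamingSet.of_isAssociatedMap {k : ℕ} {C D : CrumpledCube (k + 1)}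
    {h : ↥C.bd ≃ₜ ↥D.bd} {f : ↥C.carrier → ↥D.carrier} (hf : IsAssociatedMap C D h f)
    {T : Set (Amb (k + 1))} (hT : IsHomotopyTamingSet C T) :
    IsHomotopyTamingSet D (bdImage h T) := by
  classical
  obtain ⟨Φ, Ψ, hΦ, hΨ, hΦΨ, hΨΦ, hC⟩ := C.exists_chart
  obtain ⟨Φ₂, Ψ₂, hΦ₂, hΨ₂, hΦΨ₂, hΨΦ₂, hD⟩ := D.exists_chart
  obtain ⟨hfc, hfh, hfb⟩ := hf
  have hsC : IsClosed (Φ '' C.carrier) := (C.isCompact_carrier.image_of_continuousOn hΦ).isClosed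
  have hsD : IsClosed (Φ₂ '' D.bd) := hD.isCompact_bd.isClosed
  have hΨC : ∀ y ∈ Φ '' C.carrier, Ψ y ∈ C.carrier := by
    rintro _ ⟨x, hx, rfl⟩
    rwa [hΨΦ x hx]
  have hΨD : ∀ y ∈ Φ₂ '' D.bd, Ψ₂ y ∈ D.bd := by
    rintro _ ⟨x, hx, rfl⟩
    rwa [hΨΦ₂ x (Or.inl hx)]
  obtain ⟨F, hF, hFeq⟩ := exists_continuous_extension hsC
    (f := fun y => if hy : Ψ y ∈ C.carrier then Φ₂ (f ⟨Ψ y, hy⟩) else 0) (by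
      rw [continuousOn_iff_continuous_domRestrict]
      have h1 : Continuous fun y : ↥(Φ '' C.carrier) => Φ₂ (f ⟨Ψ y, hΨC y y.2⟩) :=
        hΦ₂.comp_continuous (continuous_subtype_val.comp (hfc.comp
          ((hΨ.comp continuous_subtype_val).subtype_mk _))) fun y => (f _).2
      refine h1.congr fun y => ?_
      simp only [domRestrict_apply]
      rw [dif_pos (hΨC y y.2)])
  obtain ⟨G, hG, hGeq⟩ := exists_continuous_extension hsD
    (f := fun y => if hy : Ψ₂ y ∈ D.bd then Φ (h.symm ⟨Ψ₂ y, hy⟩) else 0) (by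
      rw [continuousOn_iff_continuous_domRestrict]
      have h1 : Continuous fun y : ↥(Φ₂ '' D.bd) => Φ (h.symm ⟨Ψ₂ y, hΨD y y.2⟩) :=
        hΦ.comp_continuous (continuous_subtype_val.comp (h.symm.continuous.comp
          ((hΨ₂.comp continuous_subtype_val).subtype_mk _))) fun y => Or.inl (h.symm _).2
      refine h1.congr fun y => ?_
      simp only [domRestrict_apply]
      rw [dif_pos (hΨD y y.2)])
  have hFx : ∀ x (hx : x ∈ C.carrier), F (Φ x) = Φ₂ (f ⟨x, hx⟩) := by
    intro x hx
    rw [hFeq (mem_image_of_mem Φ hx)]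
    simp only [hΨΦ x hx]
    rw [dif_pos hx]
  have hFb : ∀ x : ↥C.bd, F (Φ x) = Φ₂ (h x) := fun x => by
    rw [hFx x (Or.inl x.2), hfh _ x.2]
  have hGb : ∀ y : ↥D.bd, G (Φ₂ y) = Φ (h.symm y) := by
    intro y
    rw [hGeq (mem_image_of_mem Φ₂ y.2)]
    simp only [hΨΦ₂ y (Or.inl y.2)]
    rw [dif_pos y.2]
  have key := (hT.squaresApprox_image hΦ hΨ hΦΨ hΨΦ).image hC hD hF (by
      rintro _ ⟨x, hx, rfl⟩
      rw [hFb ⟨x, hx⟩]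
      exact mem_image_of_mem Φ₂ (h _).2) (by
      rintro _ ⟨x, hx, rfl⟩
      rw [hFx x (Or.inr hx)]
      refine mem_image_of_mem Φ₂ ((f _).2.resolve_left fun hb => ?_)
      exact (C.int_subset hx).2 ((hfb _).1 hb)) hG (by
      rintro _ ⟨y, hy, rfl⟩
      rw [hGb ⟨y, hy⟩]
      exact mem_image_of_mem Φ (h.symm _).2) (by
      rintro _ ⟨x, hx, rfl⟩
      rw [hFb ⟨x, hx⟩, hGb, h.symm_apply_apply]) (by
      rintro _ ⟨y, hy, rfl⟩
      rw [hGb ⟨y, hy⟩, hFb, h.apply_symm_apply])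
  refine key.isHomotopyTamingSet hΦ₂ hΨ₂ hΨΦ₂ ?_ ?_
  · rintro _ ⟨x, -, rfl⟩
    exact (h x).2
  · rintro _ ⟨_, ⟨x, hx, rfl⟩, rfl⟩
    refine ⟨⟨x, hT.1 hx⟩, hx, ?_⟩
    simp only
    rw [hFb ⟨x, hT.1 hx⟩, hΨΦ₂ _ (Or.inl (h _).2)]

/-- **Theorem 3.5.** If `(C,D,h) ∈ 𝒲_n` and `T` is a homotopy taming set for `C`, then
`h(T)` is a homotopy taming set for `D`. -/
theorem stmt5 (n : ℕ) (hn : 2 ≤ n) (C D : CrumpledCube n) (h : ↥C.bd ≃ₜ ↥D.bd)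
    (hW : MemW C D h) (T : Set (Amb n)) (hT : IsHomotopyTamingSet C T) :
    IsHomotopyTamingSet D (bdImage h T) := by
  obtain ⟨k, rfl⟩ : ∃ k, n = k + 1 := ⟨n - 1, by omega⟩
  obtain ⟨f, hf⟩ := hW
  exact hT.of_isAssociatedMap hf
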